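/- Fix ε > 0 and an integer k ≥ 1. There exists an integer Δ_{ε,k} such that for every planar simple graph G with maximum degree Δ(G) ≥ Δ_{ε,k}, the k-frugal choice number satisfies ch_k(G) ≤ (3 + ε)·Δ(G)/(2k). -/

import Mathlib

open SimpleGraph

/-- A drawing of a simple graph in the plane: vertices are mapped to distinct points,
edges to arcs (injective continuous curves parametrised on `[0,1]`) joining the images of
their endpoints, whose interiors avoid the vertex points and each other. -/
structure PlaneEmbedding {V : Type*} (G : SimpleGraph V) where
  pos : V → ℝ × ℝ
  inj : Function.Injective pos
  arc : G.edgeSet → ℝ → ℝ × ℝ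
  arc_cont : ∀ e, ContinuousOn (arc e) (Set.Icc 0 1)
  arc_inj : ∀ e, Set.InjOn (arc e) (Set.Icc 0 1)
  arc_ends : ∀ e : G.edgeSet, ∃ u v : V, (e : Sym2 V) = s(u, v) ∧
      arc e 0 = pos u ∧ arc e 1 = pos v
  arc_avoid : ∀ e : G.edgeSet, ∀ t ∈ Set.Ioo (0:ℝ) 1, arc e t ∉ Set.range pos
  arc_disjoint : ∀ e f : G.edgeSet, e ≠ f → ∀ s ∈ Set.Ioo (0:ℝ) 1, ∀ t ∈ Set.Ioo (0:ℝ) 1,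
      arc e s ≠ arc f t

/-- A graph is planar if it admits a drawing in the plane. -/
def SimpleGraph.IsPlanar {V : Type*} (G : SimpleGraph V) : Prop :=
  Nonempty (PlaneEmbedding G)

/-- A `k`-frugal colouring: a proper vertex colouring in which no colour appears more than
`k` times in the neighbourhood of any vertex. -/
def SimpleGraph.IsFrugalColoring {V α : Type*} (G : SimpleGraph V) (k : ℕ) (c : V → α) : Prop :=
  (∀ u v, G.Adj u v → c u ≠ c v) ∧
  ∀ (v : V) (a : α), {u | u ∈ G.neighborSet v ∧ c u = a}.ncard ≤ k

/-- The `k`-frugal choice number `ch_k(G)`: the least `t` such that any assignment of lists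
of `t` integers to the vertices admits a `k`-frugal colouring from the lists. -/
noncomputable def SimpleGraph.frugalChoiceNumber {V : Type*} (G : SimpleGraph V) (k : ℕ) : ℕ :=
  sInf {t : ℕ | ∀ L : V → Finset ℤ, (∀ v, (L v).card = t) →
    ∃ c : V → ℤ, (∀ v, c v ∈ L v) ∧ G.IsFrugalColoring k c}

namespace FrugalPlanar

/-- The vertex set `s` is nonempty and induces a connected subgraph of `G`. -/
def ConnOn {V : Type} (G : SimpleGraph V) (s : Set V) : Prop :=
  s.Nonempty ∧ ∀ a ∈ s, ∀ b ∈ s, Relation.ReflTransGen (fun p q => G.Adj p q ∧ q ∈ s) a b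

/-- `H` is a minor of `G`, witnessed by a partial map from `G` to `H` with connected fibres. -/
def HasMinor {U V : Type} (H : SimpleGraph U) (G : SimpleGraph V) : Prop :=
  ∃ f : V → Option U, (∀ u, ConnOn G {v | f v = some u}) ∧
    ∀ u u', H.Adj u u' → ∃ v v', f v = some u ∧ f v' = some u' ∧ G.Adj v v'

/-- `G` has no `K₃,₃` minor. -/
def NoK33 {V : Type} (G : SimpleGraph V) : Prop :=
  ¬ HasMinor (completeBipartiteGraph (Fin 3) (Fin 3)) G

section Minors

variable {U V W : Type}

theorem HasMinor.trans {K : SimpleGraph W} {H : SimpleGraph U} {G : SimpleGraph V}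
    (h₁ : HasMinor K H) (h₂ : HasMinor H G) : HasMinor K G := by
  obtain ⟨g, hg, hg'⟩ := h₁
  obtain ⟨f, hf, hf'⟩ := h₂
  refine ⟨fun v => (f v).bind g, fun w => ⟨?_, ?_⟩, ?_⟩
  · obtain ⟨u, hu⟩ := (hg w).1
    obtain ⟨v, hv⟩ := (hf u).1
    refine ⟨v, ?_⟩
    simp only [Set.mem_ofPred_eq] at hu hv ⊢
    simp [hv, hu]
  · have inner : ∀ u, g u = some w → ∀ a b, f a = some u → f b = some u →
        Relation.ReflTransGen (fun p q => G.Adj p q ∧ q ∈ {v | (f v).bind g = some w}) a b := by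
      intro u hu a b ha hb
      refine Relation.ReflTransGen.mono ?_ _ _ ((hf u).2 a ha b hb)
      rintro p q ⟨hpq, hq⟩
      refine ⟨hpq, ?_⟩
      simp only [Set.mem_ofPred_eq] at hq ⊢
      simp [hq, hu]
    have outer : ∀ u u', g u = some w →
        Relation.ReflTransGen (fun p q => H.Adj p q ∧ q ∈ {u | g u = some w}) u u' →
        g u' = some w ∧ ∀ a b, f a = some u → f b = some u' →
        Relation.ReflTransGen (fun p q => G.Adj p q ∧ q ∈ {v | (f v).bind g = some w}) a b := by
      intro u u' hu hr
      induction hr with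
      | refl => exact ⟨hu, inner u hu⟩
      | tail _ h ih =>
        obtain ⟨hadj, hc⟩ := h
        refine ⟨hc, fun a b ha hb => ?_⟩
        obtain ⟨v, v', hv, hv', hvv⟩ := hf' _ _ hadj
        refine ((ih.2 a v ha hv).tail ⟨hvv, ?_⟩).trans (inner _ hc v' b hv' hb)
        simp only [Set.mem_ofPred_eq] at hc ⊢
        simp [hv', hc]
    intro a ha b hb
    simp only [Set.mem_ofPred_eq, Option.bind_eq_some_iff] at ha hb
    obtain ⟨u, hau, hu⟩ := ha
    obtain ⟨u', hbu, hu'⟩ := hb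
    exact (outer u u' hu ((hg w).2 u hu u' hu')).2 a b hau hbu
  · intro w w' hw
    obtain ⟨u, u', hu, hu', huu⟩ := hg' w w' hw
    obtain ⟨v, v', hv, hv', hvv⟩ := hf' u u' huu
    exact ⟨v, v', by simp [hv, hu], by simp [hv', hu'], hvv⟩

theorem HasMinor.of_star {H : SimpleGraph U} {G : SimpleGraph V} (f : V → Option U) (r : U → V)
    (hr : ∀ u, f (r u) = some u)
    (hf : ∀ v u, f v = some u → v = r u ∨ G.Adj v (r u))
    (hH : ∀ u u', H.Adj u u' → ∃ v v', f v = some u ∧ f v' = some u' ∧ G.Adj v v') :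
    HasMinor H G := by
  refine ⟨f, fun u => ⟨⟨r u, hr u⟩, ?_⟩, hH⟩
  intro a ha b hb
  have to_center : Relation.ReflTransGen (fun p q => G.Adj p q ∧ q ∈ {v | f v = some u}) a (r u) := by
    rcases hf a u ha with rfl | h
    · exact .refl
    · exact .single ⟨h, hr u⟩
  refine to_center.trans ?_
  rcases hf b u hb with rfl | h
  · exact .refl
  · exact .single ⟨h.symm, hb⟩

theorem HasMinor.of_injective {H : SimpleGraph U} {G : SimpleGraph V} (φ : U → V)
    (hφ : Function.Injective φ) (h : ∀ u u', H.Adj u u' → G.Adj (φ u) (φ u')) :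
    HasMinor H G := by
  classical
  have hinv : ∀ u, (if h : ∃ u', φ u' = φ u then some h.choose else none) = some u := by
    intro u
    have h : ∃ u', φ u' = φ u := ⟨u, rfl⟩
    rw [dif_pos h]
    exact congrArg some (hφ h.choose_spec)
  refine HasMinor.of_star (fun v => if h : ∃ u, φ u = v then some h.choose else none) φ hinv ?_ ?_
  · intro v u hv
    by_cases hx : ∃ u, φ u = v
    · rw [dif_pos hx] at hv
      left
      rw [← Option.some.inj hv, hx.choose_spec]
    · rw [dif_neg hx] at hv
      cases hv
  · exact fun u u' huu => ⟨φ u, φ u', hinv u, hinv u', h u u' huu⟩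

theorem NoK33.of_hasMinor {H : SimpleGraph U} {G : SimpleGraph V} (hG : NoK33 G)
    (h : HasMinor H G) : NoK33 H := fun h' => hG (h'.trans h)

theorem NoK33.of_star {H : SimpleGraph U} {G : SimpleGraph V} (hG : NoK33 G)
    (f : V → Option U) (r : U → V) (hr : ∀ u, f (r u) = some u)
    (hf : ∀ v u, f v = some u → v = r u ∨ G.Adj v (r u))
    (hH : ∀ u u', H.Adj u u' → ∃ v v', f v = some u ∧ f v' = some u' ∧ G.Adj v v') :
    NoK33 H := hG.of_hasMinor (.of_star f r hr hf hH)

theorem NoK33.of_injective {H : SimpleGraph U} {G : SimpleGraph V} (hG : NoK33 G) (φ : U → V)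
    (hφ : Function.Injective φ) (h : ∀ u u', H.Adj u u' → G.Adj (φ u) (φ u')) : NoK33 H :=
  hG.of_hasMinor (.of_injective φ hφ h)

/-- Three vertices of a graph without `K₃,₃` minor have at most two common neighbours. -/
theorem NoK33.card_common_le {G : SimpleGraph V} (hG : NoK33 G) {x y z : V} (hxy : x ≠ y)
    (hxz : x ≠ z) (hyz : y ≠ z) (S : Finset V)
    (hS : ∀ s ∈ S, G.Adj s x ∧ G.Adj s y ∧ G.Adj s z) : S.card ≤ 2 := by
  by_contra hcard
  obtain ⟨a, ha, b, hb, c, hc, hab, hac, hbc⟩ := Finset.two_lt_card.1 (not_le.1 hcard)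
  have hadj : ∀ i j, G.Adj (![a, b, c] i) (![x, y, z] j) := by
    have h1 := hS a ha
    have h2 := hS b hb
    have h3 := hS c hc
    intro i j
    fin_cases i <;> fin_cases j <;> simp_all
  refine hG (.of_injective (Sum.elim ![a, b, c] ![x, y, z]) ?_ ?_)
  · refine Function.Injective.sumElim ?_ ?_ fun i j => (hadj i j).ne
    · intro i j h
      fin_cases i <;> fin_cases j <;> simp_all
    · intro i j h
      fin_cases i <;> fin_cases j <;> simp_all
  · rintro (i | i) (j | j) h
    · simp at h
    · exact hadj i j
    · exact (hadj j i).symm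
    · simp at h

end Minors

end FrugalPlanar

namespace FrugalPlanar

section Curves

theorem exists_continuous_log {X : Type} [TopologicalSpace X] [SimplyConnectedSpace X]
    [LocallyPathConnectedSpace X] (g : X → ℂ) (hg : Continuous g) (h0 : ∀ x, g x ≠ 0) :
    ∃ h : X → ℂ, Continuous h ∧ ∀ x, Complex.exp (h x) = g x := by
  obtain ⟨x₀⟩ : Nonempty X := inferInstance
  obtain ⟨f, ⟨-, hf⟩, -⟩ := Complex.isCoveringMapOn_exp.existsUnique_continuousMap_lifts
    ⟨g, hg⟩ (Complex.exp_log (h0 x₀)) (fun x => h0 x)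
  exact ⟨f, f.continuous, fun x => congrFun hf x⟩

theorem log_variation_unique (g h₁ h₂ : ℝ → ℂ) (c₁ : Continuous h₁) (c₂ : Continuous h₂)
    (e₁ : ∀ x, Complex.exp (h₁ x) = g x) (e₂ : ∀ x, Complex.exp (h₂ x) = g x) :
    h₁ 1 - h₁ 0 = h₂ 1 - h₂ 0 := by
  have hg : Continuous g := by
    have : g = fun x => Complex.exp (h₁ x) := funext fun x => (e₁ x).symm
    rw [this]
    fun_prop
  have h0 : ∀ x, g x ≠ 0 := fun x => by rw [← e₁]; exact Complex.exp_ne_zero _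
  obtain ⟨F, -, huniq⟩ := Complex.isCoveringMapOn_exp.existsUnique_continuousMap_lifts
    ⟨g, hg⟩ (e₁ 0) (fun x => h0 x)
  have hexp : Complex.exp (h₁ 0 - h₂ 0) = 1 := by
    rw [Complex.exp_sub, e₁, e₂, div_self (h0 0)]
  have k₁ := huniq ⟨h₁, c₁⟩ ⟨rfl, funext e₁⟩
  have k₂ := huniq ⟨fun x => h₂ x + (h₁ 0 - h₂ 0), by fun_prop⟩
    ⟨by simp, funext fun x => by simp [Complex.exp_add, hexp, e₂]⟩
  have := congrArg (fun f : C(ℝ, ℂ) => f 1) (k₁.trans k₂.symm)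
  simp only [ContinuousMap.coe_mk] at this
  rw [this]
  ring

open Classical in
/-- The variation along `[0, 1]` of a continuous logarithm of `t ↦ f t - u`. -/
noncomputable def logVariation (u : ℂ) (f : ℝ → ℂ) : ℂ :=
  if h : ∃ h : ℝ → ℂ, Continuous h ∧ ∀ x, Complex.exp (h x) = f x - u then
    h.choose 1 - h.choose 0 else 0

theorem logVariation_eq (u : ℂ) (f h : ℝ → ℂ) (hc : Continuous h)
    (he : ∀ x, Complex.exp (h x) = f x - u) : logVariation u f = h 1 - h 0 := by
  have hex : ∃ h : ℝ → ℂ, Continuous h ∧ ∀ x, Complex.exp (h x) = f x - u := ⟨h, hc, he⟩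
  rw [logVariation, dif_pos hex]
  exact log_variation_unique _ _ _ hex.choose_spec.1 hc hex.choose_spec.2 he

theorem logVariation_eq_log (u : ℂ) (f : ℝ → ℂ) (hf : Continuous f) (h0 : ∀ t, f t ≠ u) :
    ∃ n : ℤ, logVariation u f =
      Complex.log (f 1 - u) - Complex.log (f 0 - u) + 2 * n * (Real.pi * Complex.I) := by
  obtain ⟨h, hc, he⟩ := exists_continuous_log (fun t => f t - u) (by fun_prop)
    (fun t => sub_ne_zero.2 (h0 t))
  rw [logVariation_eq u f h hc he]
  have key : ∀ t, ∃ n : ℤ, h t = Complex.log (f t - u) + n * (2 * Real.pi * Complex.I) := by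
    intro t
    refine Complex.exp_eq_exp_iff_exists_int.1 ?_
    rw [he, Complex.exp_log (sub_ne_zero.2 (h0 t))]
  obtain ⟨a, ha⟩ := key 1
  obtain ⟨b, hb⟩ := key 0
  refine ⟨a - b, ?_⟩
  rw [ha, hb]
  push_cast
  ring

theorem logVariation_square (f g : ℝ → ℂ) (hf : Continuous f) (hg : Continuous g)
    (h0 : ∀ s t, f s ≠ g t) :
    logVariation (f 0) g + logVariation (g 1) f = logVariation (g 0) f + logVariation (f 1) g := by
  obtain ⟨H, hc, he⟩ := exists_continuous_log (fun x : ℝ × ℝ => g x.2 - f x.1) (by fun_prop)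
    (fun x => sub_ne_zero.2 (h0 x.1 x.2).symm)
  have hg' : ∀ s, logVariation (f s) g = H (s, 1) - H (s, 0) := fun s =>
    logVariation_eq (f s) g (fun t => H (s, t)) (by fun_prop) fun t => he (s, t)
  have hf' : ∀ t, logVariation (g t) f = H (1, t) - H (0, t) := by
    intro t
    rw [logVariation_eq (g t) f (fun s => H (s, t) + Real.pi * Complex.I) (by fun_prop) ?_]
    · ring
    · intro s
      rw [Complex.exp_add, he, Complex.exp_pi_mul_I]
      ring
  rw [hg', hg', hf', hf']
  ring

theorem exists_log_sub_log_neg (z : ℂ) (hz : z ≠ 0) :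
    ∃ n : ℤ, Complex.log z - Complex.log (-z) = (2 * n + 1) * (Real.pi * Complex.I) := by
  have : Complex.exp (Complex.log z) = Complex.exp (Complex.log (-z) + Real.pi * Complex.I) := by
    rw [Complex.exp_add, Complex.exp_log hz, Complex.exp_log (neg_ne_zero.2 hz),
      Complex.exp_pi_mul_I]
    ring
  obtain ⟨n, hn⟩ := Complex.exp_eq_exp_iff_exists_int.1 this
  refine ⟨n, ?_⟩
  rw [hn]
  ring

/-- There are no nine curves realising `K₃,₃` such that independent ones are disjoint. -/
theorem no_curve_K33 (p q : Fin 3 → ℂ) (γ : Fin 3 → Fin 3 → ℝ → ℂ)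
    (hc : ∀ i j, Continuous (γ i j)) (h0 : ∀ i j, γ i j 0 = p i) (h1 : ∀ i j, γ i j 1 = q j)
    (hd : ∀ i j k l, i ≠ k → j ≠ l → ∀ s t, γ i j s ≠ γ k l t) : False := by
  have hother : ∀ i : Fin 3, ∃ k, i ≠ k := by decide
  have hp : ∀ i k, i ≠ k → p i ≠ p k := by
    intro i k hik
    rw [← h0 i 0, ← h0 k 1]
    exact hd _ _ _ _ hik (by decide) _ _
  have hq : ∀ i k, i ≠ k → q i ≠ q k := by
    intro i k hik
    rw [← h1 0 i, ← h1 1 k]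
    exact hd _ _ _ _ (by decide) hik _ _
  have hpq : ∀ i l, q l ≠ p i := by
    intro i l
    obtain ⟨k, hk⟩ := hother i
    obtain ⟨j, hj⟩ := hother l
    rw [← h0 i j, ← h1 k l]
    exact hd _ _ _ _ hk.symm hj _ _
  have hA : ∀ i k l, ∃ n : ℤ, i ≠ k → logVariation (p i) (γ k l) =
      Complex.log (q l - p i) - Complex.log (p k - p i) + 2 * n * (Real.pi * Complex.I) := by
    intro i k l
    by_cases hik : i = k
    · exact ⟨0, fun h => absurd hik h⟩
    obtain ⟨j, hj⟩ := hother l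
    obtain ⟨n, hn⟩ := logVariation_eq_log (p i) (γ k l) (hc k l) fun t => by
      rw [← h0 i j]
      exact hd _ _ _ _ (Ne.symm hik) hj _ _
    exact ⟨n, fun _ => by rw [hn, h1, h0]⟩
  have hB : ∀ l i j, ∃ n : ℤ, j ≠ l → logVariation (q l) (γ i j) =
      Complex.log (q j - q l) - Complex.log (p i - q l) + 2 * n * (Real.pi * Complex.I) := by
    intro l i j
    by_cases hjl : j = l
    · exact ⟨0, fun h => absurd hjl h⟩
    obtain ⟨k, hk⟩ := hother i
    obtain ⟨n, hn⟩ := logVariation_eq_log (q l) (γ i j) (hc i j) fun t => by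
      rw [← h1 k l]
      exact hd _ _ _ _ hk hjl _ _
    exact ⟨n, fun _ => by rw [hn, h1, h0]⟩
  have hab : ∀ i l, ∃ n : ℤ, Complex.log (q l - p i) - Complex.log (p i - q l) =
      (2 * n + 1) * (Real.pi * Complex.I) := by
    intro i l
    simpa using exists_log_sub_log_neg _ (sub_ne_zero.2 (hpq i l))
  have haa : ∀ i k, ∃ n : ℤ, i ≠ k → Complex.log (p k - p i) - Complex.log (p i - p k) =
      (2 * n + 1) * (Real.pi * Complex.I) := by
    intro i k
    by_cases hik : i = k
    · exact ⟨0, fun h => absurd hik h⟩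
    obtain ⟨n, hn⟩ := exists_log_sub_log_neg _ (sub_ne_zero.2 (hp k i (Ne.symm hik)))
    exact ⟨n, fun _ => by simpa using hn⟩
  have hbb : ∀ i k, ∃ n : ℤ, i ≠ k → Complex.log (q k - q i) - Complex.log (q i - q k) =
      (2 * n + 1) * (Real.pi * Complex.I) := by
    intro i k
    by_cases hik : i = k
    · exact ⟨0, fun h => absurd hik h⟩
    obtain ⟨n, hn⟩ := exists_log_sub_log_neg _ (sub_ne_zero.2 (hq k i (Ne.symm hik)))
    exact ⟨n, fun _ => by simpa using hn⟩
  choose nA hA using hA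
  choose nB hB using hB
  choose sab hab using hab
  choose saa haa using haa
  choose sbb hbb using hbb
  have hpi : (Real.pi * Complex.I : ℂ) ≠ 0 := by simp [Real.pi_ne_zero]
  have anti : ∀ l j, j ≠ l → sbb l j + sbb j l + 1 = 0 := by
    intro l j hjl
    have e₁ := hbb l j hjl.symm
    have e₂ := hbb j l hjl
    have : ((2 * (sbb l j + sbb j l + 1) : ℤ) : ℂ) * (Real.pi * Complex.I) = 0 := by
      push_cast
      linear_combination -e₁ - e₂
    have := (mul_eq_zero.1 this).resolve_right hpi
    have : (2 * (sbb l j + sbb j l + 1) : ℤ) = 0 := by exact_mod_cast this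
    omega
  have main : ∀ i k j l, i ≠ k → j ≠ l →
      2 * sab i l - 2 * sab k j - (2 * saa i k + 1) + (2 * sbb l j + 1) +
      2 * (nA i k l + nB l i j - nA k i j - nB j k l) = 0 := by
    intro i k j l hik hjl
    have sq := logVariation_square (γ i j) (γ k l) (hc i j) (hc k l) (hd i j k l hik hjl)
    rw [h0, h1, h0, h1, hA i k l hik, hB l i j hjl, hA k i j hik.symm, hB j k l hjl.symm] at sq
    have e₁ := hab i l
    have e₂ := hab k j
    have e₃ := haa i k hik
    have e₄ := hbb l j hjl.symm
    have : ((2 * sab i l - 2 * sab k j - (2 * saa i k + 1) + (2 * sbb l j + 1) +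
      2 * (nA i k l + nB l i j - nA k i j - nB j k l) : ℤ) : ℂ) * (Real.pi * Complex.I) = 0 := by
      push_cast
      linear_combination sq - e₁ + e₂ + e₃ - e₄
    exact_mod_cast (mul_eq_zero.1 this).resolve_right hpi
  have a01 := anti 0 1 (by decide)
  have a02 := anti 0 2 (by decide)
  have a12 := anti 1 2 (by decide)
  have row : ∀ i k, i ≠ k →
      2 * (2 * (sab i 0 + sab i 1 + sab i 2) - 2 * (sab k 0 + sab k 1 + sab k 2)) -
      6 * (2 * saa i k + 1) +
      4 * (nA i k 0 + nA i k 1 + nA i k 2) - 4 * (nA k i 0 + nA k i 1 + nA k i 2) +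
      2 * (nB 0 i 1 + nB 0 i 2 + nB 1 i 0 + nB 1 i 2 + nB 2 i 0 + nB 2 i 1) -
      2 * (nB 0 k 1 + nB 0 k 2 + nB 1 k 0 + nB 1 k 2 + nB 2 k 0 + nB 2 k 1) = 0 := by
    intro i k hik
    have m01 := main i k 0 1 hik (by decide)
    have m02 := main i k 0 2 hik (by decide)
    have m10 := main i k 1 0 hik (by decide)
    have m12 := main i k 1 2 hik (by decide)
    have m20 := main i k 2 0 hik (by decide)
    have m21 := main i k 2 1 hik (by decide)
    linarith
  have r01 := row 0 1 (by decide)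
  have r02 := row 0 2 (by decide)
  have r12 := row 1 2 (by decide)
  omega

end Curves

end FrugalPlanar

namespace FrugalPlanar

section Planarity

variable {V : Type} {G : SimpleGraph V}

/-- The part of the drawing formed by the vertices in `s` and the edges inside `s`. -/
def drawing (E : PlaneEmbedding G) (s : Set V) : Set (ℝ × ℝ) :=
  {x | (∃ v ∈ s, x = E.pos v) ∨
    ∃ e : G.edgeSet, (∀ v ∈ (e : Sym2 V), v ∈ s) ∧ ∃ t ∈ Set.Ioo (0 : ℝ) 1, x = E.arc e t}

theorem disjoint_drawing (E : PlaneEmbedding G) {s s' : Set V} (h : Disjoint s s') :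
    Disjoint (drawing E s) (drawing E s') := by
  rw [Set.disjoint_left] at h ⊢
  rintro x (⟨v, hv, rfl⟩ | ⟨e, he, t, ht, rfl⟩) (⟨v', hv', hx⟩ | ⟨e', he', t', ht', hx⟩)
  · exact h hv (E.inj hx ▸ hv')
  · exact E.arc_avoid e' t' ht' ⟨v, hx⟩
  · exact E.arc_avoid e t ht ⟨v', hx.symm⟩
  · by_cases hee : e = e'
    · subst hee
      obtain ⟨u, w, hu, -, -⟩ := E.arc_ends e
      have : u ∈ (e : Sym2 V) := by rw [hu]; exact Sym2.mem_mk_left _ _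
      exact h (he u this) (he' u this)
    · exact E.arc_disjoint e e' hee t ht t' ht' hx

theorem joinedIn_drawing_of_adj (E : PlaneEmbedding G) {s : Set V} {u v : V} (hu : u ∈ s)
    (hv : v ∈ s) (h : G.Adj u v) : JoinedIn (drawing E s) (E.pos u) (E.pos v) := by
  let e : G.edgeSet := ⟨s(u, v), h⟩
  have hmem : ∀ w ∈ (e : Sym2 V), w ∈ s := by
    intro w hw
    rcases Sym2.mem_iff.1 hw with rfl | rfl <;> assumption
  obtain ⟨a, b, hab, h0, h1⟩ := E.arc_ends e
  have ha : a ∈ s := hmem a (by rw [hab]; exact Sym2.mem_mk_left _ _)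
  have hb : b ∈ s := hmem b (by rw [hab]; exact Sym2.mem_mk_right _ _)
  have hjoin : JoinedIn (drawing E s) (E.pos a) (E.pos b) := by
    refine JoinedIn.ofLine (E.arc_cont e) h0 h1 ?_
    rintro _ ⟨t, ⟨ht0, ht1⟩, rfl⟩
    rcases ht0.eq_or_lt with rfl | ht0
    · exact Or.inl ⟨a, ha, h0⟩
    rcases ht1.eq_or_lt with rfl | ht1
    · exact Or.inl ⟨b, hb, h1⟩
    · exact Or.inr ⟨e, hmem, t, ⟨ht0, ht1⟩, rfl⟩
  have hab' : s(u, v) = s(a, b) := hab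
  rcases Sym2.eq_iff.1 hab' with ⟨rfl, rfl⟩ | ⟨rfl, rfl⟩
  · exact hjoin
  · exact hjoin.symm

theorem joinedIn_drawing (E : PlaneEmbedding G) {s : Set V} {u v : V} (hu : u ∈ s)
    (h : Relation.ReflTransGen (fun p q => G.Adj p q ∧ q ∈ s) u v) :
    v ∈ s ∧ JoinedIn (drawing E s) (E.pos u) (E.pos v) := by
  induction h with
  | refl => exact ⟨hu, JoinedIn.refl (Or.inl ⟨u, hu, rfl⟩)⟩
  | tail _ h ih => exact ⟨h.2, ih.2.trans (joinedIn_drawing_of_adj E ih.1 h.2 h.1)⟩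

/-- Planar graphs have no `K₃,₃` minor. -/
theorem noK33_of_isPlanar (hG : G.IsPlanar) : NoK33 G := by
  obtain ⟨E⟩ := hG
  rintro ⟨f, hconn, hedge⟩
  choose c hc using fun u => (hconn u).1
  let s : Fin 3 → Fin 3 → Set V := fun i j => {v | f v = some (.inl i) ∨ f v = some (.inr j)}
  have hjoin : ∀ i j, JoinedIn (drawing E (s i j)) (E.pos (c (.inl i))) (E.pos (c (.inr j))) := by
    intro i j
    obtain ⟨v, v', hv, hv', hvv⟩ := hedge (.inl i) (.inr j) (by simp)
    have r₁ : Relation.ReflTransGen (fun p q => G.Adj p q ∧ q ∈ s i j) (c (.inl i)) v :=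
      Relation.ReflTransGen.mono (fun p q h => ⟨h.1, Or.inl h.2⟩) _ _
        ((hconn (.inl i)).2 _ (hc _) v hv)
    have r₂ : Relation.ReflTransGen (fun p q => G.Adj p q ∧ q ∈ s i j) v' (c (.inr j)) :=
      Relation.ReflTransGen.mono (fun p q h => ⟨h.1, Or.inr h.2⟩) _ _
        ((hconn (.inr j)).2 v' hv' _ (hc _))
    exact (joinedIn_drawing E (Or.inl (hc _)) ((r₁.tail ⟨hvv, Or.inr hv'⟩).trans r₂)).2
  have hdisj : ∀ i j k l, i ≠ k → j ≠ l → Disjoint (s i j) (s k l) := by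
    intro i j k l hik hjl
    rw [Set.disjoint_left]
    rintro v (hv | hv) (hv' | hv') <;> rw [hv] at hv' <;> simp_all
  choose γ hγ using hjoin
  let e := Complex.equivRealProdCLM.symm
  have hmem : ∀ i j t, (γ i j).extend t ∈ drawing E (s i j) := fun i j t =>
    hγ i j (Set.projIcc 0 1 zero_le_one t)
  refine no_curve_K33 (fun i => e (E.pos (c (.inl i)))) (fun j => e (E.pos (c (.inr j))))
    (fun i j t => e ((γ i j).extend t)) ?_ ?_ ?_ ?_
  · intro i j
    exact e.continuous.comp (γ i j).continuous_extend
  · simp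
  · simp
  · intro i j k l hik hjl t t' heq
    have := disjoint_drawing E (hdisj i j k l hik hjl)
    rw [Set.disjoint_left] at this
    exact this (hmem i j t) (by rw [e.injective heq]; exact hmem k l t')

end Planarity

end FrugalPlanar

namespace FrugalPlanar

section Sparsity

open scoped Classical in
/-- The ordered pairs of adjacent vertices. -/
noncomputable def adjPairs {V : Type} [Fintype V] (G : SimpleGraph V) : Finset (V × V) :=
  Finset.univ.filter fun p => G.Adj p.1 p.2

open scoped Classical in
/-- The neighbourhood of a vertex as a finset. -/
noncomputable def nbrs {V : Type} [Fintype V] (G : SimpleGraph V) (v : V) : Finset V :=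
  Finset.univ.filter fun w => G.Adj v w

variable {V : Type} [Fintype V]

theorem mem_adjPairs {G : SimpleGraph V} {p : V × V} : p ∈ adjPairs G ↔ G.Adj p.1 p.2 := by
  simp [adjPairs]

theorem mem_nbrs {G : SimpleGraph V} {v w : V} : w ∈ nbrs G v ↔ G.Adj v w := by
  simp [nbrs]

theorem card_adjPairs (G : SimpleGraph V) : (adjPairs G).card = ∑ v, (nbrs G v).card := by
  classical
  have : adjPairs G = (Finset.univ : Finset V).biUnion fun v => (nbrs G v).image fun w => (v, w) := by
    ext ⟨a, b⟩
    simp [mem_adjPairs, mem_nbrs]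
  rw [this, Finset.card_biUnion]
  · refine Finset.sum_congr rfl fun v _ => Finset.card_image_of_injective _ fun a b h => ?_
    exact (Prod.mk.inj h).2
  · intro a _ b _ hab
    rw [Function.onFun, Finset.disjoint_left]
    rintro ⟨x, y⟩ h₁ h₂
    simp only [Finset.mem_image, Prod.mk.injEq] at h₁ h₂
    obtain ⟨_, _, rfl, _⟩ := h₁
    obtain ⟨_, _, rfl, _⟩ := h₂
    exact hab rfl

/-- A graph with at most `2 * C + 2` vertices and minimum degree at least `C` contains `K₃,₃`. -/
theorem not_noK33_of_dense [DecidableEq V] (G : SimpleGraph V) (S : Finset V) (hne : S.Nonempty)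
    (hS : S.card ≤ 242) (hdeg : ∀ v ∈ S, 120 ≤ (nbrs G v ∩ S).card) : ¬ NoK33 G := by
  classical
  intro hG
  have hcard : 7 ≤ S.card := by
    obtain ⟨v, hv⟩ := hne
    have := hdeg v hv
    have := Finset.card_le_card (Finset.inter_subset_right (s₁ := nbrs G v) (s₂ := S))
    omega
  obtain ⟨Q, hQS, hQ⟩ := Finset.exists_subset_card_eq hcard
  let T := S.filter fun u => 3 ≤ (nbrs G u ∩ Q).card
  have hcount : ∑ v ∈ Q, (nbrs G v ∩ S).card = ∑ u ∈ S, (nbrs G u ∩ Q).card := by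
    have e₁ : ∀ v, (nbrs G v ∩ S).card = ∑ u ∈ S, if G.Adj v u then 1 else 0 := by
      intro v
      rw [Finset.sum_boole, Nat.cast_id]
      congr 1
      ext u
      simp [mem_nbrs, and_comm]
    have e₂ : ∀ u, (nbrs G u ∩ Q).card = ∑ v ∈ Q, if G.Adj v u then 1 else 0 := by
      intro v
      rw [Finset.sum_boole, Nat.cast_id]
      congr 1
      ext u
      simp [mem_nbrs, and_comm, G.adj_comm]
    simp only [e₁, e₂]
    exact Finset.sum_comm
  have hlow : 7 * 120 ≤ ∑ v ∈ Q, (nbrs G v ∩ S).card := by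
    rw [← hQ, ← smul_eq_mul]
    exact Finset.card_nsmul_le_sum _ _ _ fun v hv => hdeg v (hQS hv)
  have hup : ∑ u ∈ S, (nbrs G u ∩ Q).card ≤ 2 * S.card + 5 * T.card := by
    have : ∀ u ∈ S, (nbrs G u ∩ Q).card ≤ 2 + 5 * (if 3 ≤ (nbrs G u ∩ Q).card then 1 else 0) := by
      intro u _
      have := Finset.card_le_card (Finset.inter_subset_right (s₁ := nbrs G u) (s₂ := Q))
      split_ifs <;> omega
    refine (Finset.sum_le_sum this).trans ?_
    rw [Finset.sum_add_distrib, ← Finset.mul_sum, Finset.sum_boole]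
    simp [T, mul_comm]
  have hT : 2 * 35 < T.card := by omega
  have hsub : ∀ u ∈ T, ∃ t ∈ Q.powersetCard 3, t ⊆ nbrs G u := by
    intro u hu
    obtain ⟨t, ht, ht3⟩ := Finset.exists_subset_card_eq (Finset.mem_filter.1 hu).2
    exact ⟨t, Finset.mem_powersetCard.2 ⟨ht.trans Finset.inter_subset_right, ht3⟩,
      ht.trans Finset.inter_subset_left⟩
  choose! φ hφ hφ' using hsub
  obtain ⟨t, ht, hlt⟩ := Finset.exists_lt_card_fiber_of_mul_lt_card_of_maps_to (n := 2) hφ (by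
    rw [Finset.card_powersetCard, hQ, show Nat.choose 7 3 = 35 from rfl]
    omega)
  obtain ⟨x, y, z, hxy, hxz, hyz, rfl⟩ := Finset.card_eq_three.1 (Finset.mem_powersetCard.1 ht).2
  refine absurd (hG.card_common_le hxy hxz hyz (T.filter fun u => φ u = {x, y, z}) ?_) (by omega)
  intro s hs
  obtain ⟨hsT, hs⟩ := Finset.mem_filter.1 hs
  have := hφ' s hsT
  rw [hs] at this
  exact ⟨mem_nbrs.1 (this (by simp)), mem_nbrs.1 (this (by simp)), mem_nbrs.1 (this (by simp))⟩

/-- Contracting an edge whose ends have few common neighbours loses few edges. -/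
theorem exists_contraction [DecidableEq V] (G : SimpleGraph V) (hG : NoK33 G) {a b : V} (hab : G.Adj a b) :
    ∃ H : SimpleGraph {x // x ≠ b}, NoK33 H ∧
      (adjPairs G).card ≤ (adjPairs H).card + 2 + 2 * (nbrs G a ∩ nbrs G b).card := by
  classical
  let m : V → {x // x ≠ b} := fun x => if h : x = b then ⟨a, hab.ne⟩ else ⟨x, h⟩
  have mb : m b = ⟨a, hab.ne⟩ := dif_pos rfl
  have mx : ∀ x (h : x ≠ b), m x = ⟨x, h⟩ := fun x h => dif_neg h
  let H : SimpleGraph {x // x ≠ b} :=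
    SimpleGraph.fromRel fun x y => ∃ v w, m v = x ∧ m w = y ∧ G.Adj v w
  refine ⟨H, hG.of_star (fun x => some (m x)) Subtype.val ?_ ?_ ?_, ?_⟩
  · rintro ⟨x, hx⟩
    simp [mx x hx]
  · intro v u hv
    by_cases h : v = b
    · right
      subst h
      rw [← Option.some.inj hv, mb]
      exact hab.symm
    · left
      rw [← Option.some.inj hv, mx v h]
  · intro x y hxy
    rcases (SimpleGraph.fromRel_adj _ _ _).1 hxy with ⟨-, ⟨v, w, rfl, rfl, h⟩ | ⟨v, w, rfl, rfl, h⟩⟩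
    · exact ⟨v, w, rfl, rfl, h⟩
    · exact ⟨w, v, rfl, rfl, h.symm⟩
  · let N := nbrs G a ∩ nbrs G b
    let X : Finset (V × V) := {(a, b), (b, a)} ∪ (N.image (fun y => (b, y)) ∪ N.image fun y => (y, b))
    have hX : X.card ≤ 2 + 2 * N.card := by
      refine (Finset.card_union_le _ _).trans ?_
      have h₁ := Finset.card_le_two (a := (a, b)) (b := (b, a))
      have h₂ := Finset.card_union_le (N.image (fun y => (b, y))) (N.image fun y => (y, b))
      have h₃ := Finset.card_image_le (s := N) (f := fun y => (b, y))
      have h₄ := Finset.card_image_le (s := N) (f := fun y => (y, b))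
      omega
    have hmap : (adjPairs G \ X).card ≤ (adjPairs H).card := by
      have notX : ∀ p ∈ adjPairs G \ X, G.Adj p.1 p.2 ∧ (p.1 = b → ¬ G.Adj a p.2 ∧ p.2 ≠ a) ∧
          (p.2 = b → ¬ G.Adj a p.1 ∧ p.1 ≠ a) := by
        rintro ⟨x, y⟩ hxy
        obtain ⟨hp, hX⟩ := Finset.mem_sdiff.1 hxy
        have hadj : G.Adj x y := mem_adjPairs.1 hp
        clear hxy hp
        refine ⟨hadj, ?_, ?_⟩
        · rintro rfl
          refine ⟨fun h => hX ?_, fun h => hX ?_⟩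
          · simp only [X, Finset.mem_union, Finset.mem_image]
            exact Or.inr (Or.inl ⟨y, Finset.mem_inter.2 ⟨mem_nbrs.2 h, mem_nbrs.2 hadj⟩, rfl⟩)
          · simp at h
            simp [X, h]
        · rintro rfl
          refine ⟨fun h => hX ?_, fun h => hX ?_⟩
          · simp only [X, Finset.mem_union, Finset.mem_image]
            exact Or.inr (Or.inr ⟨x, Finset.mem_inter.2 ⟨mem_nbrs.2 h, mem_nbrs.2 hadj.symm⟩, rfl⟩)
          · simp at h
            simp [X, h]
      have meq : ∀ x y, m x = m y → x = y ∨ (x = b ∧ y = a) ∨ (x = a ∧ y = b) := by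
        intro x y h
        by_cases hx : x = b <;> by_cases hy : y = b
        · exact Or.inl (hx.trans hy.symm)
        · subst hx
          rw [mb, mx y hy] at h
          exact Or.inr (Or.inl ⟨rfl, (Subtype.mk.inj h).symm⟩)
        · subst hy
          rw [mb, mx x hx] at h
          exact Or.inr (Or.inr ⟨Subtype.mk.inj h, rfl⟩)
        · rw [mx x hx, mx y hy] at h
          exact Or.inl (Subtype.mk.inj h)
      refine Finset.card_le_card_of_injOn (fun p => (m p.1, m p.2)) ?_ ?_
      · intro p hp
        obtain ⟨hadj, h₁, h₂⟩ := notX p hp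
        refine mem_adjPairs.2 ((SimpleGraph.fromRel_adj _ _ _).2
          ⟨fun h => ?_, Or.inl ⟨p.1, p.2, rfl, rfl, hadj⟩⟩)
        rcases meq _ _ h with h | ⟨h, h'⟩ | ⟨h, h'⟩
        · exact hadj.ne h
        · exact (h₁ h).2 h'
        · exact (h₂ h').2 h
      · rintro ⟨x, y⟩ hp ⟨x', y'⟩ hp' h
        obtain ⟨hadj, h₁, h₂⟩ := notX _ hp
        obtain ⟨hadj', h₁', h₂'⟩ := notX _ hp'
        simp only [Prod.mk.injEq] at h
        obtain ⟨hx, hy⟩ := h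
        simp only at hadj hadj' h₁ h₂ h₁' h₂'
        rcases meq _ _ hx with rfl | ⟨rfl, rfl⟩ | ⟨rfl, rfl⟩ <;>
        rcases meq _ _ hy with rfl | ⟨rfl, rfl⟩ | ⟨rfl, rfl⟩ <;>
        grind [SimpleGraph.Adj.symm, SimpleGraph.irrefl]
    have := Finset.le_card_sdiff X (adjPairs G)
    change _ ≤ _ + 2 + 2 * N.card
    omega

/-- Finite graphs without `K₃,₃` minor have linearly many edges. -/
theorem card_adjPairs_le (G : SimpleGraph V) (hG : NoK33 G) :
    (adjPairs G).card ≤ 240 * Fintype.card V := by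
  classical
  induction hn : Fintype.card V generalizing V with
  | zero =>
    have := Fintype.card_eq_zero_iff.1 hn
    have hE : adjPairs G = ∅ := Finset.eq_empty_of_isEmpty _
    simp [hE]
  | succ n ih =>
    by_contra hlt
    obtain ⟨H, hH, hmin⟩ := exists_minimal_of_wellFoundedLT
      (fun H : SimpleGraph V => H ≤ G ∧ 240 * (n + 1) < (adjPairs H).card) ⟨G, le_rfl, not_le.1 hlt⟩
    obtain ⟨hHG, hHcard⟩ := hH
    have hHK : NoK33 H := hG.of_injective id Function.injective_id fun u v h => hHG h
    have hcard : ∀ b : V, Fintype.card {x // x ≠ b} = n := by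
      intro b
      simp [hn]
    have hcommon : ∀ a b, H.Adj a b → 120 ≤ (nbrs H a ∩ nbrs H b).card := by
      intro a b hab
      obtain ⟨H', hH', hle⟩ := exists_contraction H hHK hab
      have := ih H' hH' (hcard b)
      omega
    have hdeg : ∀ v, (nbrs H v).Nonempty := by
      intro v
      by_contra hv
      rw [Finset.not_nonempty_iff_eq_empty] at hv
      have hno : ∀ w, ¬ H.Adj v w := fun w h => by
        have := mem_nbrs.2 h
        simp [hv] at this
      let H' : SimpleGraph {x // x ≠ v} := H.comap Subtype.val
      have hle := ih H' (hHK.of_injective Subtype.val Subtype.val_injective fun _ _ h => h) (hcard v)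
      have : (adjPairs H).card ≤ (adjPairs H').card := by
        have : adjPairs H ⊆ (adjPairs H').image fun p => (p.1.1, p.2.1) := by
          rintro ⟨x, y⟩ hp
          have hp := mem_adjPairs.1 hp
          refine Finset.mem_image.2 ⟨(⟨x, fun h => ?_⟩, ⟨y, fun h => ?_⟩), mem_adjPairs.2 hp, rfl⟩
          · exact hno y (h ▸ hp)
          · exact hno x (h ▸ hp).symm
        exact (Finset.card_le_card this).trans Finset.card_image_le
      omega
    have hupper : (adjPairs H).card ≤ 240 * (n + 1) + 2 := by
      obtain ⟨⟨a, b⟩, hp⟩ := Finset.card_pos.1 (by omega : 0 < (adjPairs H).card)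
      have hab := mem_adjPairs.1 hp
      let H' := H.deleteEdges {s(a, b)}
      have hle : H' ≤ H := H.deleteEdges_le _
      have hlt : ¬ 240 * (n + 1) < (adjPairs H').card := fun h => by
        have := hmin ⟨hle.trans hHG, h⟩ hle hab
        simp [H'] at this
      have : adjPairs H ⊆ adjPairs H' ∪ {(a, b), (b, a)} := by
        rintro ⟨x, y⟩ hp
        have hp := mem_adjPairs.1 hp
        simp only [Finset.mem_union, mem_adjPairs, H', deleteEdges_adj, Finset.mem_insert,
          Finset.mem_singleton, Prod.mk.injEq, Set.mem_singleton_iff, Sym2.eq_iff]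
        tauto
      have h₁ := Finset.card_le_card this
      have h₂ := Finset.card_union_le (adjPairs H') {(a, b), (b, a)}
      have h₃ := Finset.card_le_two (a := (a, b)) (b := (b, a))
      omega
    obtain ⟨v, hv⟩ : ∃ v, (nbrs H v).card ≤ 242 := by
      by_contra! h
      have : ∑ v : V, 243 ≤ ∑ v, (nbrs H v).card := Finset.sum_le_sum fun v _ => h v
      rw [← card_adjPairs, Finset.sum_const, Finset.card_univ, hn, smul_eq_mul] at this
      omega
    refine not_noK33_of_dense H (nbrs H v) (hdeg v) hv (fun w hw => ?_) hHK
    rw [Finset.inter_comm]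
    exact hcommon v w (mem_nbrs.1 hw)

/-- Every nonempty set of vertices contains a vertex with few neighbours inside the set. -/
theorem exists_small_degree (G : SimpleGraph V) (hG : NoK33 G) (S : Finset V) [DecidableEq V]
    (hS : S.Nonempty) : ∃ v ∈ S, (nbrs G v ∩ S).card ≤ 240 := by
  classical
  by_contra! h
  have hle := card_adjPairs_le (G.comap (Subtype.val : S → V))
    (hG.of_injective Subtype.val Subtype.val_injective fun _ _ h => h)
  rw [card_adjPairs, Fintype.card_coe] at hle
  have : ∀ v : S, 241 ≤ (nbrs (G.comap (Subtype.val : S → V)) v).card := by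
    intro v
    refine Nat.lt_of_lt_of_le (h v v.2) ?_
    have : nbrs G v ∩ S ⊆ (nbrs (G.comap (Subtype.val : S → V)) v).image Subtype.val := by
      intro w hw
      obtain ⟨h₁, h₂⟩ := Finset.mem_inter.1 hw
      exact Finset.mem_image.2 ⟨⟨w, h₂⟩, mem_nbrs.2 (mem_nbrs (G := G).1 h₁), rfl⟩
    exact (Finset.card_le_card this).trans Finset.card_image_le
  have hsum := Finset.sum_le_sum fun v (_ : v ∈ (Finset.univ : Finset S)) => this v
  rw [Finset.sum_const, Finset.card_univ, Fintype.card_coe, smul_eq_mul] at hsum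
  have := hS.card_pos
  omega

end Sparsity

end FrugalPlanar

namespace FrugalPlanar

section ThreeNeighbours

variable {V : Type} [Fintype V] [DecidableEq V]

/-- If the neighbourhoods in `B` of the vertices of `T` are cliques with at least three vertices
of a sparse graph `F` on `B`, then `T` is small. -/
theorem card_le_of_clique_neighbourhoods {G : SimpleGraph V} (hG : NoK33 G) (B : Finset V)
    (F : SimpleGraph B) (hF : NoK33 F) (B' : Finset B) (T : Finset V)
    (hT : ∀ s ∈ T, 3 ≤ (nbrs G s ∩ B).card)
    (hclique : ∀ s ∈ T, ∀ x y : B, G.Adj s x → G.Adj s y → x ≠ y → F.Adj x y)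
    (hsub : ∀ s ∈ T, ∀ x : B, G.Adj s x → x ∈ B') : T.card ≤ 115200 * B'.card := by
  classical
  induction hn : B'.card generalizing B' T with
  | zero =>
    rw [Nat.mul_zero, Nat.le_zero, Finset.card_eq_zero, Finset.eq_empty_iff_forall_notMem]
    intro s hs
    obtain ⟨x, hx⟩ := Finset.card_pos.1 (by have := hT s hs; omega : 0 < (nbrs G s ∩ B).card)
    obtain ⟨h₁, h₂⟩ := Finset.mem_inter.1 hx
    have := hsub s hs ⟨x, h₂⟩ (mem_nbrs.1 h₁)
    rw [Finset.card_eq_zero.1 hn] at this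
    simp at this
  | succ n ih =>
    obtain ⟨x, hx, hdeg⟩ := exists_small_degree F hF B' (Finset.card_pos.1 (by omega))
    let D := nbrs F x ∩ B'
    let Tx := T.filter fun s => G.Adj s x
    have hrest := ih (B'.erase x) (T \ Tx) (fun s hs => hT s (Finset.mem_sdiff.1 hs).1)
      (fun s hs => hclique s (Finset.mem_sdiff.1 hs).1) (by
        intro s hs y hy
        obtain ⟨h₁, h₂⟩ := Finset.mem_sdiff.1 hs
        refine Finset.mem_erase.2 ⟨?_, hsub s h₁ y hy⟩
        rintro rfl
        exact h₂ (Finset.mem_filter.2 ⟨h₁, hy⟩)) (by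
        rw [Finset.card_erase_of_mem hx]
        omega)
    have hpair : ∀ s ∈ Tx, ∃ p ∈ D ×ˢ D, p.1 ≠ p.2 ∧ G.Adj s p.1 ∧ G.Adj s p.2 := by
      intro s hs
      obtain ⟨hsT, hsx⟩ := Finset.mem_filter.1 hs
      have hc : 2 ≤ ((nbrs G s ∩ B).erase x).card := by
        have h₁ := hT s hsT
        have h₂ := Finset.pred_card_le_card_erase (s := nbrs G s ∩ B) (a := (x : V))
        omega
      obtain ⟨y, hy, z, hz, hyz⟩ := Finset.one_lt_card.1 hc
      have mem : ∀ w ∈ (nbrs G s ∩ B).erase (x : V), ∃ h : w ∈ B, G.Adj s w ∧ (⟨w, h⟩ : B) ∈ D := by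
        intro w hw
        obtain ⟨hwx, hw⟩ := Finset.mem_erase.1 hw
        obtain ⟨h₁, h₂⟩ := Finset.mem_inter.1 hw
        refine ⟨h₂, mem_nbrs.1 h₁, Finset.mem_inter.2 ⟨mem_nbrs.2 ?_, hsub s hsT ⟨w, h₂⟩ (mem_nbrs.1 h₁)⟩⟩
        exact hclique s hsT x ⟨w, h₂⟩ hsx (mem_nbrs.1 h₁) fun h => hwx (by rw [h])
      obtain ⟨hyB, hys, hyD⟩ := mem y hy
      obtain ⟨hzB, hzs, hzD⟩ := mem z hz
      exact ⟨(⟨y, hyB⟩, ⟨z, hzB⟩), Finset.mem_product.2 ⟨hyD, hzD⟩,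
        fun h => hyz (congrArg Subtype.val h), hys, hzs⟩
    have : Nonempty B := ⟨x⟩
    choose! φ hφ hne h₁ h₂ using hpair
    have hTx : Tx.card ≤ 2 * (D ×ˢ D).card := by
      refine Finset.card_le_mul_card_image_of_maps_to hφ 2 fun p hp => ?_
      obtain ⟨hp₁, hp₂⟩ := Finset.mem_product.1 hp
      have ne : ∀ y ∈ D, (x : V) ≠ y := fun y hy h =>
        (mem_nbrs.1 (Finset.mem_inter.1 hy).1).ne (Subtype.ext h)
      by_cases hpp : p.1 = p.2
      · rw [Finset.filter_false_of_mem]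
        · simp
        · rintro s hs rfl
          exact hne s hs hpp
      · refine hG.card_common_le (ne _ hp₁) (ne _ hp₂) (fun h => hpp (Subtype.ext h)) _ ?_
        intro s hs
        obtain ⟨hsx, rfl⟩ := Finset.mem_filter.1 hs
        exact ⟨(Finset.mem_filter.1 hsx).2, h₁ s hsx, h₂ s hsx⟩
    have hD : D.card ≤ 240 := hdeg
    have hDD : (D ×ˢ D).card ≤ 240 * 240 := by
      rw [Finset.card_product]
      exact Nat.mul_le_mul hD hD
    have := Finset.card_le_card (Finset.filter_subset (fun s => G.Adj s x) T)
    have := Finset.card_sdiff_add_card_eq_card (Finset.filter_subset (fun s => G.Adj s x) T)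
    change (T \ Tx).card + Tx.card = T.card at this
    omega

/-- In a graph without `K₃,₃` minor, few vertices have three neighbours in a given set. -/
theorem card_three_neighbours_le {G : SimpleGraph V} (hG : NoK33 G) (B S : Finset V)
    (hBS : Disjoint B S) (hS : ∀ s ∈ S, 3 ≤ (nbrs G s ∩ B).card) :
    S.card ≤ 115440 * B.card := by
  classical
  let good : Finset V → (V → V × V) → Prop := fun S₁ g => S₁ ⊆ S ∧
    (∀ s ∈ S₁, (g s).1 ∈ B ∧ (g s).2 ∈ B ∧ (g s).1 ≠ (g s).2 ∧ G.Adj s (g s).1 ∧ G.Adj s (g s).2) ∧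
    ∀ s ∈ S₁, ∀ s' ∈ S₁, s(((g s).1), (g s).2) = s((g s').1, (g s').2) → s = s'
  obtain ⟨S₁, hS₁, hmax⟩ := Finset.exists_max_image
    (S.powerset.filter fun S₁ => ∃ g, good S₁ g) Finset.card
    ⟨∅, Finset.mem_filter.2 ⟨by simp, fun v => (v, v), by simp [good]⟩⟩
  obtain ⟨-, g, hsub, hg, hinj⟩ := Finset.mem_filter.1 hS₁
  let F : SimpleGraph B := SimpleGraph.fromRel fun x y => ∃ s ∈ S₁, g s = ((x : V), (y : V))
  have hFadj : ∀ x y : B, F.Adj x y ↔ x ≠ y ∧ ((∃ s ∈ S₁, g s = ((x : V), (y : V))) ∨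
      ∃ s ∈ S₁, g s = ((y : V), (x : V))) := fun x y => SimpleGraph.fromRel_adj _ _ _
  have hF : NoK33 F := by
    let f : V → Option B := fun v => if h : v ∈ B then some ⟨v, h⟩ else
      if h : v ∈ S₁ then some ⟨(g v).1, (hg v h).1⟩ else none
    have hfB : ∀ x : B, f x = some x := fun x => dif_pos x.2
    have hfS : ∀ s (h : s ∈ S₁), f s = some ⟨(g s).1, (hg s h).1⟩ := by
      intro s hs
      have : s ∉ B := fun h => Finset.disjoint_left.1 hBS h (hsub hs)
      simp only [f, dif_neg this, dif_pos hs]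
    refine hG.of_star f Subtype.val hfB ?_ ?_
    · intro v u hv
      by_cases hB : v ∈ B
      · rw [hfB ⟨v, hB⟩] at hv
        exact Or.inl (by rw [← Option.some.inj hv])
      · by_cases hv₁ : v ∈ S₁
        · rw [hfS v hv₁] at hv
          rw [← Option.some.inj hv]
          exact Or.inr (hg v hv₁).2.2.2.1
        · simp [f, hB, hv₁] at hv
    · intro x y hxy
      obtain ⟨-, ⟨s, hs, hgs⟩ | ⟨s, hs, hgs⟩⟩ := (hFadj x y).1 hxy
      · refine ⟨s, y, ?_, hfB y, ?_⟩
        · rw [hfS s hs]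
          simp [hgs]
        · have := (hg s hs).2.2.2.2
          rwa [hgs] at this
      · refine ⟨x, s, hfB x, ?_, ?_⟩
        · rw [hfS s hs]
          simp [hgs]
        · have := (hg s hs).2.2.2.2
          rw [hgs] at this
          exact this.symm
  have hcardS₁ : S₁.card ≤ 240 * B.card := by
    have h₁ : S₁.card ≤ (adjPairs F).card := by
      have : S₁.image g ⊆ (adjPairs F).image fun p => ((p.1 : V), (p.2 : V)) := by
        intro p hp
        obtain ⟨s, hs, rfl⟩ := Finset.mem_image.1 hp
        obtain ⟨h₁, h₂, h₃, -⟩ := hg s hs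
        refine Finset.mem_image.2 ⟨(⟨_, h₁⟩, ⟨_, h₂⟩), mem_adjPairs.2 ((hFadj _ _).2
          ⟨fun h => h₃ (congrArg Subtype.val h), Or.inl ⟨s, hs, rfl⟩⟩), rfl⟩
      have hcard : (S₁.image g).card = S₁.card :=
        Finset.card_image_of_injOn fun s hs s' hs' h => hinj s hs s' hs' (by rw [h])
      rw [← hcard]
      exact (Finset.card_le_card this).trans Finset.card_image_le
    have h₂ := card_adjPairs_le F hF
    rw [Fintype.card_coe] at h₂
    omega
  have hcardS₂ : (S \ S₁).card ≤ 115200 * B.card := by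
    have := card_le_of_clique_neighbourhoods hG B F hF Finset.univ (S \ S₁)
      (fun s hs => hS s (Finset.mem_sdiff.1 hs).1) ?_ (by simp)
    · simpa using this
    intro s hs x y hsx hsy hxy
    obtain ⟨hsS, hs₁⟩ := Finset.mem_sdiff.1 hs
    by_contra hnot
    have hne : (x : V) ≠ y := fun h => hxy (Subtype.ext h)
    have hnew : ∀ s' ∈ S₁, s((x : V), (y : V)) ≠ s((g s').1, (g s').2) := by
      intro s' hs' h
      refine hnot ((hFadj x y).2 ⟨hxy, ?_⟩)
      rcases Sym2.eq_iff.1 h with ⟨h₁, h₂⟩ | ⟨h₁, h₂⟩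
      · exact Or.inl ⟨s', hs', by rw [h₁, h₂]⟩
      · exact Or.inr ⟨s', hs', by rw [h₁, h₂]⟩
    have hns : ∀ s' ∈ S₁, s' ≠ s := fun s' h h' => hs₁ (h' ▸ h)
    have hle := hmax (insert s S₁) (Finset.mem_filter.2
      ⟨Finset.mem_powerset.2 (Finset.insert_subset hsS hsub), Function.update g s ((x : V), (y : V)),
        Finset.insert_subset hsS hsub, ?_, ?_⟩)
    · rw [Finset.card_insert_of_notMem hs₁] at hle
      omega
    · intro s' hs'
      rcases Finset.mem_insert.1 hs' with rfl | hs'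
      · simpa using ⟨hxy, hsx, hsy⟩
      · rw [Function.update_of_ne (hns s' hs')]
        exact hg s' hs'
    · intro a ha b hb
      rcases Finset.mem_insert.1 ha with h | ha' <;> rcases Finset.mem_insert.1 hb with h' | hb'
      · exact fun _ => h.trans h'.symm
      · subst h
        rw [Function.update_of_ne (hns b hb'), Function.update_self]
        exact fun h => absurd h (hnew b hb')
      · subst h'
        rw [Function.update_of_ne (hns a ha'), Function.update_self]
        exact fun h => absurd h.symm (hnew a ha')
      · rw [Function.update_of_ne (hns a ha'), Function.update_of_ne (hns b hb')]
        exact hinj a ha' b hb'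
  have := Finset.card_sdiff_add_card_eq_card hsub
  omega

end ThreeNeighbours

end FrugalPlanar

namespace FrugalPlanar

section Expansion

variable {V : Type}

theorem reflTransGen_symm_on {F : SimpleGraph V} {s : Set V} {a b : V} (ha : a ∈ s)
    (h : Relation.ReflTransGen (fun p q => F.Adj p q ∧ q ∈ s) a b) :
    b ∈ s ∧ Relation.ReflTransGen (fun p q => F.Adj p q ∧ q ∈ s) b a := by
  induction h with
  | refl => exact ⟨ha, .refl⟩
  | tail _ h ih => exact ⟨h.2, .head ⟨h.1.symm, ih.1⟩ ih.2⟩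

theorem connOn_of_center {F : SimpleGraph V} {s : Set V} {v : V} (hv : v ∈ s)
    (h : ∀ a ∈ s, Relation.ReflTransGen (fun p q => F.Adj p q ∧ q ∈ s) v a) : ConnOn F s :=
  ⟨⟨v, hv⟩, fun a ha b hb => (reflTransGen_symm_on hv (h a ha)).2.trans (h b hb)⟩

theorem ConnOn.reach_mono {F : SimpleGraph V} {s t : Set V} (h : ConnOn F s) (hst : s ⊆ t)
    {a b : V} (ha : a ∈ s) (hb : b ∈ s) :
    Relation.ReflTransGen (fun p q => F.Adj p q ∧ q ∈ t) a b :=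
  Relation.ReflTransGen.mono (fun _ _ h => ⟨h.1, hst h.2⟩) _ _ (h.2 a ha b hb)

/-- The total weight between two sets. -/
def cut (m : V → V → ℝ) (X Y : Finset V) : ℝ := ∑ x ∈ X, ∑ y ∈ Y, m x y

section Cut

variable {m : V → V → ℝ}

theorem cut_mono (hm : ∀ x y, 0 ≤ m x y) {X X' Y Y' : Finset V} (hX : X ⊆ X') (hY : Y ⊆ Y') :
    cut m X Y ≤ cut m X' Y' := by
  refine (Finset.sum_le_sum fun x _ => Finset.sum_le_sum_of_subset_of_nonneg hY
    fun y _ _ => hm x y).trans ?_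
  exact Finset.sum_le_sum_of_subset_of_nonneg hX fun x _ _ => Finset.sum_nonneg fun y _ => hm x y

theorem cut_comm (hs : ∀ x y, m x y = m y x) (X Y : Finset V) : cut m X Y = cut m Y X := by
  rw [cut, Finset.sum_comm]
  exact Finset.sum_congr rfl fun y _ => Finset.sum_congr rfl fun x _ => hs x y

theorem cut_le_card {X Y W : Finset V} (hm : ∀ x y, 0 ≤ m x y) (hs : ∀ x y, m x y = m y x)
    (hd : ∀ x ∈ W, ∑ y ∈ W, m x y ≤ 1) (hX : X ⊆ W) (hY : Y ⊆ W) : cut m X Y ≤ Y.card := by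
  rw [cut_comm hs]
  refine (cut_mono hm subset_rfl hX).trans ?_
  refine (Finset.sum_le_sum fun y hy => hd y (hY hy)).trans ?_
  simp

variable [DecidableEq V]

theorem cut_union_left {X X' : Finset V} (h : Disjoint X X') (Y : Finset V) :
    cut m (X ∪ X') Y = cut m X Y + cut m X' Y := Finset.sum_union h

theorem cut_union_right {Y Y' : Finset V} (h : Disjoint Y Y') (X : Finset V) :
    cut m X (Y ∪ Y') = cut m X Y + cut m X Y' := by
  simp only [cut, Finset.sum_union h, Finset.sum_add_distrib]

end Cut

variable [DecidableEq V]

/-- The set of vertices of `Y` at distance at most `k` from `v` inside `Y`. -/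
noncomputable def ballIn (F : SimpleGraph V) (Y : Finset V) (v : V) : ℕ → Finset V
  | 0 => {v}
  | k + 1 => by
    classical
    exact ballIn F Y v k ∪ Y.filter fun y => ∃ x ∈ ballIn F Y v k, F.Adj x y

theorem ballIn_subset (F : SimpleGraph V) (Y : Finset V) {v : V} (hv : v ∈ Y) (k : ℕ) :
    ballIn F Y v k ⊆ Y := by
  induction k with
  | zero => simpa [ballIn] using hv
  | succ k ih =>
    simp only [ballIn]
    classical
    exact Finset.union_subset ih (Finset.filter_subset _ _)

theorem mem_ballIn_self (F : SimpleGraph V) (Y : Finset V) (v : V) (k : ℕ) :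
    v ∈ ballIn F Y v k := by
  induction k with
  | zero => simp [ballIn]
  | succ k ih =>
    simp only [ballIn, Finset.mem_union]
    exact Or.inl ih

theorem exists_conn_of_mem_ballIn (F : SimpleGraph V) (Y : Finset V) {v : V} (hv : v ∈ Y) (k : ℕ)
    {y : V} (hy : y ∈ ballIn F Y v k) :
    ∃ P : Finset V, P ⊆ Y ∧ ConnOn F P ∧ v ∈ P ∧ y ∈ P ∧ P.card ≤ k + 1 := by
  classical
  induction k generalizing y with
  | zero =>
    obtain rfl : y = v := by simpa [ballIn] using hy
    refine ⟨{y}, by simpa using hv, connOn_of_center (v := y) (by simp) ?_, by simp, by simp, by simp⟩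
    intro a ha
    obtain rfl : a = y := by simpa using ha
    exact .refl
  | succ k ih =>
    simp only [ballIn, Finset.mem_union, Finset.mem_filter] at hy
    rcases hy with hy | ⟨hyY, x, hx, hxy⟩
    · obtain ⟨P, h₁, h₂, h₃, h₄, h₅⟩ := ih hy
      exact ⟨P, h₁, h₂, h₃, h₄, by omega⟩
    · obtain ⟨P, h₁, h₂, h₃, h₄, h₅⟩ := ih hx
      refine ⟨insert y P, Finset.insert_subset hyY h₁,
        connOn_of_center (v := v) (by simp [h₃]) ?_, by simp [h₃], by simp,
        (Finset.card_insert_le _ _).trans (by omega)⟩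
      have hsub : (P : Set V) ⊆ (insert y P : Finset V) := by simp
      intro a ha
      rcases Finset.mem_insert.1 (Finset.mem_coe.1 ha) with rfl | ha
      · exact (h₂.reach_mono hsub h₃ h₄).tail ⟨hxy, by simp⟩
      · exact h₂.reach_mono hsub h₃ ha

theorem pow_le_card_ballIn {F : SimpleGraph V} {m : V → V → ℝ} (hm : ∀ x y, 0 ≤ m x y)
    (hs : ∀ x y, m x y = m y x) (hF : ∀ x y, m x y ≠ 0 → F.Adj x y) {Y : Finset V}
    (hd : ∀ x ∈ Y, ∑ y ∈ Y, m x y ≤ 1) {q : ℝ} (hq : 0 ≤ q)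
    (hexp : ∀ X ⊆ Y, X.Nonempty → 2 * X.card ≤ Y.card → q * X.card ≤ cut m X (Y \ X))
    {v : V} (hv : v ∈ Y) (k : ℕ) (hk : 2 * (ballIn F Y v k).card ≤ Y.card) :
    (1 + q) ^ k ≤ (ballIn F Y v k).card := by
  induction k with
  | zero => simp [ballIn]
  | succ k ih =>
    have hmono : ballIn F Y v k ⊆ ballIn F Y v (k + 1) := by
      simp only [ballIn]
      exact Finset.subset_union_left
    have hcard := Finset.card_le_card hmono
    have ih := ih (by omega)
    have hsubk := ballIn_subset F Y hv k
    have hsubk' := ballIn_subset F Y hv (k + 1)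
    have h₁ := hexp _ hsubk ⟨v, mem_ballIn_self F Y v k⟩ (by omega)
    have h₂ : cut m (ballIn F Y v k) (Y \ ballIn F Y v k) ≤
        cut m (ballIn F Y v k) (ballIn F Y v (k + 1) \ ballIn F Y v k) := by
      refine Finset.sum_le_sum fun x hx => ?_
      rw [← Finset.sum_subset (Finset.sdiff_subset_sdiff hsubk' subset_rfl)]
      intro y hy hy'
      by_contra hne
      refine hy' (Finset.mem_sdiff.2 ⟨?_, (Finset.mem_sdiff.1 hy).2⟩)
      simp only [ballIn, Finset.mem_union, Finset.mem_filter]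
      exact Or.inr ⟨(Finset.mem_sdiff.1 hy).1, x, hx, hF x y hne⟩
    have h₃ := cut_le_card hm hs hd hsubk
      ((Finset.sdiff_subset (s := ballIn F Y v (k + 1)) (t := ballIn F Y v k)).trans hsubk')
    have h₄ : ((ballIn F Y v (k + 1) \ ballIn F Y v k).card : ℝ) + (ballIn F Y v k).card =
        (ballIn F Y v (k + 1)).card := by
      exact_mod_cast Finset.card_sdiff_add_card_eq_card hmono
    rw [pow_succ]
    have h₅ := mul_le_mul_of_nonneg_right ih (by linarith : 0 ≤ 1 + q)
    linarith

theorem not_noK33_of_branch_sets {F : SimpleGraph V} (A : Finset (Finset V)) (hA : A.card = 6)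
    (hconn : ∀ X ∈ A, ConnOn F (X : Set V))
    (hdisj : ∀ X ∈ A, ∀ Y ∈ A, X ≠ Y → Disjoint X Y)
    (hadj : ∀ X ∈ A, ∀ Y ∈ A, X ≠ Y → ∃ x ∈ X, ∃ y ∈ Y, F.Adj x y) : ¬ NoK33 F := by
  classical
  have e : Fin 3 ⊕ Fin 3 ≃ A := Fintype.equivOfCardEq (by simp [hA])
  let f : V → Option (Fin 3 ⊕ Fin 3) := fun v =>
    if h : ∃ u, v ∈ (e u).1 then some h.choose else none
  have hf : ∀ v u, f v = some u ↔ v ∈ (e u).1 := by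
    intro v u
    constructor
    · intro h
      by_cases hex : ∃ u, v ∈ (e u).1
      · simp only [f, dif_pos hex, Option.some.injEq] at h
        rw [← h]
        exact hex.choose_spec
      · simp only [f, dif_neg hex] at h
        cases h
    · intro h
      have hex : ∃ u, v ∈ (e u).1 := ⟨u, h⟩
      simp only [f, dif_pos hex, Option.some.injEq]
      by_contra hne
      have hne' : (e hex.choose).1 ≠ (e u).1 := fun h => hne (e.injective (Subtype.ext h))
      exact Finset.disjoint_left.1 (hdisj _ (e hex.choose).2 _ (e u).2 hne') hex.choose_spec h
  refine fun hno => hno ⟨f, fun u => ?_, fun u u' huu => ?_⟩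
  · have : {v | f v = some u} = ((e u).1 : Set V) := by
      ext v
      simpa using hf v u
    rw [this]
    exact hconn _ (e u).2
  · obtain ⟨x, hx, y, hy, hxy⟩ := hadj _ (e u).2 _ (e u').2
      fun h => huu.ne (e.injective (Subtype.ext h))
    exact ⟨x, y, (hf x u).2 hx, (hf y u').2 hy, hxy⟩

/-- A partial construction of a `K₆` minor of `F` inside `W`: a weakly attached set `R` and a
family `A` of small pairwise adjacent branch sets. -/
structure PartialClique (F : SimpleGraph V) (m : V → V → ℝ) (W : Finset V) (h : ℝ) (z : ℕ)
    (R : Finset V) (A : Finset (Finset V)) : Prop where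
  subR : R ⊆ W
  subA : ∀ X ∈ A, X ⊆ W
  cardA : ∀ X ∈ A, X.card ≤ z
  conn : ∀ X ∈ A, ConnOn F (X : Set V)
  disjR : ∀ X ∈ A, Disjoint X R
  disjA : ∀ X ∈ A, ∀ Y ∈ A, X ≠ Y → Disjoint X Y
  adj : ∀ X ∈ A, ∀ Y ∈ A, X ≠ Y → ∃ x ∈ X, ∃ y ∈ Y, F.Adj x y
  le_six : A.card ≤ 6
  cardR : 4 * R.card ≤ 3 * W.card
  cutR : cut m R ((W \ R) \ A.biUnion id) ≤ h / 6 * R.card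

variable {F : SimpleGraph V} {m : V → V → ℝ} {W : Finset V} {h : ℝ} {z : ℕ} {R : Finset V}
  {A : Finset (Finset V)}

theorem PartialClique.card_biUnion_le (s : PartialClique F m W h z R A) :
    (A.biUnion id).card ≤ 6 * z :=
  (Finset.card_biUnion_le_card_mul _ _ _ s.cardA).trans (Nat.mul_le_mul_right _ s.le_six)

theorem PartialClique.card_R_le (s : PartialClique F m W h z R A) (hm : ∀ x y, 0 ≤ m x y)
    (hs : ∀ x y, m x y = m y x) (hd : ∀ x ∈ W, ∑ y ∈ W, m x y ≤ 1) (hh : 0 < h)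
    (hexp : ∀ X ⊆ W, X.Nonempty → 2 * X.card ≤ W.card → h * X.card ≤ cut m X (W \ X))
    (hz : 0 < z) (hW : 36 * z / h + 6 * z ≤ W.card / 4) : (R.card : ℝ) ≤ 36 * z / h := by
  have hsubU : A.biUnion id ⊆ W := Finset.biUnion_subset.2 fun X hX => s.subA X hX
  have hcut : cut m R (W \ R) ≤ h / 6 * R.card + 6 * z := by
    have h₁ : cut m R (W \ R) ≤ cut m R ((W \ R) \ A.biUnion id) + cut m R (A.biUnion id) := by
      rw [← cut_union_right Finset.sdiff_disjoint]
      exact cut_mono hm subset_rfl (by rw [Finset.sdiff_union_self_eq_union]; exact Finset.subset_union_left)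
    have h₂ := cut_le_card hm hs hd s.subR hsubU
    have h₃ : ((A.biUnion id).card : ℝ) ≤ 6 * z := by exact_mod_cast s.card_biUnion_le
    linarith [s.cutR]
  have hz' : (0 : ℝ) < z := by exact_mod_cast hz
  rw [le_div_iff₀ hh]
  have hW' : 36 * z + 6 * z * h ≤ h * (W.card / 4) := by
    have := mul_le_mul_of_nonneg_left hW hh.le
    have e : h * (36 * z / h + 6 * z) = 36 * z + 6 * z * h := by field_simp
    linarith
  by_cases hR : 2 * R.card ≤ W.card
  · rcases R.eq_empty_or_nonempty with rfl | hne
    · simp only [Finset.card_empty, Nat.cast_zero, zero_mul]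
      positivity
    · have := hexp R s.subR hne hR
      linarith
  · exfalso
    have hcard : ((W \ R).card : ℝ) + R.card = W.card := by
      exact_mod_cast Finset.card_sdiff_add_card_eq_card s.subR
    have hR4 : 4 * (R.card : ℝ) ≤ 3 * W.card := by exact_mod_cast s.cardR
    have hcardn := Finset.card_sdiff_add_card_eq_card s.subR
    have hpos : 0 < (W \ R).card := by
      by_contra h0
      have := s.cardR
      have : (0 : ℝ) < h * (W.card / 4) := by
        have : 0 < 6 * z * h := by positivity
        linarith
      have : (0 : ℝ) < W.card := by
        by_contra hneg
        have := mul_nonneg hh.le (by linarith : (0 : ℝ) ≤ -(W.card / 4))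
        linarith
      have : 0 < W.card := by exact_mod_cast this
      omega
    have h₁ := hexp (W \ R) Finset.sdiff_subset (Finset.card_pos.1 hpos) (by omega)
    rw [Finset.sdiff_sdiff_eq_self s.subR, cut_comm hs] at h₁
    have h₂ : h * (W.card / 4) ≤ h * (W \ R).card :=
      mul_le_mul_of_nonneg_left (by linarith) hh.le
    have h₃ : h / 6 * R.card ≤ h / 6 * (3 * W.card / 4) :=
      mul_le_mul_of_nonneg_left (by linarith) (by positivity)
    have : 0 < 6 * z * h := by positivity
    linarith

end Expansion

end FrugalPlanar

namespace FrugalPlanar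

section Clusters

variable {V : Type} [DecidableEq V] {F : SimpleGraph V} {m : V → V → ℝ} {W : Finset V} {h : ℝ}
  {z : ℕ} {R : Finset V} {A : Finset (Finset V)}

/-- A branch set without neighbours in the remaining part can be moved to the attached set. -/
theorem PartialClique.absorb_branch (s : PartialClique F m W h z R A)
    (hF : ∀ x y, m x y ≠ 0 → F.Adj x y) (hh : 0 < h) {X : Finset V} (hX : X ∈ A)
    (hno : ∀ x ∈ X, ∀ y ∈ (W \ R) \ A.biUnion id, ¬ F.Adj x y)
    (hcard : 4 * (R.card + X.card) ≤ 3 * W.card) :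
    PartialClique F m W h z (R ∪ X) (A.erase X) := by
  have hdisj : Disjoint R X := (s.disjR X hX).symm
  have hrest : (W \ (R ∪ X)) \ (A.erase X).biUnion id ⊆ (W \ R) \ A.biUnion id := by
    intro v hv
    simp only [Finset.mem_sdiff, Finset.mem_union, Finset.mem_biUnion, id, Finset.mem_erase,
      not_or, not_exists, not_and] at hv ⊢
    refine ⟨⟨hv.1.1, hv.1.2.1⟩, fun Y hY hvY => ?_⟩
    by_cases hYX : Y = X
    · exact hv.1.2.2 (hYX ▸ hvY)
    · exact hv.2 Y ⟨hYX, hY⟩ hvY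
  refine ⟨Finset.union_subset s.subR (s.subA X hX), fun Y hY => s.subA Y (Finset.mem_of_mem_erase hY),
    fun Y hY => s.cardA Y (Finset.mem_of_mem_erase hY),
    fun Y hY => s.conn Y (Finset.mem_of_mem_erase hY), fun Y hY => ?_,
    fun Y hY Y' hY' => s.disjA Y (Finset.mem_of_mem_erase hY) Y' (Finset.mem_of_mem_erase hY'),
    fun Y hY Y' hY' => s.adj Y (Finset.mem_of_mem_erase hY) Y' (Finset.mem_of_mem_erase hY'),
    (Finset.card_erase_le).trans s.le_six, ?_, ?_⟩
  · obtain ⟨hne, hY⟩ := Finset.mem_erase.1 hY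
    exact Finset.disjoint_union_right.2 ⟨s.disjR Y hY, s.disjA Y hY X hX hne⟩
  · rwa [Finset.card_union_of_disjoint hdisj]
  · rw [cut_union_left hdisj, Finset.card_union_of_disjoint hdisj]
    have h₁ : cut m X ((W \ (R ∪ X)) \ (A.erase X).biUnion id) = 0 := by
      refine Finset.sum_eq_zero fun x hx => Finset.sum_eq_zero fun y hy => ?_
      by_contra hne
      exact hno x hx y (hrest hy) (hF x y hne)
    have h₂ : cut m R ((W \ (R ∪ X)) \ (A.erase X).biUnion id) ≤
        cut m R ((W \ R) \ A.biUnion id) := by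
      refine (Finset.sum_le_sum fun x _ => ?_)
      have heq : (W \ R) \ A.biUnion id ⊆ (W \ (R ∪ X)) \ (A.erase X).biUnion id := by
        intro v hv
        simp only [Finset.mem_sdiff, Finset.mem_union, Finset.mem_biUnion, id, Finset.mem_erase,
          not_or, not_exists, not_and] at hv ⊢
        exact ⟨⟨hv.1.1, hv.1.2, hv.2 X hX⟩, fun Y hY => hv.2 Y hY.2⟩
      rw [subset_antisymm hrest heq]
    have h₃ : 0 ≤ h / 6 * X.card := by positivity
    push_cast
    linarith [s.cutR]

/-- A weakly attached part of the remaining vertices can be moved to the attached set. -/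
theorem PartialClique.absorb_part (s : PartialClique F m W h z R A) (hm : ∀ x y, 0 ≤ m x y)
    {X : Finset V} (hX : X ⊆ (W \ R) \ A.biUnion id)
    (hcut : cut m X (((W \ R) \ A.biUnion id) \ X) ≤ h / 6 * X.card)
    (hcard : 4 * (R.card + X.card) ≤ 3 * W.card) :
    PartialClique F m W h z (R ∪ X) A := by
  have hXW : X ⊆ W := fun v hv => (Finset.mem_sdiff.1 (Finset.mem_sdiff.1 (hX hv)).1).1
  have hdisj : Disjoint R X := Finset.disjoint_right.2 fun v hv =>
    (Finset.mem_sdiff.1 (Finset.mem_sdiff.1 (hX hv)).1).2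
  have hrest : (W \ (R ∪ X)) \ A.biUnion id = ((W \ R) \ A.biUnion id) \ X := by
    ext v
    simp only [Finset.mem_sdiff, Finset.mem_union]
    tauto
  refine ⟨Finset.union_subset s.subR hXW, s.subA, s.cardA, s.conn, fun Y hY => ?_, s.disjA, s.adj,
    s.le_six, ?_, ?_⟩
  · refine Finset.disjoint_union_right.2 ⟨s.disjR Y hY, Finset.disjoint_right.2 fun v hv hvY => ?_⟩
    exact (Finset.mem_sdiff.1 (hX hv)).2 (Finset.mem_biUnion.2 ⟨Y, hY, hvY⟩)
  · rwa [Finset.card_union_of_disjoint hdisj]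
  · rw [cut_union_left hdisj, Finset.card_union_of_disjoint hdisj, hrest]
    have := cut_mono hm (subset_refl R) (Finset.sdiff_subset (s := (W \ R) \ A.biUnion id) (t := X))
    push_cast
    linarith [s.cutR]

/-- A connected set of remaining vertices adjacent to all branch sets is a new branch set. -/
theorem PartialClique.add_branch (s : PartialClique F m W h z R A) (hm : ∀ x y, 0 ≤ m x y)
    {X : Finset V} (hX : X ⊆ (W \ R) \ A.biUnion id) (hconn : ConnOn F (X : Set V))
    (hadj : ∀ Y ∈ A, ∃ y ∈ Y, ∃ x ∈ X, F.Adj y x) (hcard : X.card ≤ z) (hA : A.card < 6) :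
    X ∉ A ∧ PartialClique F m W h z R (insert X A) := by
  have hdisjA : ∀ Y ∈ A, Disjoint X Y := fun Y hY => Finset.disjoint_left.2 fun v hv hvY =>
    (Finset.mem_sdiff.1 (hX hv)).2 (Finset.mem_biUnion.2 ⟨Y, hY, hvY⟩)
  have hXA : X ∉ A := by
    intro hXA
    obtain ⟨x, hx⟩ := hconn.1
    exact Finset.disjoint_left.1 (hdisjA X hXA) hx hx
  refine ⟨hXA, s.subR, ?_, ?_, ?_, ?_, ?_, ?_, ?_, s.cardR, ?_⟩
  · intro Y hY
    rcases Finset.mem_insert.1 hY with rfl | hY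
    · exact fun v hv => (Finset.mem_sdiff.1 (Finset.mem_sdiff.1 (hX hv)).1).1
    · exact s.subA Y hY
  · intro Y hY
    rcases Finset.mem_insert.1 hY with rfl | hY
    · exact hcard
    · exact s.cardA Y hY
  · intro Y hY
    rcases Finset.mem_insert.1 hY with rfl | hY
    · exact hconn
    · exact s.conn Y hY
  · intro Y hY
    rcases Finset.mem_insert.1 hY with rfl | hY
    · exact Finset.disjoint_left.2 fun v hv =>
        (Finset.mem_sdiff.1 (Finset.mem_sdiff.1 (hX hv)).1).2
    · exact s.disjR Y hY
  · intro Y hY Z hZ hne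
    rcases Finset.mem_insert.1 hY with h₁ | hY <;> rcases Finset.mem_insert.1 hZ with h₂ | hZ
    · exact absurd (h₁.trans h₂.symm) hne
    · exact h₁ ▸ hdisjA Z hZ
    · exact h₂ ▸ (hdisjA Y hY).symm
    · exact s.disjA Y hY Z hZ hne
  · intro Y hY Z hZ hne
    rcases Finset.mem_insert.1 hY with h₁ | hY <;> rcases Finset.mem_insert.1 hZ with h₂ | hZ
    · exact absurd (h₁.trans h₂.symm) hne
    · obtain ⟨y, hy, x, hx, hyx⟩ := hadj Z hZ
      exact ⟨x, h₁ ▸ hx, y, hy, hyx.symm⟩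
    · obtain ⟨y, hy, x, hx, hyx⟩ := hadj Y hY
      exact ⟨y, hy, x, h₂ ▸ hx, hyx⟩
    · exact s.adj Y hY Z hZ hne
  · rw [Finset.card_insert_of_notMem hXA]
    omega
  · refine (cut_mono hm subset_rfl (Finset.sdiff_subset_sdiff subset_rfl ?_)).trans s.cutR
    exact Finset.biUnion_subset_biUnion_of_subset_left _ (Finset.subset_insert _ _)

/-- Inside a set in which all large balls intersect, any few vertices lie in a small connected
subset. -/
theorem exists_conn_hub {Y : Finset V} {r : ℕ} (hne : Y.Nonempty)
    (hball : ∀ v ∈ Y, Y.card < 2 * (ballIn F Y v r).card) (T : Finset V) (hT : T ⊆ Y) :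
    ∃ X ⊆ Y, ConnOn F (X : Set V) ∧ T ⊆ X ∧ X.card ≤ T.card * (2 * (r + 1)) + 1 := by
  obtain ⟨v₀, hv₀⟩ := hne
  have hpath : ∀ v ∈ T, ∃ P ⊆ Y, ConnOn F (P : Set V) ∧ v₀ ∈ P ∧ v ∈ P ∧ P.card ≤ 2 * (r + 1) := by
    intro v hv
    obtain ⟨w, hw⟩ : (ballIn F Y v r ∩ ballIn F Y v₀ r).Nonempty := by
      rw [← Finset.card_pos]
      have h₁ := hball v (hT hv)
      have h₂ := hball v₀ hv₀
      have h₃ := Finset.card_union_add_card_inter (ballIn F Y v r) (ballIn F Y v₀ r)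
      have h₄ := Finset.card_le_card (Finset.union_subset (ballIn_subset F Y (hT hv) r)
        (ballIn_subset F Y hv₀ r))
      omega
    obtain ⟨hw₁, hw₂⟩ := Finset.mem_inter.1 hw
    obtain ⟨P, hP, cP, vP, wP, nP⟩ := exists_conn_of_mem_ballIn F Y (hT hv) r hw₁
    obtain ⟨Q, hQ, cQ, vQ, wQ, nQ⟩ := exists_conn_of_mem_ballIn F Y hv₀ r hw₂
    refine ⟨P ∪ Q, Finset.union_subset hP hQ, connOn_of_center (v := w) (by simp [wP]) ?_,
      by simp [vQ], by simp [vP], (Finset.card_union_le _ _).trans (by omega)⟩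
    intro a ha
    rcases Finset.mem_union.1 (Finset.mem_coe.1 ha) with ha | ha
    · exact cP.reach_mono (by simp) wP ha
    · exact cQ.reach_mono (by simp) wQ ha
  choose! P hPY hPc hP₀ hPv hPn using hpath
  refine ⟨T.biUnion P ∪ {v₀}, Finset.union_subset (Finset.biUnion_subset.2 hPY) (by simpa using hv₀),
    connOn_of_center (v := v₀) (by simp) ?_, ?_, ?_⟩
  · intro a ha
    rcases Finset.mem_union.1 (Finset.mem_coe.1 ha) with ha | ha
    · obtain ⟨v, hv, hav⟩ := Finset.mem_biUnion.1 ha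
      refine (hPc v hv).reach_mono ?_ (hP₀ v hv) hav
      exact_mod_cast (Finset.subset_biUnion_of_mem P hv).trans Finset.subset_union_left
    · obtain rfl : a = v₀ := by simpa using ha
      exact .refl
  · exact fun v hv => Finset.mem_union_left _ (Finset.mem_biUnion.2 ⟨v, hv, hPv v hv⟩)
  · refine (Finset.card_union_le _ _).trans ?_
    have := Finset.card_biUnion_le_card_mul T P _ hPn
    simpa using this

/-- A large weighted graph of bounded weighted degree with no `K₃,₃` minor has a sparse cut. -/
theorem exists_sparse_cut [Finite V] (hK : NoK33 F) (hm : ∀ x y, 0 ≤ m x y)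
    (hs : ∀ x y, m x y = m y x) (hF : ∀ x y, m x y ≠ 0 → F.Adj x y)
    (hd : ∀ x ∈ W, ∑ y ∈ W, m x y ≤ 1) (hh : 0 < h) (r : ℕ) (hr : (W.card : ℝ) < (1 + h / 6) ^ r)
    (hz : z = 12 * (r + 1)) (hW : 36 * z / h + 6 * z ≤ (W.card : ℝ) / 4) :
    ∃ X ⊆ W, X.Nonempty ∧ 2 * X.card ≤ W.card ∧ cut m X (W \ X) < h * X.card := by
  classical
  have := Fintype.ofFinite V
  by_contra! hexp
  have hzpos : 0 < z := by omega
  have hz' : (0 : ℝ) < z := by exact_mod_cast hzpos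
  have hzh : 0 < 36 * z / h := by positivity
  obtain ⟨⟨R, A⟩, hs', hmax⟩ := Finset.exists_max_image
    (Finset.univ.filter fun p : Finset V × Finset (Finset V) => PartialClique F m W h z p.1 p.2)
    (fun p => 10 * p.1.card + p.2.card)
    ⟨(∅, ∅), by
      simp only [Finset.mem_filter, Finset.mem_univ, true_and]
      refine ⟨by simp, by simp, by simp, by simp, by simp, by simp, by simp, by simp, by simp, ?_⟩
      simp [cut]⟩
  have s : PartialClique F m W h z R A := (Finset.mem_filter.1 hs').2
  have hmax' : ∀ R' A', PartialClique F m W h z R' A' →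
      10 * R'.card + A'.card ≤ 10 * R.card + A.card := fun R' A' h =>
    hmax (R', A') (Finset.mem_filter.2 ⟨Finset.mem_univ _, h⟩)
  have hRcard := s.card_R_le hm hs hd hh hexp hzpos hW
  set Y := (W \ R) \ A.biUnion id with hY
  have hYW : Y ⊆ W := fun v hv => (Finset.mem_sdiff.1 (Finset.mem_sdiff.1 hv).1).1
  have hYcard : Y.card ≤ W.card := Finset.card_le_card hYW
  have hYpos : Y.Nonempty := by
    rw [← Finset.card_pos]
    have h₁ := Finset.le_card_sdiff R W
    have h₂ := Finset.le_card_sdiff (A.biUnion id) (W \ R)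
    have h₃ := s.card_biUnion_le
    have h₄ : R.card + 6 * z < W.card := by
      have : (R.card : ℝ) + 6 * z < W.card := by linarith
      exact_mod_cast this
    change 0 < ((W \ R) \ A.biUnion id).card
    omega
  have hnbr : ∀ X ∈ A, ∃ y ∈ Y, ∃ x ∈ X, F.Adj x y := by
    intro X hX
    by_contra! hno
    have hcard : 4 * (R.card + X.card) ≤ 3 * W.card := by
      have h₁ : (X.card : ℝ) ≤ z := by exact_mod_cast s.cardA X hX
      have : 4 * ((R.card : ℝ) + X.card) ≤ 3 * W.card := by linarith
      exact_mod_cast this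
    have h₁ := hmax' _ _ (s.absorb_branch hF hh hX (fun x hx y hy => hno y hy x hx) hcard)
    rw [Finset.card_union_of_disjoint (s.disjR X hX).symm, Finset.card_erase_of_mem hX] at h₁
    have h₂ : 0 < X.card := Finset.card_pos.2 (by simpa using (s.conn X hX).1)
    omega
  have hexpY : ∀ X ⊆ Y, X.Nonempty → 2 * X.card ≤ Y.card → h / 6 * X.card ≤ cut m X (Y \ X) := by
    intro X hX hne hcard
    by_contra! hlt
    have hcard' : 4 * (R.card + X.card) ≤ 3 * W.card := by
      have h₁ : 2 * (X.card : ℝ) ≤ W.card := by exact_mod_cast hcard.trans hYcard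
      have : 4 * ((R.card : ℝ) + X.card) ≤ 3 * W.card := by linarith
      exact_mod_cast this
    have h₁ := hmax' _ _ (s.absorb_part hm hX hlt.le hcard')
    rw [Finset.card_union_of_disjoint (Finset.disjoint_right.2 fun v hv =>
      (Finset.mem_sdiff.1 (Finset.mem_sdiff.1 (hX hv)).1).2)] at h₁
    have := hne.card_pos
    omega
  have hdY : ∀ x ∈ Y, ∑ y ∈ Y, m x y ≤ 1 := fun x hx =>
    (Finset.sum_le_sum_of_subset_of_nonneg hYW fun y _ _ => hm x y).trans (hd x (hYW hx))
  have hball : ∀ v ∈ Y, Y.card < 2 * (ballIn F Y v r).card := by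
    intro v hv
    by_contra! hle
    have h₁ := pow_le_card_ballIn hm hs hF hdY (by positivity : 0 ≤ h / 6) hexpY hv r hle
    have h₂ : ((ballIn F Y v r).card : ℝ) ≤ W.card := by
      exact_mod_cast Finset.card_le_card ((ballIn_subset F Y hv r).trans hYW)
    linarith
  by_cases hA : A.card = 6
  · exact not_noK33_of_branch_sets A hA s.conn s.disjA s.adj hK
  have : Nonempty V := ⟨hYpos.choose⟩
  choose! w hwY x hxX hadj using hnbr
  obtain ⟨X, hXY, hconn, hTX, hXcard⟩ := exists_conn_hub hYpos hball (A.image w)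
    (Finset.image_subset_iff.2 hwY)
  have hA6 : A.card < 6 := lt_of_le_of_ne s.le_six hA
  have hsize : X.card ≤ z := by
    have h₁ := Finset.card_image_le (s := A) (f := w)
    have h₂ : (A.image w).card * (2 * (r + 1)) ≤ 5 * (2 * (r + 1)) :=
      Nat.mul_le_mul_right _ (by omega)
    omega
  obtain ⟨hXA, s'⟩ := s.add_branch hm hXY hconn
    (fun Z hZ => ⟨x Z, hxX Z hZ, w Z, hTX (Finset.mem_image_of_mem w hZ), hadj Z hZ⟩) hsize hA6
  have := hmax' _ _ s'
  rw [Finset.card_insert_of_notMem hXA] at this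
  omega

/-- The weighted deficiency of a set. -/
def deficiency (d : V → ℝ) (m : V → V → ℝ) (X : Finset V) : ℝ := ∑ x ∈ X, d x - cut m X X

theorem deficiency_add (d : V → ℝ) (hs : ∀ x y, m x y = m y x) {X W : Finset V} (hX : X ⊆ W) :
    deficiency d m X + deficiency d m (W \ X) = deficiency d m W + 2 * cut m X (W \ X) := by
  have hdisj : Disjoint X (W \ X) := Finset.disjoint_sdiff
  have hW : W = X ∪ (W \ X) := (Finset.union_sdiff_of_subset hX).symm
  have h₁ : cut m W W = cut m X X + cut m X (W \ X) + (cut m (W \ X) X + cut m (W \ X) (W \ X)) := by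
    conv_lhs => rw [hW]
    rw [cut_union_left hdisj, cut_union_right hdisj, cut_union_right hdisj]
  have h₂ : ∑ x ∈ W, d x = ∑ x ∈ X, d x + ∑ x ∈ W \ X, d x := by
    conv_lhs => rw [hW]
    rw [Finset.sum_union hdisj]
  rw [deficiency, deficiency, deficiency, h₁, h₂, cut_comm hs (W \ X) X]
  ring

/-- The slowly decreasing threshold for deficiencies. -/
noncomputable def threshold (δ : ℝ) (n : ℕ) : ℝ := δ / 2 * (1 + 1 / (1 + (Nat.log 2 n : ℝ)))

theorem threshold_anti {δ : ℝ} (hδ : 0 < δ) {a b : ℕ} (hab : a ≤ b) :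
    threshold δ b ≤ threshold δ a := by
  unfold threshold
  have : (Nat.log 2 a : ℝ) ≤ Nat.log 2 b := by exact_mod_cast Nat.log_mono_right hab
  gcongr

theorem threshold_le {δ : ℝ} (hδ : 0 < δ) (n : ℕ) : threshold δ n ≤ δ := by
  unfold threshold
  have : 1 / (1 + (Nat.log 2 n : ℝ)) ≤ 1 := by
    rw [div_le_one (by positivity)]
    linarith [(Nat.cast_nonneg (Nat.log 2 n) : (0 : ℝ) ≤ _)]
  nlinarith

theorem half_le_threshold {δ : ℝ} (hδ : 0 < δ) (n : ℕ) : δ / 2 ≤ threshold δ n := by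
  unfold threshold
  have : 0 ≤ 1 / (1 + (Nat.log 2 n : ℝ)) := by positivity
  nlinarith

theorem threshold_half {δ : ℝ} (hδ : 0 < δ) {a n : ℕ} (ha : 0 < a) (han : 2 * a ≤ n) :
    δ / (2 * Nat.log 2 n * (Nat.log 2 n + 1)) ≤ threshold δ a - threshold δ n := by
  have hl : Nat.log 2 a + 1 ≤ Nat.log 2 n := by
    rw [← Nat.log_mul_base (by norm_num) (by omega)]
    exact Nat.log_mono_right (by omega)
  obtain ⟨l, hl'⟩ : ∃ l, Nat.log 2 n = l + 1 := ⟨Nat.log 2 n - 1, by omega⟩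
  have h₁ : threshold δ a ≥ δ / 2 * (1 + 1 / (1 + (l : ℝ))) := by
    unfold threshold
    have : (Nat.log 2 a : ℝ) ≤ l := by exact_mod_cast (by omega : Nat.log 2 a ≤ l)
    gcongr
  have h₂ : δ / (2 * Nat.log 2 n * (Nat.log 2 n + 1)) =
      δ / 2 * (1 + 1 / (1 + (l : ℝ))) - threshold δ n := by
    unfold threshold
    rw [hl']
    push_cast
    have : (0 : ℝ) ≤ l := Nat.cast_nonneg _
    field_simp
    ring
  linarith

theorem eventually_pow_five_lt (c : ℝ) : ∃ L : ℕ, ∀ l ≥ L, c * ((l : ℝ) + 1) ^ 5 ≤ 2 ^ l := by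
  have h₁ := tendsto_pow_const_div_const_pow_of_one_lt 5 (by norm_num : (1 : ℝ) < 2)
  have h₂ := h₁.eventually (ge_mem_nhds (by positivity : (0 : ℝ) < 1 / (2 * (|c| + 1))))
  obtain ⟨L, hL⟩ := Filter.eventually_atTop.1 h₂
  refine ⟨L, fun l hl => ?_⟩
  have := hL (l + 1) (by omega)
  rw [div_le_div_iff₀ (by positivity) (by positivity)] at this
  push_cast at this
  have h₃ : c * ((l : ℝ) + 1) ^ 5 ≤ (|c| + 1) * ((l : ℝ) + 1) ^ 5 :=
    mul_le_mul_of_nonneg_right (by linarith [le_abs_self c]) (by positivity)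
  rw [pow_succ (2 : ℝ)] at this
  linarith

theorem exists_radius {δ : ℝ} (hδ : 0 < δ) : ∃ N : ℕ, 2 ≤ N ∧ ∀ n ≥ N, ∃ r z : ℕ,
    0 < δ / (4 * Nat.log 2 n * (Nat.log 2 n + 1)) ∧
    (n : ℝ) < (1 + δ / (4 * Nat.log 2 n * (Nat.log 2 n + 1)) / 6) ^ r ∧ z = 12 * (r + 1) ∧
    36 * z / (δ / (4 * Nat.log 2 n * (Nat.log 2 n + 1))) + 6 * z ≤ (n : ℝ) / 4 := by
  set c : ℝ := 24 / δ + 1 with hc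
  obtain ⟨L, hL⟩ := eventually_pow_five_lt (1600 * c ^ 2)
  refine ⟨2 ^ (L + 1), by rw [pow_succ]; have := Nat.one_le_two_pow (n := L); omega, fun n hn => ?_⟩
  have hn0 : n ≠ 0 := by
    rintro rfl
    have := Nat.one_le_two_pow (n := L + 1)
    omega
  set l := Nat.log 2 n with hl
  have hlL : L + 1 ≤ l := by
    exact Nat.le_log_of_pow_le (by norm_num) hn
  have hl1 : (1 : ℝ) ≤ l := by exact_mod_cast (by omega : 1 ≤ l)
  set h := δ / (4 * l * (l + 1)) with hh
  have hpos : 0 < h := by positivity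
  have hc1 : 1 ≤ c := by
    have : 0 < 24 / δ := by positivity
    linarith
  have h6 : 6 / h = 24 / δ * (l * (l + 1)) := by
    rw [hh]
    field_simp
    ring
  have hl2 : (l : ℝ) * (l + 1) ≤ (l + 1) ^ 2 := by nlinarith
  have h6le : 6 / h ≤ (c - 1) * (l + 1) ^ 2 := by
    rw [h6, hc]
    have := mul_le_mul_of_nonneg_left hl2 (by positivity : 0 ≤ 24 / δ)
    linarith
  set b := ⌈6 / h⌉₊ with hb
  have hble : (b : ℝ) ≤ c * (l + 1) ^ 2 := by
    have := (Nat.ceil_lt_add_one (by positivity : 0 ≤ 6 / h)).le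
    nlinarith
  have hone : (1 : ℝ) ≤ (l + 1) ^ 2 := by nlinarith
  have hone3 : (1 : ℝ) ≤ (l + 1) ^ 3 := by
    have : ((l : ℝ) + 1) ^ 3 = (l + 1) ^ 2 * (l + 1) := by ring
    nlinarith
  refine ⟨b * (l + 1), 12 * (b * (l + 1) + 1), hpos, ?_, rfl, ?_⟩
  · have h₁ : (2 : ℝ) ≤ (1 + h / 6) ^ b := by
      have := one_add_mul_le_pow (by linarith : -2 ≤ h / 6) b
      have h₂ : 6 / h ≤ b := Nat.le_ceil _
      rw [div_le_iff₀ hpos] at h₂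
      linarith
    rw [pow_mul]
    have h₂ : (n : ℝ) < 2 ^ (l + 1) := by exact_mod_cast Nat.lt_pow_succ_log_self (by norm_num) n
    exact h₂.trans_le (pow_le_pow_left₀ (by norm_num) h₁ _)
  · have h₁ : ((12 * (b * (l + 1) + 1) : ℕ) : ℝ) ≤ 24 * c * (l + 1) ^ 3 := by
      push_cast
      have : (b : ℝ) * (l + 1) ≤ c * (l + 1) ^ 2 * (l + 1) :=
        mul_le_mul_of_nonneg_right hble (by positivity)
      nlinarith
    have h₂ : 36 / h + 6 ≤ 12 * c * (l + 1) ^ 2 := by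
      have : 36 / h = 6 * (6 / h) := by ring
      nlinarith
    have h₃ : (36 / h + 6) * ((12 * (b * (l + 1) + 1) : ℕ) : ℝ) ≤
        12 * c * (l + 1) ^ 2 * (24 * c * (l + 1) ^ 3) :=
      mul_le_mul h₂ h₁ (by positivity) (by positivity)
    have h₄ := hL l (by omega)
    have h₅ : (2 : ℝ) ^ l ≤ n := by exact_mod_cast Nat.pow_log_le_self 2 hn0
    have h₆ : 0 ≤ c ^ 2 * ((l : ℝ) + 1) ^ 5 := by positivity
    have h₇ : 36 * ((12 * (b * (l + 1) + 1) : ℕ) : ℝ) / h + 6 * ((12 * (b * (l + 1) + 1) : ℕ) : ℝ) =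
        (36 / h + 6) * ((12 * (b * (l + 1) + 1) : ℕ) : ℝ) := by ring
    rw [h₇]
    nlinarith

/-- A weighted graph with small deficiency and no `K₃,₃` minor contains a set of bounded size in
which the deficiency of every subset is controlled. -/
theorem exists_bounded_cluster {δ : ℝ} (hδ : 0 < δ) : ∃ N : ℕ, ∀ (U : Type) [Fintype U]
    [DecidableEq U] [Nonempty U] (F : SimpleGraph U) (m : U → U → ℝ) (d : U → ℝ),
    NoK33 F → (∀ x y, 0 ≤ m x y) → (∀ x y, m x y = m y x) → (∀ x y, m x y ≠ 0 → F.Adj x y) →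
    (∀ x, ∑ y, m x y ≤ 1) → deficiency d m Finset.univ ≤ δ / 2 * Fintype.card U →
    ∃ W : Finset U, W.Nonempty ∧ W.card ≤ N ∧ ∀ X ⊆ W,
      deficiency d m X ≤ 2 * cut m X (W \ X) + δ * X.card := by
  classical
  obtain ⟨N, hN2, hN⟩ := exists_radius hδ
  refine ⟨N, fun U _ _ _ F m d hK hm hs hF hd hdef => ?_⟩
  obtain ⟨W, hW, hmin⟩ := Finset.exists_min_image
    (Finset.univ.filter fun W : Finset U => W.Nonempty ∧
      deficiency d m W ≤ threshold δ W.card * W.card) Finset.card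
    ⟨Finset.univ, by
      simp only [Finset.mem_filter, Finset.mem_univ, true_and, Finset.univ_nonempty]
      refine hdef.trans (mul_le_mul_of_nonneg_right (half_le_threshold hδ _) (Nat.cast_nonneg _))⟩
  obtain ⟨-, hne, hdefW⟩ := Finset.mem_filter.1 hW
  have hsmall : ∀ X ⊂ W, X.Nonempty → threshold δ X.card * X.card < deficiency d m X := by
    intro X hX hXne
    by_contra! hle
    have := hmin X (Finset.mem_filter.2 ⟨Finset.mem_univ _, hXne, hle⟩)
    have := Finset.card_lt_card hX
    omega
  have hcompl : ∀ X ⊆ W, X.Nonempty → X ≠ W →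
      threshold δ W.card * (W \ X).card < deficiency d m (W \ X) := by
    intro X hX hXne hXW
    have hss : W \ X ⊂ W := Finset.sdiff_ssubset hX hXne
    have hne' : (W \ X).Nonempty := Finset.sdiff_nonempty.2 fun h => hXW (subset_antisymm hX h)
    refine lt_of_le_of_lt ?_ (hsmall _ hss hne')
    exact mul_le_mul_of_nonneg_right (threshold_anti hδ (Finset.card_le_card hss.subset))
      (Nat.cast_nonneg _)
  have hcardadd : ∀ X ⊆ W, ((W \ X).card : ℝ) + X.card = W.card := fun X hX => by
    exact_mod_cast Finset.card_sdiff_add_card_eq_card hX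
  refine ⟨W, hne, ?_, ?_⟩
  · by_contra! hlt
    obtain ⟨r, z, hpos, hr, hz, hzW⟩ := hN W.card hlt.le
    obtain ⟨X, hX, hXne, hXcard, hcut⟩ := exists_sparse_cut hK hm hs hF
      (fun x _ => (Finset.sum_le_sum_of_subset_of_nonneg (Finset.subset_univ W)
        fun y _ _ => hm x y).trans (hd x)) hpos r hr hz hzW
    have hXpos := hXne.card_pos
    have hXW : X ≠ W := by
      rintro rfl
      omega
    have h₁ := hsmall X (Finset.ssubset_iff_subset_ne.2 ⟨hX, hXW⟩) hXne
    have h₂ := hcompl X hX hXne hXW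
    have h₃ := deficiency_add d hs hX
    have h₄ := threshold_half hδ hXpos hXcard
    have h₅ := mul_le_mul_of_nonneg_right h₄ (Nat.cast_nonneg X.card : (0 : ℝ) ≤ X.card)
    have h₆ : δ / (2 * Nat.log 2 W.card * (Nat.log 2 W.card + 1)) =
        2 * (δ / (4 * Nat.log 2 W.card * (Nat.log 2 W.card + 1))) := by
      rw [mul_div_assoc']
      rw [div_eq_div_iff]
      · ring
      · intro h0
        rw [show (4 * (Nat.log 2 W.card : ℝ) * (Nat.log 2 W.card + 1)) =
          2 * (2 * Nat.log 2 W.card * (Nat.log 2 W.card + 1)) by ring, h0] at hpos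
        simp at hpos
      · intro h0
        rw [h0] at hpos
        simp at hpos
    have h₇ := hcardadd X hX
    rw [h₆] at h₅
    have h₈ : threshold δ W.card * W.card =
      threshold δ W.card * (W \ X).card + threshold δ W.card * X.card := by rw [← h₇]; ring
    linarith
  · intro X hX
    rcases X.eq_empty_or_nonempty with rfl | hXne
    · simp [deficiency, cut]
    have hth := mul_le_mul_of_nonneg_right (threshold_le hδ W.card)
      (Nat.cast_nonneg X.card : (0 : ℝ) ≤ X.card)
    by_cases hXW : X = W
    · subst hXW
      simp only [sdiff_self, Finset.bot_eq_empty]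
      have : cut m X ∅ = 0 := by simp [cut]
      rw [this]
      linarith
    · have h₂ := hcompl X hX hXne hXW
      have h₃ := deficiency_add d hs hX
      have h₇ := hcardadd X hX
      have h₈ : threshold δ W.card * W.card =
        threshold δ W.card * (W \ X).card + threshold δ W.card * X.card := by rw [← h₇]; ring
      linarith

end Clusters

end FrugalPlanar

namespace FrugalPlanar

theorem exists_involution_orbit {W : Type} {σ τ : Equiv.Perm W} (hσ : σ * σ = 1) (hτ : τ * τ = 1)
    {t : W} (ht : τ t = t) : ∃ P : Set W, t ∈ P ∧ (∀ w ∈ P, σ w ∈ P) ∧ (∀ w ∈ P, τ w ∈ P) ∧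
      ∀ u ∈ P, ∀ v ∈ P, σ u = u → σ v = v → u = v := by
  set π := σ * τ with hπ
  have hτinv : τ⁻¹ = τ := inv_eq_of_mul_eq_one_left hτ
  have hσinv : σ⁻¹ = σ := inv_eq_of_mul_eq_one_left hσ
  have hconj : ∀ i : ℤ, τ * π ^ i = π ^ (-i) * τ := by
    intro i
    have h : τ * π * τ⁻¹ = π⁻¹ := by
      rw [hπ, mul_inv_rev, hτinv, hσinv, mul_assoc, mul_assoc, hτ, mul_one]
    have h2 : τ * π ^ i * τ⁻¹ = π ^ (-i) := by
      rw [← conj_zpow, h, inv_zpow, zpow_neg]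
    rw [← h2]
    group
  have hτi : ∀ i : ℤ, τ ((π ^ i) t) = (π ^ (-i)) t := by
    intro i
    have := congrArg (fun p : Equiv.Perm W => p t) (hconj i)
    simpa [Equiv.Perm.mul_apply, ht] using this
  have hσi : ∀ i : ℤ, σ ((π ^ i) t) = (π ^ (1 - i)) t := by
    intro i
    have h : σ = π * τ := by rw [hπ, mul_assoc, hτ, mul_one]
    rw [h, Equiv.Perm.mul_apply, hτi, ← Equiv.Perm.mul_apply, ← zpow_one_add]
    rfl
  refine ⟨{w | ∃ i : ℤ, (π ^ i) t = w}, ⟨0, rfl⟩, ?_, ?_, ?_⟩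
  · rintro _ ⟨i, rfl⟩
    exact ⟨1 - i, (hσi i).symm⟩
  · rintro _ ⟨i, rfl⟩
    exact ⟨-i, (hτi i).symm⟩
  · rintro _ ⟨i, rfl⟩ _ ⟨j, rfl⟩ hi hj
    let S : AddSubgroup ℤ :=
      { carrier := {n | (π ^ n) t = t}
        zero_mem' := rfl
        add_mem' := by
          intro a b ha hb
          change (π ^ (a + b)) t = t
          rw [zpow_add, Equiv.Perm.mul_apply]
          exact (congrArg _ hb).trans ha
        neg_mem' := by
          intro a ha
          change (π ^ (-a)) t = t
          rw [zpow_neg, Equiv.Perm.inv_eq_iff_eq]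
          exact ha.symm }
    have hmem : ∀ i : ℤ, σ ((π ^ i) t) = (π ^ i) t → 2 * i - 1 ∈ S := by
      intro i hi
      change (π ^ (2 * i - 1)) t = t
      rw [hσi] at hi
      have h3 : (2 * i - 1 : ℤ) = -(1 - i) + i := by ring
      rw [h3, zpow_add, Equiv.Perm.mul_apply, ← hi, ← Equiv.Perm.mul_apply, ← zpow_add]
      simp
    have h4 : i - j ∈ S := by
      have ha := S.zsmul_mem (hmem i hi) (i - j)
      have hb := S.zsmul_mem (S.sub_mem (hmem i hi) (hmem j hj)) (i - 1)
      have := S.sub_mem ha hb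
      convert this using 1
      simp only [smul_eq_mul]
      ring
    have h5 : (π ^ (i - j)) t = t := h4
    calc (π ^ i) t = (π ^ (j + (i - j))) t := by congr 2; ring
      _ = (π ^ j) ((π ^ (i - j)) t) := by rw [zpow_add, Equiv.Perm.mul_apply]
      _ = _ := by rw [h5]

theorem involutive_of_mul_self {W : Type} {σ : Equiv.Perm W} (h : σ * σ = 1) : Function.Involutive σ :=
  fun x => by rw [← Equiv.Perm.mul_apply, h, Equiv.Perm.one_apply]

theorem toPerm_mul_self {W : Type} {f : W → W} (h : Function.Involutive f) : h.toPerm * h.toPerm = 1 := by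
  ext x
  simpa using h x

variable {W : Type} [Fintype W] [DecidableEq W]

/-- Weight of an involution, regarded as a matching, counting every edge twice. -/
def matchingWeight (c : W → W → ℝ) (σ : Equiv.Perm W) : ℝ := ∑ v, c v (σ v)

/-- `σ` is an involution of maximum weight. -/
def IsMaxMatching (c : W → W → ℝ) (σ : Equiv.Perm W) : Prop :=
  σ * σ = 1 ∧ ∀ τ : Equiv.Perm W, τ * τ = 1 → matchingWeight c τ ≤ matchingWeight c σ

theorem IsMaxMatching.unmatch {c : W → W → ℝ} (hsymm : ∀ u v, c u v = c v u)
    (hdiag : ∀ u, c u u = 0) {σ : Equiv.Perm W} (h : IsMaxMatching c σ) :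
    ∃ σ', IsMaxMatching c σ' ∧ ∀ v, c v (σ v) = 0 → σ' v = v := by
  have hσ := involutive_of_mul_self h.1
  have hinv : Function.Involutive (fun v => if c v (σ v) = 0 then v else σ v) := by
    intro v
    by_cases hv : c v (σ v) = 0
    · simp [hv]
    · have : c (σ v) v ≠ 0 := by rwa [hsymm]
      simp [hv, hσ v, this]
  refine ⟨hinv.toPerm, ⟨toPerm_mul_self hinv, fun τ hτ => (h.2 τ hτ).trans ?_⟩, ?_⟩
  · unfold matchingWeight
    refine Finset.sum_le_sum fun v _ => ?_
    by_cases hv : c v (σ v) = 0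
    · simp [hv, hdiag]
    · simp [hv]
  · intro v hv
    simp [hv]

theorem IsMaxMatching.not_adj {c : W → W → ℝ} (hsymm : ∀ u v, c u v = c v u)
    (hdiag : ∀ u, c u u = 0) {σ : Equiv.Perm W} (h : IsMaxMatching c σ) {u v : W}
    (hu : σ u = u) (hv : σ v = v) : c u v ≤ 0 := by
  by_contra! hc
  have huv : u ≠ v := by
    rintro rfl
    rw [hdiag] at hc
    exact lt_irrefl _ hc
  have hσ := involutive_of_mul_self h.1
  set τ := Equiv.swap u v * σ with hτdef
  have hτv : ∀ w, τ w = if w = u then v else if w = v then u else σ w := by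
    intro w
    rw [hτdef, Equiv.Perm.mul_apply]
    split_ifs with h1 h2
    · rw [h1, hu, Equiv.swap_apply_left]
    · rw [h2, hv, Equiv.swap_apply_right]
    · refine Equiv.swap_apply_of_ne_of_ne ?_ ?_
      · intro h3
        exact h1 (σ.injective (h3.trans hu.symm))
      · intro h3
        exact h2 (σ.injective (h3.trans hv.symm))
  have hτ : τ * τ = 1 := by
    ext w
    rw [Equiv.Perm.mul_apply, Equiv.Perm.one_apply, hτv (τ w), hτv w]
    by_cases h1 : w = u
    · subst h1; simp [huv.symm]
    by_cases h2 : w = v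
    · subst h2; simp [h1]
    have h3 : σ w ≠ u := fun h3 => h1 (σ.injective (h3.trans hu.symm))
    have h4 : σ w ≠ v := fun h3 => h2 (σ.injective (h3.trans hv.symm))
    simp [h1, h2, h3, h4, hσ w]
  have h1 := h.2 τ hτ
  have h2 : matchingWeight c σ < matchingWeight c τ := by
    unfold matchingWeight
    refine Finset.sum_lt_sum (fun w _ => ?_) ⟨u, Finset.mem_univ _, ?_⟩
    · rw [hτv]
      split_ifs with h1 h2
      · rw [h1, hu, hdiag]; exact hc.le
      · rw [h2, hv, hdiag, hsymm]; exact hc.le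
      · exact le_rfl
    · rw [hτv, if_pos rfl, hu, hdiag]; exact hc
  linarith

open scoped Classical in
theorem IsMaxMatching.exchange {c : W → W → ℝ} {σ τ : Equiv.Perm W} (hσ : IsMaxMatching c σ)
    (hτ : IsMaxMatching c τ) {P : Set W} (hPσ : ∀ w ∈ P, σ w ∈ P) (hPτ : ∀ w ∈ P, τ w ∈ P) :
    ∃ σ', IsMaxMatching c σ' ∧ (∀ w ∈ P, σ' w = τ w) ∧ ∀ w ∉ P, σ' w = σ w := by
  have key : ∀ α β : Equiv.Perm W, α * α = 1 → β * β = 1 → (∀ w ∈ P, α w ∈ P) →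
      (∀ w ∈ P, β w ∈ P) → Function.Involutive (fun w => if w ∈ P then α w else β w) := by
    intro α β hα hβ hPα hPβ w
    by_cases hw : w ∈ P
    · simp [hw, hPα w hw, involutive_of_mul_self hα w]
    · have : β w ∉ P := fun h => hw (by simpa [involutive_of_mul_self hβ w] using hPβ _ h)
      simp [hw, this, involutive_of_mul_self hβ w]
  have h1 := key τ σ hτ.1 hσ.1 hPτ hPσ
  have h2 := key σ τ hσ.1 hτ.1 hPσ hPτ
  have hsum : matchingWeight c h1.toPerm + matchingWeight c h2.toPerm =
      matchingWeight c σ + matchingWeight c τ := by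
    unfold matchingWeight
    rw [← Finset.sum_add_distrib, ← Finset.sum_add_distrib]
    refine Finset.sum_congr rfl fun w _ => ?_
    by_cases hw : w ∈ P
    · simp [hw, add_comm]
    · simp [hw]
  refine ⟨h1.toPerm, ⟨toPerm_mul_self h1, fun ρ hρ => ?_⟩, ?_, ?_⟩
  · have h3 := hτ.2 _ (toPerm_mul_self h2)
    have h4 := hσ.2 ρ hρ
    linarith
  · intro w hw
    simp [hw]
  · intro w hw
    simp [hw]

theorem IsMaxMatching.eq_of_reachable {c : W → W → ℝ} (hsymm : ∀ u v, c u v = c v u)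
    (hdiag : ∀ u, c u u = 0) (hall : ∀ t, ∃ τ, IsMaxMatching c τ ∧ τ t = t) {u v : W}
    (huv : Relation.ReflTransGen (fun a b => 0 < c a b) u v) :
    ∀ σ, IsMaxMatching c σ → σ u = u → σ v = v → u = v := by
  induction huv using Relation.ReflTransGen.head_induction_on with
  | refl => exact fun _ _ _ _ => rfl
  | @head u t hut htv ih =>
    intro σ hσ hu hv
    by_contra hne
    obtain ⟨τ, hτ, ht⟩ := hall t
    obtain ⟨P, htP, hPσ, hPτ, hP⟩ := exists_involution_orbit hσ.1 hτ.1 ht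
    obtain ⟨ρ, hρ, hρP, hρ'⟩ := hσ.exchange hτ hPσ hPτ
    have hρt : ρ t = t := (hρP t htP).trans ht
    by_cases huP : u ∈ P
    · have hvP : v ∉ P := fun hvP => hne (hP u huP v hvP hu hv)
      have := ih ρ hρ hρt ((hρ' v hvP).trans hv)
      exact hvP (this ▸ htP)
    · exact absurd (hρ.not_adj hsymm hdiag ((hρ' u huP).trans hu) hρt) (not_le.2 hut)

/-- A direction in which the weights of a maximum matching problem can be decreased: its pairing
with the fractional matching is at most its weight on every maximum matching. -/
theorem exists_direction {x c : W → W → ℝ} (hx : ∀ u v, 0 ≤ x u v) (hxs : ∀ u v, x u v = x v u)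
    (hdeg : ∀ u, ∑ v, x u v ≤ 1)
    (hodd : ∀ X : Finset W, Odd X.card → 3 ≤ X.card → ∑ u ∈ X, ∑ v ∈ X, x u v ≤ X.card - 1)
    (hc : ∀ u v, 0 ≤ c u v) (hsymm : ∀ u v, c u v = c v u) (hdiag : ∀ u, c u u = 0)
    (hne : ∃ u v, 0 < c u v) :
    ∃ h : W → W → ℝ, (∀ u v, 0 ≤ h u v) ∧ (∀ u v, h u v = h v u) ∧ (∀ u v, h u v ≤ 1) ∧
      (∀ u v, c u v = 0 → h u v = 0) ∧ (∃ u v, 0 < h u v) ∧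
      ∀ σ, IsMaxMatching c σ → ∑ u, ∑ v, h u v * x u v ≤ matchingWeight h σ := by
  classical
  by_cases hcase : ∃ v, (∃ w, 0 < c v w) ∧ ∀ σ, IsMaxMatching c σ → 0 < c v (σ v)
  · obtain ⟨v, ⟨w₀, hw₀⟩, hv⟩ := hcase
    refine ⟨fun a b => if 0 < c a b ∧ (a = v ∨ b = v) then 1 else 0, ?_, ?_, ?_, ?_, ?_, ?_⟩
    · intro a b; dsimp only; split_ifs <;> norm_num
    · intro a b; exact if_congr (by rw [hsymm, or_comm]) rfl rfl
    · intro a b; dsimp only; split_ifs <;> norm_num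
    · intro a b hab; simp [hab]
    · exact ⟨v, w₀, by simp [hw₀]⟩
    · intro σ hσ
      have hpos := hv σ hσ
      have hneσ : σ v ≠ v := by
        intro h; rw [h, hdiag] at hpos; exact lt_irrefl _ hpos
      have h1 : ∑ a, ∑ b, (if 0 < c a b ∧ (a = v ∨ b = v) then (1 : ℝ) else 0) * x a b ≤ 2 := by
        calc ∑ a, ∑ b, (if 0 < c a b ∧ (a = v ∨ b = v) then (1 : ℝ) else 0) * x a b
            ≤ ∑ a, ∑ b, ((if a = v then x a b else 0) + if b = v then x a b else 0) := by
              refine Finset.sum_le_sum fun a _ => Finset.sum_le_sum fun b _ => ?_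
              have := hx a b
              split_ifs <;> simp_all
          _ = ∑ b, x v b + ∑ a, x a v := by
              simp only [Finset.sum_add_distrib]
              congr 1
              · rw [Finset.sum_comm]
                simp
              · simp
          _ ≤ 2 := by
              have h2 : ∑ a, x a v = ∑ a, x v a := Finset.sum_congr rfl fun a _ => hxs a v
              linarith [hdeg v]
      refine h1.trans ?_
      unfold matchingWeight
      calc (2 : ℝ) = ∑ a ∈ {v, σ v}, (1 : ℝ) := by
            rw [Finset.sum_pair hneσ.symm]; norm_num
        _ ≤ ∑ a ∈ {v, σ v}, (if 0 < c a (σ a) ∧ (a = v ∨ σ a = v) then (1 : ℝ) else 0) := by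
            refine Finset.sum_le_sum fun a ha => ?_
            rw [Finset.mem_insert, Finset.mem_singleton] at ha
            rcases ha with rfl | rfl
            · simp [hpos]
            · rw [involutive_of_mul_self hσ.1 v, hsymm]
              simp [hpos]
        _ ≤ _ := Finset.sum_le_sum_of_subset_of_nonneg (Finset.subset_univ _) fun a _ _ => by
            split_ifs <;> norm_num
  · push Not at hcase
    obtain ⟨u₀, v₀, hu₀⟩ := hne
    set X : Finset W := Finset.univ.filter
      fun w => Relation.ReflTransGen (fun a b => 0 < c a b) u₀ w with hX
    have hmemX : ∀ w, w ∈ X ↔ Relation.ReflTransGen (fun a b => 0 < c a b) u₀ w := by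
      intro w; simp [hX]
    have hclosed : ∀ a ∈ X, ∀ b, 0 < c a b → b ∈ X := fun a ha b hab =>
      (hmemX b).2 (((hmemX a).1 ha).tail hab)
    have hu₀X : u₀ ∈ X := (hmemX _).2 .refl
    have hv₀X : v₀ ∈ X := hclosed _ hu₀X _ hu₀
    have hsymR : ∀ a b, Relation.ReflTransGen (fun a b => 0 < c a b) a b →
        Relation.ReflTransGen (fun a b => 0 < c a b) b a := by
      intro a b h
      induction h with
      | refl => exact .refl
      | tail _ hbc ih => exact .head (by rwa [hsymm]) ih
    -- vertices without positive edges are harmless: they can be fixed by any maximum matching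
    have hMex : ∃ σ, IsMaxMatching c σ := by
      obtain ⟨σ, hσ, hmax⟩ := Finset.exists_max_image
        (Finset.univ.filter fun σ : Equiv.Perm W => σ * σ = 1) (matchingWeight c) ⟨1, by simp⟩
      exact ⟨σ, by simpa using hσ, fun τ hτ => hmax τ (by simpa using hτ)⟩
    have hall : ∀ t, ∃ τ, IsMaxMatching c τ ∧ τ t = t := by
      intro t
      have : ∃ σ, IsMaxMatching c σ ∧ c t (σ t) = 0 := by
        by_cases ht : ∃ w, 0 < c t w
        · obtain ⟨σ, hσ, hle⟩ := hcase t ht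
          exact ⟨σ, hσ, le_antisymm hle (hc _ _)⟩
        · obtain ⟨σ, hσ⟩ := hMex
          push Not at ht
          exact ⟨σ, hσ, le_antisymm (ht _) (hc _ _)⟩
      obtain ⟨σ, hσ, h0⟩ := this
      obtain ⟨σ', hσ', h'⟩ := hσ.unmatch hsymm hdiag
      exact ⟨σ', hσ', h' t h0⟩
    have huniq : ∀ σ, IsMaxMatching c σ → ∀ a ∈ X, ∀ b ∈ X, c a (σ a) = 0 → c b (σ b) = 0 →
        a = b := by
      intro σ hσ a ha b hb ha0 hb0
      obtain ⟨σ', hσ', h'⟩ := hσ.unmatch hsymm hdiag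
      exact IsMaxMatching.eq_of_reachable hsymm hdiag hall
        ((hsymR _ _ ((hmemX a).1 ha)).trans ((hmemX b).1 hb)) σ' hσ' (h' a ha0) (h' b hb0)
    have hcount : ∀ σ, IsMaxMatching c σ → X.card ≤ (X.filter fun a => 0 < c a (σ a)).card + 1 := by
      intro σ hσ
      have h1 := Finset.card_filter_add_card_filter_not (s := X) (fun a => 0 < c a (σ a))
      have h2 : (X.filter fun a => ¬ 0 < c a (σ a)).card ≤ 1 := by
        rw [Finset.card_le_one]
        intro a ha b hb
        rw [Finset.mem_filter] at ha hb
        exact huniq σ hσ a ha.1 b hb.1 (le_antisymm (not_lt.1 ha.2) (hc _ _))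
          (le_antisymm (not_lt.1 hb.2) (hc _ _))
      omega
    have heven : ∀ σ, IsMaxMatching c σ → Even (X.filter fun a => 0 < c a (σ a)).card := by
      intro σ hσ
      have hinv := involutive_of_mul_self hσ.1
      have h1 : ∑ a ∈ X.filter (fun a => 0 < c a (σ a)), (1 : ZMod 2) = 0 := by
        refine Finset.sum_involution (fun a _ => σ a) (fun _ _ => by decide) ?_ ?_ ?_
        · intro a ha _ h
          have := (Finset.mem_filter.1 ha).2
          rw [h, hdiag] at this
          exact lt_irrefl _ this
        · intro a ha
          obtain ⟨haX, hpos⟩ := Finset.mem_filter.1 ha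
          refine Finset.mem_filter.2 ⟨hclosed a haX _ hpos, ?_⟩
          rwa [hinv a, hsymm]
        · intro a _
          exact hinv a
      rw [Finset.sum_const, nsmul_eq_mul, mul_one, ZMod.natCast_eq_zero_iff] at h1
      exact even_iff_two_dvd.2 h1
    have hXodd : Odd X.card := by
      obtain ⟨σ, hσ, h0⟩ := hall u₀
      have h1 := hcount σ hσ
      have h2 : (X.filter fun a => 0 < c a (σ a)).card < X.card := by
        refine Finset.card_lt_card (Finset.filter_ssubset.2 ⟨u₀, hu₀X, ?_⟩)
        rw [h0, hdiag]
        exact lt_irrefl _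
      have h3 : X.card = (X.filter fun a => 0 < c a (σ a)).card + 1 := by omega
      rw [h3]
      exact (heven σ hσ).add_one
    have hX3 : 3 ≤ X.card := by
      have : 1 < X.card := Finset.one_lt_card.2 ⟨u₀, hu₀X, v₀, hv₀X, by
        rintro rfl
        rw [hdiag] at hu₀
        exact lt_irrefl _ hu₀⟩
      obtain ⟨r, hr⟩ := hXodd
      omega
    refine ⟨fun a b => if 0 < c a b ∧ a ∈ X ∧ b ∈ X then 1 else 0, ?_, ?_, ?_, ?_, ?_, ?_⟩
    · intro a b; dsimp only; split_ifs <;> norm_num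
    · intro a b; exact if_congr (by rw [hsymm, and_comm (a := a ∈ X)]) rfl rfl
    · intro a b; dsimp only; split_ifs <;> norm_num
    · intro a b hab; simp [hab]
    · exact ⟨u₀, v₀, by simp [hu₀, hu₀X, hv₀X]⟩
    · intro σ hσ
      calc ∑ a, ∑ b, (if 0 < c a b ∧ a ∈ X ∧ b ∈ X then (1 : ℝ) else 0) * x a b
          ≤ ∑ a, ∑ b, (if a ∈ X then if b ∈ X then x a b else 0 else 0) := by
            refine Finset.sum_le_sum fun a _ => Finset.sum_le_sum fun b _ => ?_
            have := hx a b
            split_ifs <;> simp_all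
        _ = ∑ a ∈ X, ∑ b ∈ X, x a b := by
            rw [← Finset.sum_filter_add_sum_filter_not Finset.univ (· ∈ X)]
            rw [Finset.sum_eq_zero (s := Finset.univ.filter (· ∉ X)), add_zero]
            · rw [Finset.filter_mem_eq_inter, Finset.univ_inter]
              refine Finset.sum_congr rfl fun a ha => ?_
              simp [ha]
            · intro a ha
              simp [(Finset.mem_filter.1 ha).2]
        _ ≤ X.card - 1 := hodd X hXodd hX3
        _ ≤ ((X.filter fun a => 0 < c a (σ a)).card : ℝ) := by
            have := hcount σ hσ
            have : (X.card : ℝ) ≤ (X.filter fun a => 0 < c a (σ a)).card + 1 := by exact_mod_cast this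
            linarith
        _ = ∑ a ∈ X.filter (fun a => 0 < c a (σ a)), (1 : ℝ) := by simp
        _ ≤ ∑ a ∈ X.filter (fun a => 0 < c a (σ a)),
              (if 0 < c a (σ a) ∧ a ∈ X ∧ σ a ∈ X then (1 : ℝ) else 0) := by
            refine Finset.sum_le_sum fun a ha => ?_
            obtain ⟨haX, hpos⟩ := Finset.mem_filter.1 ha
            rw [if_pos ⟨hpos, haX, hclosed a haX _ hpos⟩]
        _ ≤ matchingWeight _ σ := Finset.sum_le_sum_of_subset_of_nonneg (Finset.subset_univ _)
            fun a _ _ => by split_ifs <;> norm_num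

end FrugalPlanar

namespace FrugalPlanar

theorem eventually_mul_lt (a : ℝ) {b : ℝ} (hb : 0 < b) :
    ∀ᶠ t in nhdsWithin (0 : ℝ) (Set.Ioi 0), t * a < b := by
  have h : Filter.Tendsto (fun t : ℝ => t * a) (nhdsWithin 0 (Set.Ioi 0)) (nhds (0 * a)) :=
    ((continuous_id.mul continuous_const).tendsto 0).mono_left nhdsWithin_le_nhds
  rw [zero_mul] at h
  exact h.eventually (gt_mem_nhds hb)

variable {W : Type} [Fintype W] [DecidableEq W]

theorem exists_weight_le_matchingWeight {x : W → W → ℝ} (hx : ∀ u v, 0 ≤ x u v)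
    (hxs : ∀ u v, x u v = x v u) (hdeg : ∀ u, ∑ v, x u v ≤ 1)
    (hodd : ∀ X : Finset W, Odd X.card → 3 ≤ X.card → ∑ u ∈ X, ∑ v ∈ X, x u v ≤ X.card - 1)
    {c : W → W → ℝ} (hc : ∀ u v, 0 ≤ c u v) (hcs : ∀ u v, c u v = c v u)
    (hcd : ∀ u, c u u = 0) :
    ∃ σ : Equiv.Perm W, σ * σ = 1 ∧ ∑ u, ∑ v, c u v * x u v ≤ matchingWeight c σ := by
  classical
  by_contra! hcon
  set J : Finset (Equiv.Perm W) := Finset.univ.filter fun σ => σ * σ = 1 with hJ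
  have hJmem : ∀ σ, σ ∈ J ↔ σ * σ = 1 := fun σ => by simp [hJ]
  have hJne : J.Nonempty := ⟨1, by simp [hJ]⟩
  set F : (W → W → ℝ) → ℝ :=
    fun c => ∑ u, ∑ v, c u v * x u v - J.sup' hJne (matchingWeight c) with hF
  set K : Set (W → W → ℝ) := {c | (∀ u v, 0 ≤ c u v) ∧ (∀ u v, c u v = c v u) ∧ (∀ u, c u u = 0) ∧
    ∑ u, ∑ v, c u v ≤ 1} with hK
  have hFcont : Continuous F := by
    refine Continuous.sub (by fun_prop) ?_
    refine Continuous.finset_sup'_apply hJne fun σ _ => ?_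
    unfold matchingWeight
    fun_prop
  have hKclosed : IsClosed K := by
    simp only [hK, Set.ofPred_and, Set.ofPred_forall]
    refine IsClosed.inter ?_ (IsClosed.inter ?_ (IsClosed.inter ?_ ?_))
    · exact isClosed_iInter fun u => isClosed_iInter fun v =>
        isClosed_le continuous_const (by fun_prop)
    · exact isClosed_iInter fun u => isClosed_iInter fun v =>
        isClosed_eq (by fun_prop) (by fun_prop)
    · exact isClosed_iInter fun u => isClosed_eq (by fun_prop) (by fun_prop)
    · exact isClosed_le (by fun_prop) continuous_const
  have hKcomp : IsCompact K := by
    refine IsCompact.of_isClosed_subset (isCompact_Icc (a := (0 : W → W → ℝ)) (b := 1)) hKclosed ?_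
    rintro d ⟨h0, -, -, h1⟩
    refine ⟨fun u v => h0 u v, fun u v => ?_⟩
    calc d u v ≤ ∑ v, d u v := Finset.single_le_sum (f := d u) (fun w _ => h0 u w) (Finset.mem_univ v)
      _ ≤ ∑ u, ∑ v, d u v := Finset.single_le_sum (f := fun u => ∑ v, d u v)
          (fun w _ => Finset.sum_nonneg fun v _ => h0 w v) (Finset.mem_univ u)
      _ ≤ 1 := h1
  have hwt_smul : ∀ (s : ℝ) (d : W → W → ℝ) σ, matchingWeight (s • d) σ = s * matchingWeight d σ := by
    intro s d σ
    simp [matchingWeight, Finset.mul_sum]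
  have hsum_smul : ∀ (s : ℝ) (d : W → W → ℝ), ∑ u, ∑ v, (s • d) u v * x u v =
      s * ∑ u, ∑ v, d u v * x u v := by
    intro s d
    simp [Finset.mul_sum, mul_assoc]
  have hF_lt : ∀ d a, (∀ σ, σ * σ = 1 → a < ∑ u, ∑ v, d u v * x u v - matchingWeight d σ) →
      a < F d := by
    intro d a h
    rw [hF]
    dsimp only
    rw [lt_sub_comm, Finset.sup'_lt_iff]
    intro σ hσ
    linarith [h σ ((hJmem σ).1 hσ)]
  have hF_le : ∀ d σ, σ * σ = 1 → F d ≤ ∑ u, ∑ v, d u v * x u v - matchingWeight d σ := by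
    intro d σ hσ
    have := Finset.le_sup' (matchingWeight d) ((hJmem σ).2 hσ)
    rw [hF]
    dsimp only
    linarith
  have htot : 0 ≤ ∑ u, ∑ v, c u v :=
    Finset.sum_nonneg fun u _ => Finset.sum_nonneg fun v _ => hc u v
  obtain ⟨d, hdK, hdmax⟩ := hKcomp.exists_isMaxOn
    (⟨0, by simp [hK]⟩ : K.Nonempty) hFcont.continuousOn
  have hFd : 0 < F d := by
    set s := (1 + ∑ u, ∑ v, c u v)⁻¹ with hs
    have hspos : 0 < s := by positivity
    have hmem : s • c ∈ K := by
      refine ⟨fun u v => mul_nonneg hspos.le (hc u v), fun u v => ?_, fun u => ?_, ?_⟩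
      · simp [hcs u v]
      · simp [hcd u]
      · have : ∑ u, ∑ v, (s • c) u v = s * ∑ u, ∑ v, c u v := by simp [Finset.mul_sum]
        rw [this, hs, inv_mul_le_iff₀ (by positivity)]
        linarith
    refine lt_of_lt_of_le ?_ (hdmax hmem)
    refine hF_lt _ _ fun σ hσ => ?_
    rw [hsum_smul, hwt_smul, ← mul_sub]
    exact mul_pos hspos (sub_pos.2 (hcon σ hσ))
  obtain ⟨hd0, hds, hdd, hd1⟩ := hdK
  have hdne : ∃ u v, 0 < d u v := by
    by_contra! h
    have h0 : ∀ u v, d u v = 0 := fun u v => le_antisymm (h u v) (hd0 u v)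
    have := hF_le d 1 (by simp)
    simp [h0, matchingWeight] at this
    linarith
  obtain ⟨h, hh0, hhs, -, hhd, ⟨u₀, v₀, hpos⟩, hmain⟩ :=
    exists_direction hx hxs hdeg hodd hd0 hds hdd hdne
  obtain ⟨σ₀, hσ₀⟩ : ∃ σ, IsMaxMatching d σ := by
    obtain ⟨σ, hσ, hmax⟩ := Finset.exists_max_image J (matchingWeight d) hJne
    exact ⟨σ, (hJmem σ).1 hσ, fun τ hτ => hmax τ ((hJmem τ).2 hτ)⟩
  set H := ∑ u, ∑ v, h u v * x u v with hH
  set T := ∑ u, ∑ v, h u v with hT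
  have hTpos : 0 < T := by
    calc 0 < h u₀ v₀ := hpos
      _ ≤ ∑ v, h u₀ v := Finset.single_le_sum (f := h u₀) (fun w _ => hh0 u₀ w) (Finset.mem_univ v₀)
      _ ≤ T := Finset.single_le_sum (f := fun u => ∑ v, h u v)
          (fun w _ => Finset.sum_nonneg fun v _ => hh0 w v) (Finset.mem_univ u₀)
  have hev : ∀ᶠ t in nhdsWithin (0 : ℝ) (Set.Ioi 0), 0 < t ∧ t * T < 1 ∧
      (∀ u v, t * h u v ≤ d u v) ∧ ∀ σ : Equiv.Perm W,
        matchingWeight d σ < matchingWeight d σ₀ → t * H < matchingWeight d σ₀ - matchingWeight d σ := by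
    refine (eventually_mem_nhdsWithin).and ((eventually_mul_lt T one_pos).and (Filter.Eventually.and ?_ ?_))
    · refine Filter.eventually_all.2 fun u => Filter.eventually_all.2 fun v => ?_
      rcases (hd0 u v).eq_or_lt with h0 | h0
      · simp [hhd u v h0.symm, ← h0]
      · exact (eventually_mul_lt _ h0).mono fun t ht => ht.le
    · refine Filter.eventually_all.2 fun σ => ?_
      by_cases hσ : matchingWeight d σ < matchingWeight d σ₀
      · exact (eventually_mul_lt H (sub_pos.2 hσ)).mono fun t ht _ => ht
      · exact Filter.Eventually.of_forall fun t ht => absurd ht hσ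
  obtain ⟨t, ht0, htT, hth, htσ⟩ := hev.exists
  set s := (1 - t * T)⁻¹ with hs
  have hs1 : 1 < s := (one_lt_inv₀ (by linarith)).2 (by nlinarith)
  set d' : W → W → ℝ := fun u v => d u v - t * h u v with hd'
  have hmem : s • d' ∈ K := by
    refine ⟨fun u v => mul_nonneg (by linarith) (sub_nonneg.2 (hth u v)), fun u v => ?_,
      fun u => ?_, ?_⟩
    · simp [hd', hds u v, hhs u v]
    · simp [hd', hdd u, hhd u u (hdd u)]
    · have : ∑ u, ∑ v, (s • d') u v = s * (∑ u, ∑ v, d u v - t * T) := by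
        simp [hd', Finset.mul_sum, hT, Finset.sum_sub_distrib, mul_sub]
      rw [this, hs, inv_mul_le_iff₀ (by linarith)]
      linarith
  have hle := hdmax hmem
  have hsum' : ∑ u, ∑ v, d' u v * x u v = ∑ u, ∑ v, d u v * x u v - t * H := by
    simp [hd', hH, Finset.mul_sum, Finset.sum_sub_distrib, sub_mul, mul_assoc]
  have hwt' : ∀ σ, matchingWeight d' σ = matchingWeight d σ - t * matchingWeight h σ := by
    intro σ
    simp [hd', matchingWeight, Finset.mul_sum, Finset.sum_sub_distrib]
  refine absurd hle (not_le.2 (hF_lt _ _ fun σ hσ => ?_))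
  rw [hsum_smul, hwt_smul, ← mul_sub, hsum', hwt']
  have hFσ₀ := hF_le d σ₀ hσ₀.1
  have hge : F d ≤ ∑ u, ∑ v, d u v * x u v - t * H - (matchingWeight d σ - t * matchingWeight h σ) := by
    by_cases hlt : matchingWeight d σ < matchingWeight d σ₀
    · have h1 := htσ σ hlt
      have h2 : 0 ≤ matchingWeight h σ := Finset.sum_nonneg fun v _ => hh0 _ _
      have h3 : 0 ≤ t * matchingWeight h σ := mul_nonneg (le_of_lt ht0) h2
      linarith
    · have hopt : IsMaxMatching d σ := ⟨hσ, fun τ hτ => (hσ₀.2 τ hτ).trans (not_lt.1 hlt)⟩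
      have h1 := mul_le_mul_of_nonneg_left (hmain σ hopt) (le_of_lt ht0)
      have h2 := hF_le d σ hσ
      linarith
  nlinarith

/-- Edmonds' matching polytope theorem: a fractional matching satisfying the odd-set constraints is
dominated by a convex combination of matchings. -/
theorem exists_matching_decomposition {x : W → W → ℝ} (hx : ∀ u v, 0 ≤ x u v)
    (hxs : ∀ u v, x u v = x v u) (hdeg : ∀ u, ∑ v, x u v ≤ 1)
    (hodd : ∀ X : Finset W, Odd X.card → 3 ≤ X.card → ∑ u ∈ X, ∑ v ∈ X, x u v ≤ X.card - 1) :
    ∃ l : Equiv.Perm W → ℝ, (∀ σ, 0 ≤ l σ) ∧ (∀ σ, l σ ≠ 0 → σ * σ = 1) ∧ ∑ σ, l σ = 1 ∧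
      ∀ u v, u ≠ v → x u v ≤ ∑ σ, if σ u = v then l σ else 0 := by
  classical
  set J := {σ : Equiv.Perm W // σ * σ = 1} with hJ
  set z : (J → ℝ) → W → W → ℝ := fun l u v => ∑ σ : J, l σ * (if σ.1 u = v then 1 else 0) with hz
  set g : (J → ℝ) → W → W → ℝ := fun l u v => if u = v then 0 else max (x u v - z l u v) 0 with hg
  set Φ : (J → ℝ) → ℝ := fun l => ∑ u, ∑ v, g l u v ^ 2 with hΦ
  have hΦc : Continuous Φ := by
    simp only [hΦ, hg, hz]
    refine continuous_finsetSum _ fun u _ => continuous_finsetSum _ fun v _ => ?_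
    by_cases huv : u = v
    · simp only [huv, if_true]
      exact continuous_const
    · simp only [huv, if_false]
      fun_prop
  have hne : (stdSimplex ℝ J).Nonempty := ⟨_, single_mem_stdSimplex ℝ (⟨1, by simp⟩ : J)⟩
  obtain ⟨l, hl, hmin⟩ := (isCompact_stdSimplex ℝ J).exists_isMinOn hne hΦc.continuousOn
  have hzs : ∀ l u v, z l u v = z l v u := by
    intro l u v
    refine Finset.sum_congr rfl fun σ _ => ?_
    have hinv := involutive_of_mul_self σ.2
    have : σ.1 u = v ↔ σ.1 v = u := by
      constructor <;> (intro h; rw [← h, hinv])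
    rw [if_congr this rfl rfl]
  have hΦ0 : Φ l = 0 := by
    by_contra hne0
    have hΦpos : 0 < Φ l := lt_of_le_of_ne
      (Finset.sum_nonneg fun u _ => Finset.sum_nonneg fun v _ => sq_nonneg _) (Ne.symm hne0)
    have hg0 : ∀ u v, 0 ≤ g l u v := by
      intro u v
      simp only [hg]
      split_ifs
      · exact le_rfl
      · exact le_max_right _ _
    obtain ⟨σ, hσ, hle⟩ := exists_weight_le_matchingWeight hx hxs hdeg hodd (c := g l) hg0
      (fun u v => by simp only [hg, eq_comm (a := u), hxs u v, hzs l u v])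
      (fun u => by simp [hg])
    set e : J → ℝ := Pi.single ⟨σ, hσ⟩ 1 with he
    have hemem : e ∈ stdSimplex ℝ J := single_mem_stdSimplex ℝ _
    have hze : ∀ u v, z e u v = if σ u = v then 1 else 0 := by
      intro u v
      simp only [hz, he]
      rw [Finset.sum_eq_single (⟨σ, hσ⟩ : J)]
      · simp
      · intro τ _ hτ
        simp [Pi.single_eq_of_ne hτ]
      · simp
    set Q := ∑ u, ∑ v, (z l u v - z e u v) ^ 2 with hQ
    have hQ0 : 0 ≤ Q := Finset.sum_nonneg fun u _ => Finset.sum_nonneg fun v _ => sq_nonneg _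
    have hstep : ∀ s ∈ Set.Icc (0 : ℝ) 1, Φ l ≤ Φ l - 2 * s * Φ l + s ^ 2 * Q := by
      intro s hs
      have hmem : (1 - s) • l + s • e ∈ stdSimplex ℝ J :=
        convex_stdSimplex ℝ J hl hemem (by linarith [hs.2]) hs.1 (by ring)
      have hzlin : ∀ u v, z ((1 - s) • l + s • e) u v = z l u v - s * (z l u v - z e u v) := by
        intro u v
        simp only [hz, Pi.add_apply, Pi.smul_apply, smul_eq_mul]
        rw [← Finset.sum_sub_distrib, Finset.mul_sum, ← Finset.sum_sub_distrib]
        exact Finset.sum_congr rfl fun τ _ => by ring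
      have hwt : matchingWeight (g l) σ = ∑ u, ∑ v, g l u v * z e u v := by
        refine Finset.sum_congr rfl fun u _ => ?_
        simp [hze]
      have hcz : ∑ u, ∑ v, g l u v * (z l u v - z e u v) ≤ - Φ l := by
        calc ∑ u, ∑ v, g l u v * (z l u v - z e u v)
            = ∑ u, ∑ v, g l u v * z l u v - matchingWeight (g l) σ := by
              rw [hwt]; simp [mul_sub, Finset.sum_sub_distrib]
          _ ≤ ∑ u, ∑ v, g l u v * z l u v - ∑ u, ∑ v, g l u v * x u v := by linarith
          _ = ∑ u, ∑ v, - (g l u v) ^ 2 := by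
              rw [← Finset.sum_sub_distrib]
              refine Finset.sum_congr rfl fun u _ => ?_
              rw [← Finset.sum_sub_distrib]
              refine Finset.sum_congr rfl fun v _ => ?_
              simp only [hg]
              split_ifs
              · ring
              · rcases le_total (x u v - z l u v) 0 with h | h
                · rw [max_eq_right h]; ring
                · rw [max_eq_left h]; ring
          _ = - Φ l := by simp [hΦ]
      calc Φ l ≤ Φ ((1 - s) • l + s • e) := hmin hmem
        _ ≤ ∑ u, ∑ v, (g l u v + s * (z l u v - z e u v)) ^ 2 := by
            refine Finset.sum_le_sum fun u _ => Finset.sum_le_sum fun v _ => ?_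
            simp only [hg, hzlin]
            split_ifs
            · rw [zero_pow two_ne_zero]; positivity
            · rcases le_total (x u v - (z l u v - s * (z l u v - z e u v))) 0 with h | h
              · rw [max_eq_right h, zero_pow two_ne_zero]; positivity
              · rw [max_eq_left h]
                refine pow_le_pow_left₀ h ?_ 2
                linarith [le_max_left (x u v - z l u v) 0]
        _ = Φ l + 2 * s * (∑ u, ∑ v, g l u v * (z l u v - z e u v)) + s ^ 2 * Q := by
            simp only [hΦ, hQ, Finset.mul_sum, ← Finset.sum_add_distrib]
            exact Finset.sum_congr rfl fun u _ => Finset.sum_congr rfl fun v _ => by ring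
        _ ≤ _ := by nlinarith [hs.1]
    set s := Φ l / (Q + Φ l) with hs
    have hs0 : 0 < s := by positivity
    have hs1 : s ≤ 1 := by rw [hs, div_le_one (by positivity)]; linarith
    have h1 := hstep s ⟨hs0.le, hs1⟩
    have h2 : s * Q ≤ Φ l := by
      rw [hs, div_mul_eq_mul_div, div_le_iff₀ (by positivity)]
      nlinarith
    nlinarith
  have hext : ∀ f : Equiv.Perm W → ℝ,
      (∑ σ, if h : σ * σ = 1 then l ⟨σ, h⟩ * f σ else 0) = ∑ σ : J, l σ * f σ.1 := by
    intro f
    set f' : Equiv.Perm W → ℝ := fun σ => if h : σ * σ = 1 then l ⟨σ, h⟩ * f σ else 0 with hf'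
    have h1 : ∑ σ : J, l σ * f σ.1 = ∑ σ : J, f' σ.1 :=
      Finset.sum_congr rfl fun σ _ => by simp [hf', σ.2]
    rw [h1, ← Finset.subtype_univ, Finset.sum_subtype_eq_sum_filter]
    refine (Finset.sum_filter_of_ne fun σ _ hσ => ?_).symm
    by_contra h
    simp [h] at hσ
  refine ⟨fun σ => if h : σ * σ = 1 then l ⟨σ, h⟩ else 0, ?_, ?_, ?_, ?_⟩
  · intro σ
    dsimp only
    split_ifs
    · exact hl.1 _
    · exact le_rfl
  · intro σ hσ
    by_contra h
    simp [h] at hσ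
  · have := hext 1
    simp only [Pi.one_apply, mul_one] at this
    rw [this]
    exact hl.2
  · intro u v huv
    have h1 : g l u v = 0 := by
      have h2 := (Finset.sum_eq_zero_iff_of_nonneg
        (fun u _ => Finset.sum_nonneg fun v _ => sq_nonneg _)).1 hΦ0 u (Finset.mem_univ _)
      have h3 := (Finset.sum_eq_zero_iff_of_nonneg (fun v _ => sq_nonneg _)).1 h2 v (Finset.mem_univ _)
      exact pow_eq_zero_iff two_ne_zero |>.1 h3
    have h4 : x u v ≤ z l u v := by
      simp only [hg, huv, if_false] at h1
      linarith [le_max_left (x u v - z l u v) 0]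
    refine h4.trans (le_of_eq ?_)
    rw [hz]
    dsimp only
    rw [← hext fun σ => if σ u = v then 1 else 0]
    refine Finset.sum_congr rfl fun σ _ => ?_
    split_ifs <;> simp

end FrugalPlanar

namespace FrugalPlanar

theorem exp_neg_le_quadratic {η : ℝ} (hη : 0 ≤ η) : Real.exp (-η) ≤ 1 - η + η ^ 2 / 2 := by
  have h := Real.quadratic_le_exp_of_nonneg hη
  rw [Real.exp_neg, inv_le_iff_one_le_mul₀ (Real.exp_pos _)]
  have h1 : 0 ≤ 1 - η + η ^ 2 / 2 := by nlinarith [sq_nonneg (η - 1)]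
  nlinarith [mul_le_mul_of_nonneg_left h h1, sq_nonneg (η ^ 2)]

theorem weighted_exp_le {p η : ℝ} (hp0 : 0 ≤ p) (hp1 : p ≤ 1) (hη : 0 ≤ η) :
    p * Real.exp (η * (p - η) - η) + (1 - p) * Real.exp (η * (p - η)) ≤ Real.exp (-(η ^ 2 / 2)) := by
  have h1 : Real.exp (η * (p - η) - η) = Real.exp (η * (p - η)) * Real.exp (-η) := by
    rw [← Real.exp_add]; ring_nf
  have h2 := exp_neg_le_quadratic hη
  have h3 : 1 - p * (η - η ^ 2 / 2) ≤ Real.exp (-(p * (η - η ^ 2 / 2))) := by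
    have := Real.add_one_le_exp (-(p * (η - η ^ 2 / 2)))
    linarith
  have h4 : p * Real.exp (-η) + (1 - p) ≤ 1 - p * (η - η ^ 2 / 2) := by nlinarith
  calc p * Real.exp (η * (p - η) - η) + (1 - p) * Real.exp (η * (p - η))
      = Real.exp (η * (p - η)) * (p * Real.exp (-η) + (1 - p)) := by rw [h1]; ring
    _ ≤ Real.exp (η * (p - η)) * Real.exp (-(p * (η - η ^ 2 / 2))) :=
        mul_le_mul_of_nonneg_left (h4.trans h3) (Real.exp_pos _).le
    _ = Real.exp (η * (p - η) + -(p * (η - η ^ 2 / 2))) := (Real.exp_add _ _).symm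
    _ ≤ _ := Real.exp_le_exp.2 (by nlinarith [mul_nonneg (sq_nonneg η) (sub_nonneg.2 hp1)])

open scoped Classical in
/-- Colours can be partitioned into classes so that every list meets every class in roughly the
prescribed proportion. -/
theorem exists_color_split {E J α : Type} [Fintype E] [Fintype J] (A : E → Finset α) {l : J → ℝ}
    (hl : ∀ j, 0 ≤ l j) (hl1 : ∑ j, l j = 1) {η : ℝ} (hη : 0 < η)
    (hsum : ∑ e, ∑ _j : J, Real.exp (-(η ^ 2 / 2)) ^ (A e).card < 1) :
    ∃ χ : α → J, ∀ e j, (l j - η) * (A e).card ≤ ((A e).filter fun a => χ a = j).card := by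
  set w : J → Option J → ℝ := fun j o => o.elim (Real.exp (-(η ^ 2 / 2)))
    fun i => Real.exp (η * (l j - η) - if i = j then η else 0) with hw
  have hwpos : ∀ j o, 0 < w j o := by
    intro j o
    cases o <;> exact Real.exp_pos _
  have hlj1 : ∀ j, l j ≤ 1 := fun j =>
    hl1 ▸ Finset.single_le_sum (fun i _ => hl i) (Finset.mem_univ j)
  have havg : ∀ j, ∑ i, l i * w j (some i) ≤ w j none := by
    intro j
    refine le_trans (le_of_eq ?_) (weighted_exp_le (hl j) (hlj1 j) hη.le)
    have h1 : ∑ i ∈ Finset.univ.erase j, l i = 1 - l j := by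
      rw [← hl1, ← Finset.add_sum_erase _ l (Finset.mem_univ j)]; ring
    rw [← Finset.add_sum_erase _ _ (Finset.mem_univ j), ← h1, Finset.sum_mul]
    congr 1
    · simp [hw]
    · refine Finset.sum_congr rfl fun i hi => ?_
      simp [hw, Finset.ne_of_mem_erase hi]
  set Ψ : (α → Option J) → ℝ := fun χ => ∑ e, ∑ j, ∏ a ∈ A e, w j (χ a) with hΨ
  have hstep : ∀ S : Finset α, ∃ χ : α → Option J, (∀ a, a ∈ S ↔ χ a ≠ none) ∧ Ψ χ < 1 := by
    intro S
    induction S using Finset.induction_on with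
    | empty => exact ⟨fun _ => none, by simp, by simpa [hΨ, hw] using hsum⟩
    | insert b S hb ih =>
      obtain ⟨χ, hχ, hχ1⟩ := ih
      have hχb : χ b = none := by
        by_contra h
        exact hb ((hχ b).2 h)
      have hle : ∑ i, l i * Ψ (Function.update χ b (some i)) ≤ Ψ χ := by
        simp only [hΨ, Finset.mul_sum]
        rw [Finset.sum_comm]
        refine Finset.sum_le_sum fun e _ => ?_
        rw [Finset.sum_comm]
        refine Finset.sum_le_sum fun j _ => ?_
        by_cases hbe : b ∈ A e
        · have h1 : ∀ o, ∏ a ∈ A e, w j (Function.update χ b o a) =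
              w j o * ∏ a ∈ (A e).erase b, w j (χ a) := by
            intro o
            rw [← Finset.mul_prod_erase _ _ hbe, Function.update_self]
            congr 1
            refine Finset.prod_congr rfl fun a ha => ?_
            rw [Function.update_of_ne (Finset.ne_of_mem_erase ha)]
          have h2 := h1 none
          rw [← hχb, Function.update_eq_self] at h2
          simp only [h1]
          rw [h2, hχb]
          simp only [← mul_assoc]
          rw [← Finset.sum_mul]
          exact mul_le_mul_of_nonneg_right (havg j) (Finset.prod_nonneg fun a _ => (hwpos _ _).le)
        · have h1 : ∀ o, ∏ a ∈ A e, w j (Function.update χ b o a) = ∏ a ∈ A e, w j (χ a) := by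
            intro o
            refine Finset.prod_congr rfl fun a ha => ?_
            rw [Function.update_of_ne]
            rintro rfl
            exact hbe ha
          simp only [h1]
          rw [← Finset.sum_mul, hl1, one_mul]
      obtain ⟨i, hi⟩ : ∃ i, Ψ (Function.update χ b (some i)) < 1 := by
        by_contra! h
        have : (1 : ℝ) ≤ ∑ i, l i * Ψ (Function.update χ b (some i)) := by
          rw [← hl1]
          exact Finset.sum_le_sum fun i _ => le_mul_of_one_le_right (hl i) (h i)
        linarith
      refine ⟨_, fun a => ?_, hi⟩
      by_cases hab : a = b
      · subst hab; simp
      · rw [Function.update_of_ne hab, Finset.mem_insert]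
        simp only [hab, false_or]
        exact hχ a
  obtain ⟨χ, hχ, hχ1⟩ := hstep (Finset.univ.biUnion A)
  have hJ : Nonempty J := by
    by_contra h
    rw [not_nonempty_iff] at h
    simp at hl1
  refine ⟨fun a => (χ a).getD hJ.some, fun e j => ?_⟩
  have hsingle : ∏ a ∈ A e, w j (χ a) < 1 := by
    refine lt_of_le_of_lt ?_ hχ1
    calc ∏ a ∈ A e, w j (χ a) ≤ ∑ j, ∏ a ∈ A e, w j (χ a) :=
          Finset.single_le_sum (f := fun j => ∏ a ∈ A e, w j (χ a))
            (fun j _ => Finset.prod_nonneg fun a _ => (hwpos _ _).le) (Finset.mem_univ j)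
      _ ≤ _ := Finset.single_le_sum (f := fun e => ∑ j, ∏ a ∈ A e, w j (χ a))
            (fun e _ => Finset.sum_nonneg fun j _ => Finset.prod_nonneg fun a _ => (hwpos _ _).le)
            (Finset.mem_univ e)
  have hprod : ∏ a ∈ A e, w j (χ a) =
      Real.exp (∑ a ∈ A e, (η * (l j - η) - if (χ a).getD hJ.some = j then η else 0)) := by
    rw [Real.exp_sum]
    refine Finset.prod_congr rfl fun a ha => ?_
    have : χ a ≠ none := (hχ a).1 (Finset.mem_biUnion.2 ⟨e, Finset.mem_univ _, ha⟩)
    obtain ⟨i, hi⟩ := Option.ne_none_iff_exists'.1 this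
    simp [hw, hi]
  rw [hprod, Real.exp_lt_one_iff, Finset.sum_sub_distrib, Finset.sum_const, ← Finset.sum_filter,
    Finset.sum_const, nsmul_eq_mul, nsmul_eq_mul] at hsingle
  by_contra! h
  nlinarith

open scoped Classical in
theorem exists_greedy_coloring {E α : Type} [Fintype E] (L : E → Finset α)
    (bad : E → E → α → α → Prop) (hsymm : ∀ e e' a b, bad e e' a b → bad e' e b a)
    (w : E → E → ℕ) (hw : ∀ e e' b, ((L e).filter fun a => bad e e' a b).card ≤ w e e')
    (hsum : ∀ e, ∑ e' ∈ Finset.univ.erase e, w e e' < (L e).card) :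
    ∃ f : E → α, (∀ e, f e ∈ L e) ∧ ∀ e e', e ≠ e' → ¬ bad e e' (f e) (f e') := by
  have hne : ∀ e, (L e).Nonempty := fun e => Finset.card_pos.1 (lt_of_le_of_lt (Nat.zero_le _) (hsum e))
  have key : ∀ S : Finset E, ∃ f : E → α, (∀ e, f e ∈ L e) ∧
      ∀ e ∈ S, ∀ e' ∈ S, e ≠ e' → ¬ bad e e' (f e) (f e') := by
    intro S
    induction S using Finset.induction_on with
    | empty => exact ⟨fun e => (hne e).choose, fun e => (hne e).choose_spec, by simp⟩
    | insert d S hd ih =>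
      obtain ⟨f, hf, hS⟩ := ih
      have hex : ∃ a ∈ L d, ∀ e' ∈ S, ¬ bad d e' a (f e') := by
        by_contra! h
        have h1 : L d ⊆ S.biUnion fun e' => (L d).filter fun a => bad d e' a (f e') := by
          intro a ha
          obtain ⟨e', he', hb⟩ := h a ha
          exact Finset.mem_biUnion.2 ⟨e', he', Finset.mem_filter.2 ⟨ha, hb⟩⟩
        have h2 := (Finset.card_le_card h1).trans Finset.card_biUnion_le
        have h3 : ∑ e' ∈ S, ((L d).filter fun a => bad d e' a (f e')).card ≤
            ∑ e' ∈ Finset.univ.erase d, w d e' :=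
          (Finset.sum_le_sum fun e' _ => hw d e' (f e')).trans
            (Finset.sum_le_sum_of_subset fun e' he' => Finset.mem_erase.2
              ⟨fun h => hd (h ▸ he'), Finset.mem_univ _⟩)
        have := hsum d
        omega
      obtain ⟨a, ha, hbad⟩ := hex
      refine ⟨Function.update f d a, fun e => ?_, fun e he e' he' hee => ?_⟩
      · by_cases h : e = d
        · subst h; simpa using ha
        · rw [Function.update_of_ne h]; exact hf e
      · rw [Finset.mem_insert] at he he'
        by_cases h : e = d
        · have h' : e' ≠ d := fun h' => hee (h.trans h'.symm)
          rw [h, Function.update_self, Function.update_of_ne h']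
          exact hbad e' (he'.resolve_left h')
        · rw [Function.update_of_ne h]
          by_cases h' : e' = d
          · rw [h', Function.update_self]
            exact fun hb => hbad e (he.resolve_left h) (hsymm _ _ _ _ hb)
          · rw [Function.update_of_ne h']
            exact hS e (he.resolve_left h) e' (he'.resolve_left h') hee
  obtain ⟨f, hf, h⟩ := key Finset.univ
  exact ⟨f, hf, fun e e' hee => h e (Finset.mem_univ _) e' (Finset.mem_univ _) hee⟩

open scoped Classical in
theorem exists_bounded_fibers {E J : Type} [Fintype E] [Fintype J] (s : Finset E) (cap : J → ℕ)
    (h : s.card ≤ ∑ j, cap j) :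
    ∃ g : E → Option J, (∀ e ∈ s, g e ≠ none) ∧
      ∀ j, (s.filter fun e => g e = some j).card ≤ cap j := by
  have hcard : Fintype.card s ≤ Fintype.card (Σ j, Fin (cap j)) := by simpa using h
  obtain ⟨φ⟩ := Function.Embedding.nonempty_of_card_le hcard
  refine ⟨fun e => if he : e ∈ s then some (φ ⟨e, he⟩).1 else none, fun e he => by simp [he], ?_⟩
  intro j
  rw [← Fintype.card_fin (cap j), ← Fintype.card_coe]
  refine Fintype.card_le_of_injective (fun e => Fin.cast (congrArg cap (?_ : _ = j))
    (φ ⟨e.1, (Finset.mem_filter.1 e.2).1⟩).2) ?_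
  · have h1 := Finset.mem_filter.1 e.2
    simpa [h1.1] using h1.2
  · intro e e' hee
    have h1 := Finset.mem_filter.1 e.2
    have h2 := Finset.mem_filter.1 e'.2
    have e1 : (φ ⟨e.1, h1.1⟩).1 = j := by simpa [h1.1] using h1.2
    have e2 : (φ ⟨e'.1, h2.1⟩).1 = j := by simpa [h2.1] using h2.2
    have h3 : φ ⟨e.1, h1.1⟩ = φ ⟨e'.1, h2.1⟩ := by
      refine Sigma.ext (e1.trans e2.symm) ?_
      have hv : ((φ ⟨e.1, h1.1⟩).2 : ℕ) = (φ ⟨e'.1, h2.1⟩).2 := by simpa [Fin.ext_iff] using hee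
      exact (Fin.heq_ext_iff (congrArg cap (e1.trans e2.symm))).2 hv
    exact Subtype.ext (by simpa using φ.injective h3)

open scoped Classical in
/-- List edge colouring of a multigraph on a bounded number of vertices, with edges `E`, guided by a
convex combination of matchings; boundedly many additional conflicts are allowed at each edge. -/
theorem exists_edge_coloring {W E α β : Type} [Fintype W] [Fintype E] (ends : E → Finset W)
    (hends : ∀ e, (ends e).card = 2) (A : E → Finset α) (near : E → E → Prop)
    (hnear_symm : ∀ e e', near e e' → near e' e) {D : ℕ}
    (hnear : ∀ e, (Finset.univ.filter fun e' => near e e').card ≤ D) (π : α → β) {k : ℕ}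
    (hπ : ∀ e b, ((A e).filter fun a => π a = b).card ≤ k) (ℓ : Finset W → ℝ)
    (hℓ : ∀ s, 0 ≤ ℓ s) (hA : ∀ e, ℓ (ends e) ≤ (A e).card) {η : ℝ} (hη : 0 < η)
    {l : Equiv.Perm W → ℝ} (hl : ∀ σ, 0 ≤ l σ) (hinv : ∀ σ, l σ ≠ 0 → σ * σ = 1)
    (hl1 : ∑ σ, l σ = 1)
    (hsum : ∑ e, ∑ _σ : Equiv.Perm W, Real.exp (-(η ^ 2 / 2)) ^ (A e).card < 1)
    (hcap : ∀ x y, x ≠ y → ((Finset.univ.filter fun e => ends e = {x, y}).card : ℝ) +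
      Fintype.card (Equiv.Perm W) * (η * ℓ {x, y} + k * D + 1) ≤
        ℓ {x, y} * ∑ σ : Equiv.Perm W, if σ x = y then l σ else 0) :
    ∃ f : E → α, (∀ e, f e ∈ A e) ∧
      (∀ e e', e ≠ e' → (ends e ∩ ends e').Nonempty → f e ≠ f e') ∧
      ∀ e e', e ≠ e' → near e e' → π (f e) ≠ π (f e') := by
  obtain ⟨χ, hχ⟩ := exists_color_split A hl hl1 hη hsum
  set covers : Equiv.Perm W → Finset W → Prop := fun σ s => ∀ x ∈ s, ∀ y ∈ s, x ≠ y → σ x = y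
    with hcovers
  set cap : Finset W → Equiv.Perm W → ℕ := fun s σ =>
    if covers σ s then ⌊(l σ - η) * ℓ s - k * D⌋₊ else 0 with hcapdef
  have hbundle : ∀ s : Finset W, s.card = 2 →
      (Finset.univ.filter fun e => ends e = s).card ≤ ∑ σ, cap s σ := by
    intro s hs
    obtain ⟨x, y, hxy, rfl⟩ := Finset.card_eq_two.1 hs
    have h1 : ∀ σ : Equiv.Perm W, (if σ x = y then l σ else 0) * ℓ {x, y} -
        (η * ℓ {x, y} + k * D + 1) ≤ cap {x, y} σ := by
      intro σ
      have h0 : 0 ≤ η * ℓ {x, y} := mul_nonneg hη.le (hℓ _)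
      have h0' : (0 : ℝ) ≤ k * D := by positivity
      by_cases hσ : σ x = y ∧ l σ ≠ 0
      · have hsy : σ y = x := by rw [← hσ.1, involutive_of_mul_self (hinv σ hσ.2)]
        have hcov : covers σ {x, y} := by
          intro a ha b hb hab
          simp only [Finset.mem_insert, Finset.mem_singleton] at ha hb
          rcases ha with rfl | rfl <;> rcases hb with rfl | rfl
          · exact absurd rfl hab
          · exact hσ.1
          · exact hsy
          · exact absurd rfl hab
        simp only [hcapdef, if_pos hcov, if_pos hσ.1]
        have := Nat.lt_floor_add_one ((l σ - η) * ℓ {x, y} - k * D)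
        nlinarith
      · have h2 : (if σ x = y then l σ else 0) = 0 := by
          split_ifs with h
          · by_contra h3
            exact hσ ⟨h, h3⟩
          · rfl
        rw [h2]
        have : (0 : ℝ) ≤ cap {x, y} σ := Nat.cast_nonneg _
        linarith
    have h2 := Finset.sum_le_sum fun σ (_ : σ ∈ Finset.univ) => h1 σ
    rw [Finset.sum_sub_distrib, ← Finset.sum_mul, Finset.sum_const, nsmul_eq_mul,
      Finset.card_univ] at h2
    have h3 := hcap x y hxy
    have h4 : ((Finset.univ.filter fun e => ends e = {x, y}).card : ℝ) ≤
        ((∑ σ, cap {x, y} σ : ℕ) : ℝ) := by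
      push_cast
      linarith
    exact_mod_cast h4
  have hg : ∀ s : Finset W, ∃ g : E → Option (Equiv.Perm W), s.card = 2 →
      (∀ e, ends e = s → g e ≠ none) ∧
      ∀ σ, (Finset.univ.filter fun e => ends e = s ∧ g e = some σ).card ≤ cap s σ := by
    intro s
    by_cases hs : s.card = 2
    · obtain ⟨g, h1, h2⟩ := exists_bounded_fibers _ _ (hbundle s hs)
      refine ⟨g, fun _ => ⟨fun e he => h1 e (by simpa using he), fun σ => ?_⟩⟩
      rw [← Finset.filter_filter]
      convert h2 σ
    · exact ⟨fun _ => none, fun h => absurd h hs⟩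
  choose g hg using hg
  have hcls : ∀ e, ∃ σ, g (ends e) e = some σ := fun e =>
    Option.ne_none_iff_exists'.1 ((hg (ends e) (hends e)).1 e rfl)
  choose cls hcls using hcls
  have hfib : ∀ e, (Finset.univ.filter fun e' => ends e' = ends e ∧ cls e' = cls e).card ≤
      cap (ends e) (cls e) := by
    intro e
    refine le_trans (Finset.card_le_card fun e' he' => ?_) ((hg (ends e) (hends e)).2 (cls e))
    simp only [Finset.mem_filter, Finset.mem_univ, true_and] at he' ⊢
    refine ⟨he'.1, ?_⟩
    rw [← he'.1, hcls, he'.2]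
  have hcappos : ∀ e, 0 < cap (ends e) (cls e) := fun e =>
    lt_of_lt_of_le (Finset.card_pos.2 ⟨e, by simp⟩) (hfib e)
  have hcov : ∀ e, covers (cls e) (ends e) := by
    intro e
    by_contra h
    have := hcappos e
    simp [hcapdef, h] at this
  have hroom : ∀ e, cap (ends e) (cls e) + k * D ≤ ((A e).filter fun a => χ a = cls e).card := by
    intro e
    have h1 := hcappos e
    have h2 : cap (ends e) (cls e) = ⌊(l (cls e) - η) * ℓ (ends e) - k * D⌋₊ := if_pos (hcov e)
    have h4 : 1 ≤ (l (cls e) - η) * ℓ (ends e) - k * D := by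
      rw [h2] at h1
      exact (Nat.floor_pos).1 h1
    have h3 : (cap (ends e) (cls e) : ℝ) ≤ (l (cls e) - η) * ℓ (ends e) - k * D := by
      rw [h2]
      exact Nat.floor_le (by linarith)
    have h0' : (0 : ℝ) ≤ k * D := by positivity
    have h5 : 0 < l (cls e) - η := by
      by_contra! h
      nlinarith [hℓ (ends e)]
    have h6 : (l (cls e) - η) * (A e).card ≤ ((A e).filter fun a => χ a = cls e).card := by
      convert hχ e (cls e)
    have h7 := mul_le_mul_of_nonneg_left (hA e) h5.le
    have h8 : ((cap (ends e) (cls e) + k * D : ℕ) : ℝ) ≤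
        ((A e).filter fun a => χ a = cls e).card := by
      push_cast
      linarith
    exact_mod_cast h8
  obtain ⟨f, hf, hbad⟩ := exists_greedy_coloring (fun e => (A e).filter fun a => χ a = cls e)
    (fun e e' a b => (ends e' = ends e ∧ cls e' = cls e ∧ a = b) ∨ (near e e' ∧ π a = π b))
    (by
      rintro e e' a b (⟨h1, h2, h3⟩ | ⟨h1, h2⟩)
      · exact Or.inl ⟨h1.symm, h2.symm, h3.symm⟩
      · exact Or.inr ⟨hnear_symm _ _ h1, h2.symm⟩)
    (fun e e' => (if ends e' = ends e ∧ cls e' = cls e then 1 else 0) +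
      if near e e' then k else 0)
    (by
      intro e e' b
      refine (Finset.card_le_card (t := (((A e).filter fun a => χ a = cls e).filter fun a =>
        ends e' = ends e ∧ cls e' = cls e ∧ a = b) ∪ (((A e).filter fun a => χ a = cls e).filter
          fun a => near e e' ∧ π a = π b)) ?_).trans ((Finset.card_union_le _ _).trans
            (add_le_add ?_ ?_))
      · intro a ha
        simp only [Finset.mem_union, Finset.mem_filter] at ha ⊢
        tauto
      · split_ifs with h
        · refine Finset.card_le_one.2 fun a ha a' ha' => ?_
          exact (Finset.mem_filter.1 ha).2.2.2.trans (Finset.mem_filter.1 ha').2.2.2.symm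
        · rw [Finset.card_eq_zero.2]
          refine Finset.filter_eq_empty_iff.2 fun a _ ha => h ⟨ha.1, ha.2.1⟩
      · split_ifs with h
        · refine (Finset.card_le_card ?_).trans (hπ e (π b))
          intro a ha
          simp only [Finset.mem_filter] at ha ⊢
          exact ⟨ha.1.1, ha.2.2⟩
        · rw [Finset.card_eq_zero.2]
          refine Finset.filter_eq_empty_iff.2 fun a _ ha => h ha.1)
    (by
      intro e
      rw [Finset.sum_add_distrib]
      have h1 : ∑ e' ∈ Finset.univ.erase e, (if ends e' = ends e ∧ cls e' = cls e then 1 else 0) + 1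
          ≤ cap (ends e) (cls e) := by
        refine le_trans (le_of_eq ?_) (hfib e)
        rw [Finset.card_filter, ← Finset.add_sum_erase _ _ (Finset.mem_univ e)]
        simp [add_comm]
      have h2 : ∑ e' ∈ Finset.univ.erase e, (if near e e' then k else 0) ≤ k * D := by
        refine (Finset.sum_le_sum_of_subset (Finset.erase_subset _ _)).trans ?_
        rw [← Finset.sum_filter, Finset.sum_const, smul_eq_mul, mul_comm]
        exact Nat.mul_le_mul_left k (hnear e)
      have := hroom e
      omega)
  have hfA : ∀ e, f e ∈ A e ∧ χ (f e) = cls e := fun e => Finset.mem_filter.1 (hf e)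
  refine ⟨f, fun e => (hfA e).1, ?_, ?_⟩
  · rintro e e' hee ⟨x, hx⟩ hff
    rw [Finset.mem_inter] at hx
    have hc : cls e' = cls e := by rw [← (hfA e').2, ← hff, (hfA e).2]
    have hends_eq : ∀ e, x ∈ ends e → ends e = {x, cls e x} := by
      intro e hx
      obtain ⟨y, hy, hyx⟩ := Finset.exists_mem_ne (by rw [hends e]; norm_num) x
      rw [hcov e x hx y hy hyx.symm]
      refine (Finset.eq_of_subset_of_card_le ?_ ?_).symm
      · intro z hz
        rw [Finset.mem_insert, Finset.mem_singleton] at hz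
        rcases hz with rfl | rfl
        · exact hx
        · exact hy
      · rw [hends e, Finset.card_pair hyx.symm]
    have he : ends e' = ends e := by rw [hends_eq e' hx.2, hends_eq e hx.1, hc]
    exact hbad e e' hee (Or.inl ⟨he, hc, hff⟩)
  · intro e e' hee hn hff
    exact hbad e e' hee (Or.inr ⟨hn, hff⟩)

end FrugalPlanar

namespace FrugalPlanar

theorem inv_half_add_le {p q : ℝ} (hp : 0 < p) (hq : 0 < q) :
    1 / ((p + q) / 2) ≤ (1 / p + 1 / q) / 2 := by
  have h : (1 / p + 1 / q) / 2 = (p + q) / (2 * (p * q)) := by field_simp; ring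
  have h' : 1 / ((p + q) / 2) = 2 / (p + q) := by field_simp
  rw [h, h', div_le_div_iff₀ (by positivity) (by positivity)]
  nlinarith [sq_nonneg (p - q)]

theorem vertex_load_le {b d : ℝ} (hb0 : 0 ≤ b) (hb : b ≤ 1 / 2) (hd : d ≤ b + 1 / 2) :
    d / (2 * b + 1 / 2) ≤ 2 / 3 + 2 / 3 * (d - 2 * b) := by
  rw [div_le_iff₀ (by positivity)]
  nlinarith [mul_nonneg hb0 (sub_nonneg.2 hb), mul_nonneg (sub_nonneg.2 hd) (sub_nonneg.2 hb)]

/-- Fractional edge weights of a multigraph whose edges are dominated by vertex weights `b`. -/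
theorem sum_weight_div_le {W : Type} {m : W → W → ℝ} (hm : ∀ x y, 0 ≤ m x y)
    (hms : ∀ x y, m x y = m y x) {b : W → ℝ} (hb0 : ∀ x, 0 ≤ b x) (hb : ∀ x, b x ≤ 1 / 2)
    (X : Finset W) (hdeg : ∀ x ∈ X, ∑ y ∈ X, m x y ≤ b x + 1 / 2)
    (hcut : cut m X X ≤ ∑ x ∈ X, 2 * b x) :
    ∑ x ∈ X, ∑ y ∈ X, m x y / (b x + b y + 1 / 2) ≤ 2 / 3 * X.card := by
  have h1 : ∀ x y, m x y / (b x + b y + 1 / 2) ≤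
      m x y / (2 * b x + 1 / 2) / 2 + m x y / (2 * b y + 1 / 2) / 2 := by
    intro x y
    have hx := hb0 x
    have hy := hb0 y
    have h2 := inv_half_add_le (by linarith : 0 < 2 * b x + 1 / 2) (by linarith : 0 < 2 * b y + 1 / 2)
    have h3 := mul_le_mul_of_nonneg_left h2 (hm x y)
    have h4 : (2 * b x + 1 / 2 + (2 * b y + 1 / 2)) / 2 = b x + b y + 1 / 2 := by ring
    rw [h4] at h3
    calc m x y / (b x + b y + 1 / 2) = m x y * (1 / (b x + b y + 1 / 2)) := by ring
      _ ≤ _ := h3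
      _ = _ := by ring
  calc ∑ x ∈ X, ∑ y ∈ X, m x y / (b x + b y + 1 / 2)
      ≤ ∑ x ∈ X, ∑ y ∈ X, (m x y / (2 * b x + 1 / 2) / 2 + m x y / (2 * b y + 1 / 2) / 2) :=
        Finset.sum_le_sum fun x _ => Finset.sum_le_sum fun y _ => h1 x y
    _ = ∑ x ∈ X, ∑ y ∈ X, m x y / (2 * b x + 1 / 2) := by
        simp only [Finset.sum_add_distrib]
        have h2 : ∑ x ∈ X, ∑ y ∈ X, m x y / (2 * b y + 1 / 2) / 2 =
            ∑ x ∈ X, ∑ y ∈ X, m x y / (2 * b x + 1 / 2) / 2 := by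
          rw [Finset.sum_comm]
          exact Finset.sum_congr rfl fun x _ => Finset.sum_congr rfl fun y _ => by rw [hms]
        rw [h2, ← Finset.sum_add_distrib]
        refine Finset.sum_congr rfl fun x _ => ?_
        rw [← Finset.sum_add_distrib]
        exact Finset.sum_congr rfl fun y _ => by ring
    _ = ∑ x ∈ X, (∑ y ∈ X, m x y) / (2 * b x + 1 / 2) := by simp only [Finset.sum_div]
    _ ≤ ∑ x ∈ X, (2 / 3 + 2 / 3 * (∑ y ∈ X, m x y - 2 * b x)) :=
        Finset.sum_le_sum fun x hx => vertex_load_le (hb0 x) (hb x) (hdeg x hx)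
    _ = 2 / 3 * X.card + 2 / 3 * (cut m X X - ∑ x ∈ X, 2 * b x) := by
        rw [Finset.sum_add_distrib, Finset.sum_const, nsmul_eq_mul, ← Finset.mul_sum,
          Finset.sum_sub_distrib, cut]
        ring
    _ ≤ _ := by linarith

theorem exists_matching_guide {W : Type} [Fintype W] [DecidableEq W] [Nonempty W] {N : ℕ}
    (hN : Fintype.card W ≤ N) {ε : ℝ} (hε : 0 < ε) (hε1 : ε ≤ 1) {m : W → W → ℝ}
    (hm : ∀ x y, 0 ≤ m x y) (hms : ∀ x y, m x y = m y x) {a : W → ℝ} (ha : ∀ x, 0 ≤ a x)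
    (hdeg : ∀ x, ∑ y, m x y ≤ 1 - a x)
    (hcut : ∀ X : Finset W, cut m X X ≤ ∑ x ∈ X, (1 - 2 * a x + ε / 8)) :
    ∃ l : Equiv.Perm W → ℝ, (∀ σ, 0 ≤ l σ) ∧ (∀ σ, l σ ≠ 0 → σ * σ = 1) ∧ ∑ σ, l σ = 1 ∧
      ∀ x y, x ≠ y → ∀ ℓ, 3 / 2 + ε - a x - a y ≤ ℓ →
        m x y + ε / (16 * N) * ℓ ≤ ℓ * ∑ σ : Equiv.Perm W, if σ x = y then l σ else 0 := by
  have hN1 : (1 : ℝ) ≤ N := by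
    exact_mod_cast (Nat.one_le_iff_ne_zero.2 (by have := Fintype.card_pos (α := W); omega) : 1 ≤ N)
  have hWN : (Fintype.card W : ℝ) ≤ N := by exact_mod_cast hN
  set δ := ε / 8 with hδ
  have hδ0 : 0 < δ := by positivity
  set b : W → ℝ := fun x => (1 / 2 - a x + δ) / (1 + 2 * δ) with hb
  have hpos : 0 < 1 + 2 * δ := by positivity
  have ha2 : ∀ x, a x ≤ (1 + δ) / 2 := by
    intro x
    have h1 := hcut {x}
    have h2 : 0 ≤ cut m {x} {x} := by simpa [cut] using hm x x
    rw [Finset.sum_singleton] at h1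
    linarith
  have hb0 : ∀ x, 0 ≤ b x := fun x => div_nonneg (by linarith [ha2 x]) hpos.le
  have hb1 : ∀ x, b x ≤ 1 / 2 := fun x => by
    rw [hb]
    dsimp only
    rw [div_le_iff₀ hpos]
    linarith [ha x]
  set m' : W → W → ℝ := fun x y => m x y / (1 + 2 * δ) with hm'
  have hm'0 : ∀ x y, 0 ≤ m' x y := fun x y => div_nonneg (hm x y) hpos.le
  have hm's : ∀ x y, m' x y = m' y x := fun x y => by simp only [hm', hms x y]
  have hdeg' : ∀ x, ∑ y, m' x y ≤ b x + 1 / 2 := by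
    intro x
    simp only [hm', hb]
    rw [← Finset.sum_div, div_add' _ _ _ hpos.ne']
    refine div_le_div_of_nonneg_right ?_ hpos.le
    linarith [hdeg x]
  have hcut' : ∀ X : Finset W, cut m' X X ≤ ∑ x ∈ X, 2 * b x := by
    intro X
    have h1 : cut m' X X = cut m X X / (1 + 2 * δ) := by
      simp only [cut, hm', Finset.sum_div]
    have h2 : ∑ x ∈ X, 2 * b x = (∑ x ∈ X, 2 * (1 / 2 - a x + δ)) / (1 + 2 * δ) := by
      simp only [hb, Finset.sum_div]
      exact Finset.sum_congr rfl fun x _ => by ring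
    rw [h1, h2]
    refine div_le_div_of_nonneg_right ((hcut X).trans ?_) hpos.le
    exact Finset.sum_le_sum fun x _ => by linarith
  set y : W → W → ℝ := fun u v => m' u v / (b u + b v + 1 / 2) with hy
  have hden : ∀ u v, 0 < b u + b v + 1 / 2 := fun u v => by linarith [hb0 u, hb0 v]
  have hy0 : ∀ u v, 0 ≤ y u v := fun u v => div_nonneg (hm'0 u v) (hden u v).le
  have hys : ∀ u v, y u v = y v u := fun u v => by simp only [hy, hm's u v, add_comm (b u)]
  have hydeg : ∀ u, ∑ v, y u v ≤ 1 := by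
    intro u
    have hu := hb0 u
    calc ∑ v, y u v ≤ ∑ v, m' u v / (b u + 1 / 2) := by
          refine Finset.sum_le_sum fun v _ => ?_
          exact div_le_div_of_nonneg_left (hm'0 u v) (by linarith) (by linarith [hb0 v])
      _ = (∑ v, m' u v) / (b u + 1 / 2) := by rw [Finset.sum_div]
      _ ≤ 1 := by rw [div_le_one (by linarith)]; exact hdeg' u
  have hyX : ∀ X : Finset W, ∑ u ∈ X, ∑ v ∈ X, y u v ≤ 2 / 3 * X.card := by
    intro X
    refine sum_weight_div_le hm'0 hm's hb0 hb1 X (fun u _ => ?_) (hcut' X)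
    exact (Finset.sum_le_sum_of_subset_of_nonneg (Finset.subset_univ _)
      fun v _ _ => hm'0 u v).trans (hdeg' u)
  set ζ := ε / (16 * N) with hζ
  have hζ0 : 0 < ζ := by positivity
  have hζN : ζ * N = δ / 2 := by
    rw [hζ, hδ]; field_simp; ring
  set z : W → W → ℝ := fun u v => (1 - δ) * y u v + ζ with hz
  have hδ1 : δ ≤ 1 / 8 := by rw [hδ]; linarith
  obtain ⟨l, h1, h2, h3, h4⟩ := exists_matching_decomposition (x := z)
    (fun u v => add_nonneg (mul_nonneg (by linarith) (hy0 u v)) hζ0.le)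
    (fun u v => by simp only [hz, hys u v])
    (fun u => by
      simp only [hz]
      rw [Finset.sum_add_distrib, ← Finset.mul_sum, Finset.sum_const, nsmul_eq_mul,
        Finset.card_univ]
      have := mul_le_mul_of_nonneg_left (hydeg u) (by linarith : 0 ≤ 1 - δ)
      have := mul_le_mul_of_nonneg_left hWN hζ0.le
      linarith)
    (fun X _ hX => by
      simp only [hz, Finset.sum_add_distrib, ← Finset.mul_sum, Finset.sum_const, nsmul_eq_mul]
      have h1 := mul_le_mul_of_nonneg_left (hyX X) (by linarith : 0 ≤ 1 - δ)
      have h2 : (X.card : ℝ) ≤ N := le_trans (by exact_mod_cast Finset.card_le_univ X) hWN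
      have h3 : (3 : ℝ) ≤ X.card := by exact_mod_cast hX
      have h4 := mul_le_mul_of_nonneg_left h2 hζ0.le
      have h5 : (X.card : ℝ) * (X.card * ζ) ≤ X.card * (δ / 2) :=
        mul_le_mul_of_nonneg_left (by linarith) (by linarith)
      nlinarith)
  refine ⟨l, h1, h2, h3, fun u v huv ℓ hℓ => ?_⟩
  have hbs : (1 + 2 * δ) * (b u + b v + 1 / 2) = 3 / 2 - a u - a v + 3 * δ := by
    simp only [hb]; field_simp; ring
  have hℓ0 : 0 < ℓ := by linarith [ha2 u, ha2 v]
  have hmy : m u v = (1 + 2 * δ) * (b u + b v + 1 / 2) * y u v := by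
    simp only [hy, hm']
    have := (hden u v).ne'
    generalize b u + b v + 1 / 2 = d at this ⊢
    field_simp
  have h5 := mul_le_mul_of_nonneg_left (h4 u v huv) hℓ0.le
  refine le_trans ?_ h5
  have hεδ : ε = 8 * δ := by rw [hδ]; ring
  have h6 : 3 / 2 - a u - a v + 3 * δ ≤ ℓ * (1 - δ) := by
    have : (3 / 2 + ε - a u - a v) * (1 - δ) ≤ ℓ * (1 - δ) :=
      mul_le_mul_of_nonneg_right hℓ (by linarith)
    nlinarith [ha u, ha v, mul_nonneg hδ0.le (ha u), mul_nonneg hδ0.le (ha v)]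
  have h7 := mul_le_mul_of_nonneg_right h6 (hy0 u v)
  rw [hmy, hbs]
  simp only [hz]
  nlinarith

end FrugalPlanar

namespace FrugalPlanar

variable {V : Type} [Fintype V] [DecidableEq V] (G : SimpleGraph V)

/-- Vertices within distance two of `v` through a vertex outside `B`, together with the neighbours
of `v`. -/
noncomputable def nearby (B : Finset V) (v : V) : Finset V :=
  (nbrs G v ∪ (nbrs G v \ B).biUnion (nbrs G)).erase v

theorem mem_nearby {B : Finset V} {u v : V} : u ∈ nearby G B v ↔
    u ≠ v ∧ (G.Adj v u ∨ ∃ w, G.Adj v w ∧ w ∉ B ∧ G.Adj w u) := by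
  simp only [nearby, Finset.mem_erase, Finset.mem_union, mem_nbrs, Finset.mem_biUnion,
    Finset.mem_sdiff, and_assoc]

theorem nearby_symm {B : Finset V} {u v : V} (h : u ∈ nearby G B v) : v ∈ nearby G B u := by
  rw [mem_nearby] at h ⊢
  obtain ⟨hne, h | ⟨w, h1, h2, h3⟩⟩ := h
  · exact ⟨hne.symm, Or.inl h.symm⟩
  · exact ⟨hne.symm, Or.inr ⟨w, h3.symm, h2, h1.symm⟩⟩

theorem card_nearby_le {B : Finset V} {d : ℕ} (hB : ∀ w ∉ B, (nbrs G w).card ≤ d) {v : V}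
    (hv : v ∉ B) : (nearby G B v).card ≤ d + d * d := by
  refine (Finset.card_erase_le).trans ((Finset.card_union_le _ _).trans (add_le_add (hB v hv) ?_))
  refine (Finset.card_biUnion_le_card_mul _ _ d fun w hw => hB w (Finset.mem_sdiff.1 hw).2).trans ?_
  exact Nat.mul_le_mul_right _ ((Finset.card_le_card Finset.sdiff_subset).trans (hB v hv))

/-- Number of neighbours of `x` outside `R` of colour `a`. -/
noncomputable def usage (R : Finset V) (c : V → ℤ) (x : V) (a : ℤ) : ℕ :=
  ((nbrs G x \ R).filter fun u => c u = a).card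

/-- The virtual colours available at `v` when the vertices outside `R` are coloured by `c`: pairs of
a colour of the list of `v` and an index below `k`, such that the colour is not used nearby, and
such that the index is not blocked by an already coloured neighbour of a vertex of `B`. -/
noncomputable def available (B R : Finset V) (c : V → ℤ) (L : V → Finset ℤ) (k : ℕ) (v : V) :
    Finset (ℤ × ℕ) :=
  (L v ×ˢ Finset.range k).filter fun p =>
    p.1 ∉ (nearby G B v \ R).image c ∧ ∀ x ∈ nbrs G v ∩ B, usage G R c x p.1 ≤ p.2

theorem le_card_available (B R : Finset V) (c : V → ℤ) (L : V → Finset ℤ) (k : ℕ) (v : V) :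
    k * (L v).card ≤ (available G B R c L k v).card + k * (nearby G B v).card +
      ∑ x ∈ nbrs G v ∩ B, (nbrs G x \ R).card := by
  set blocked : V → Finset (ℤ × ℕ) := fun x => ((nbrs G x \ R).image c).biUnion fun a =>
    (Finset.range (usage G R c x a)).image fun i => (a, i) with hblocked
  have hblk : ∀ x, (blocked x).card ≤ (nbrs G x \ R).card := by
    intro x
    refine Finset.card_biUnion_le.trans ?_
    rw [Finset.card_eq_sum_card_image c (nbrs G x \ R)]
    refine Finset.sum_le_sum fun a _ => Finset.card_image_le.trans ?_
    rw [Finset.card_range]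
    exact le_rfl
  have hsub : L v ×ˢ Finset.range k ⊆ available G B R c L k v ∪
      ((nearby G B v \ R).image c) ×ˢ Finset.range k ∪ (nbrs G v ∩ B).biUnion blocked := by
    rintro ⟨a, i⟩ hp
    have hp' := Finset.mem_product.1 hp
    by_cases h1 : a ∈ (nearby G B v \ R).image c
    · exact Finset.mem_union_left _ (Finset.mem_union_right _ (Finset.mem_product.2 ⟨h1, hp'.2⟩))
    by_cases h2 : ∀ x ∈ nbrs G v ∩ B, usage G R c x a ≤ i
    · exact Finset.mem_union_left _ (Finset.mem_union_left _ (Finset.mem_filter.2 ⟨hp, h1, h2⟩))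
    · push Not at h2
      obtain ⟨x, hx, hlt⟩ := h2
      refine Finset.mem_union_right _ (Finset.mem_biUnion.2 ⟨x, hx, Finset.mem_biUnion.2 ⟨a, ?_, ?_⟩⟩)
      · have : 0 < usage G R c x a := by omega
        obtain ⟨u, hu⟩ := Finset.card_pos.1 this
        rw [Finset.mem_filter] at hu
        exact Finset.mem_image.2 ⟨u, hu⟩
      · exact Finset.mem_image.2 ⟨i, Finset.mem_range.2 hlt, rfl⟩
  have h1 := Finset.card_le_card hsub
  have h2 := Finset.card_union_le (available G B R c L k v ∪
      ((nearby G B v \ R).image c) ×ˢ Finset.range k) ((nbrs G v ∩ B).biUnion blocked)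
  have h3 := Finset.card_union_le (available G B R c L k v)
      (((nearby G B v \ R).image c) ×ˢ Finset.range k)
  have h4 : ((nbrs G v ∩ B).biUnion blocked).card ≤ ∑ x ∈ nbrs G v ∩ B, (nbrs G x \ R).card :=
    Finset.card_biUnion_le.trans (Finset.sum_le_sum fun x _ => hblk x)
  rw [Finset.card_product, Finset.card_range] at h1 h3
  have h5 : ((nearby G B v \ R).image c).card ≤ (nearby G B v).card :=
    Finset.card_image_le.trans (Finset.card_le_card Finset.sdiff_subset)
  have h6 := Nat.mul_le_mul_right k h5
  rw [mul_comm k, mul_comm k]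
  omega

theorem ncard_color_eq (c : V → ℤ) (x : V) (a : ℤ) :
    {u | u ∈ G.neighborSet x ∧ c u = a}.ncard = ((nbrs G x).filter fun u => c u = a).card := by
  rw [← Set.ncard_coe_finset]
  congr 1
  ext u
  simp [mem_nbrs]

/-- A partial colouring outside `R` together with a suitable choice of available virtual colours on
`R` yields a frugal colouring. -/
theorem exists_frugal_of_selection {B R : Finset V} {c : V → ℤ} {L : V → Finset ℤ} {k : ℕ}
    (hk : 1 ≤ k) (hcL : ∀ v ∉ R, c v ∈ L v)
    (hproper : ∀ u v, u ∉ R → v ∉ R → G.Adj u v → c u ≠ c v)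
    (husage : ∀ x a, usage G R c x a ≤ k) (f : V → ℤ × ℕ)
    (hf : ∀ v ∈ R, f v ∈ available G B R c L k v)
    (hnear : ∀ u ∈ R, ∀ v ∈ R, u ∈ nearby G B v → (f u).1 ≠ (f v).1)
    (hbig : ∀ u ∈ R, ∀ v ∈ R, u ≠ v → ∀ x ∈ B, G.Adj x u → G.Adj x v → f u ≠ f v) :
    ∃ c' : V → ℤ, (∀ v, c' v ∈ L v) ∧ G.IsFrugalColoring k c' := by
  set c' : V → ℤ := fun v => if v ∈ R then (f v).1 else c v with hc'
  have hin : ∀ v ∈ R, c' v = (f v).1 := fun v hv => if_pos hv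
  have hout : ∀ v, v ∉ R → c' v = c v := fun v hv => if_neg hv
  have hav : ∀ v ∈ R, (f v).1 ∈ L v ∧ (f v).2 < k ∧ (∀ u ∈ nearby G B v, u ∉ R → c u ≠ (f v).1) ∧
      ∀ x ∈ B, G.Adj v x → usage G R c x (f v).1 ≤ (f v).2 := by
    intro v hv
    have h := hf v hv
    rw [available, Finset.mem_filter, Finset.mem_product, Finset.mem_range] at h
    refine ⟨h.1.1, h.1.2, fun u hu huR hcu => h.2.1 ?_, fun x hx hvx => h.2.2 x ?_⟩
    · exact Finset.mem_image.2 ⟨u, Finset.mem_sdiff.2 ⟨hu, huR⟩, hcu⟩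
    · exact Finset.mem_inter.2 ⟨(mem_nbrs).2 hvx, hx⟩
  have hfar : ∀ v ∈ R, ∀ u ∈ nearby G B v, c' u ≠ c' v := by
    intro v hv u hu
    rw [hin v hv]
    by_cases huR : u ∈ R
    · rw [hin u huR]
      exact hnear u huR v hv hu
    · rw [hout u huR]
      exact (hav v hv).2.2.1 u hu huR
  refine ⟨c', fun v => ?_, fun u v huv => ?_, fun x a => ?_⟩
  · by_cases hv : v ∈ R
    · rw [hin v hv]; exact (hav v hv).1
    · rw [hout v hv]; exact hcL v hv
  · by_cases hv : v ∈ R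
    · exact hfar v hv u ((mem_nearby G).2 ⟨huv.ne, Or.inl huv.symm⟩)
    by_cases hu : u ∈ R
    · exact (hfar u hu v ((mem_nearby G).2 ⟨huv.ne', Or.inl huv⟩)).symm
    · rw [hout u hu, hout v hv]
      exact hproper u v hu hv huv
  · rw [ncard_color_eq G]
    have hsplit : ((nbrs G x).filter fun u => c' u = a).card = usage G R c x a +
        ((nbrs G x ∩ R).filter fun u => (f u).1 = a).card := by
      rw [usage, ← Finset.card_union_of_disjoint]
      · congr 1
        ext u
        simp only [Finset.mem_filter, Finset.mem_union, Finset.mem_sdiff, Finset.mem_inter]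
        by_cases hu : u ∈ R
        · rw [hin u hu]; tauto
        · rw [hout u hu]; tauto
      · refine Finset.disjoint_left.2 fun u h1 h2 => ?_
        simp only [Finset.mem_filter, Finset.mem_sdiff, Finset.mem_inter] at h1 h2
        exact h1.1.2 h2.1.2
    by_cases hemp : ((nbrs G x ∩ R).filter fun u => (f u).1 = a) = ∅
    · rw [hsplit, hemp, Finset.card_empty, add_zero]
      exact husage x a
    obtain ⟨v, hv⟩ := Finset.nonempty_iff_ne_empty.2 hemp
    rw [Finset.mem_filter, Finset.mem_inter, mem_nbrs] at hv
    by_cases hxB : x ∈ B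
    · have hle : ((nbrs G x ∩ R).filter fun u => (f u).1 = a).card ≤
          (Finset.Ico (usage G R c x a) k).card := by
        refine Finset.card_le_card_of_injOn (fun u => (f u).2) ?_ ?_
        · intro u hu
          simp only [Finset.coe_filter, Finset.mem_inter, mem_nbrs, Set.mem_ofPred_eq] at hu
          obtain ⟨-, h1, -, h2⟩ := hav u hu.1.2
          refine Finset.mem_coe.2 (Finset.mem_Ico.2 ⟨?_, h1⟩)
          have := h2 x hxB hu.1.1.symm
          rwa [hu.2] at this
        · intro u hu u' hu' huu
          simp only [Finset.coe_filter, Finset.mem_inter, mem_nbrs, Set.mem_ofPred_eq] at hu hu'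
          by_contra hne
          refine hbig u hu.1.2 u' hu'.1.2 hne x hxB hu.1.1 hu'.1.1 (Prod.ext ?_ huu)
          rw [hu.2, hu'.2]
      rw [Nat.card_Ico] at hle
      have := husage x a
      omega
    · have hone : ((nbrs G x).filter fun u => c' u = a).card ≤ 1 := by
        have hcv : c' v = a := (hin v hv.1.2).trans hv.2
        refine Finset.card_le_one.2 ?_
        have : ∀ u ∈ (nbrs G x).filter (fun u => c' u = a), u = v := by
          intro u hu
          rw [Finset.mem_filter, mem_nbrs] at hu
          by_contra hne
          refine hfar v hv.1.2 u ((mem_nearby G).2 ⟨hne, Or.inr ⟨x, hv.1.1.symm, hxB, hu.1⟩⟩) ?_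
          rw [hu.2, hcv]
        intro u hu u' hu'
        rw [this u hu, this u' hu']
      omega

/-- A frugal colouring of a graph `H` on the complement of `R` provides a partial colouring that
can be extended to `R`. -/
theorem exists_partial_coloring {R : Finset V} {L : V → Finset ℤ} {k : ℕ} (hk : 1 ≤ k)
    (H : SimpleGraph {v // v ∉ R}) (hH : ∀ u v, G.Adj u.1 v.1 → H.Adj u v)
    (hR : ∀ v ∈ R, nbrs G v ⊆ R ∨ ∃ w : {v // v ∉ R}, ∀ u : {v // v ∉ R}, G.Adj v u.1 →
      u = w ∨ H.Adj w u)
    (c₀ : {v // v ∉ R} → ℤ) (hL : ∀ v, c₀ v ∈ L v.1) (hc₀ : H.IsFrugalColoring k c₀) :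
    ∃ c : V → ℤ, (∀ v ∉ R, c v ∈ L v) ∧ (∀ u v, u ∉ R → v ∉ R → G.Adj u v → c u ≠ c v) ∧
      ∀ x a, usage G R c x a ≤ k := by
  set c : V → ℤ := fun v => if h : v ∉ R then c₀ ⟨v, h⟩ else 0 with hc
  have hcv : ∀ v (h : v ∉ R), c v = c₀ ⟨v, h⟩ := fun v h => dif_pos h
  refine ⟨c, fun v hv => ?_, fun u v hu hv huv => ?_, fun x a => ?_⟩
  · rw [hcv v hv]; exact hL ⟨v, hv⟩
  · rw [hcv u hu, hcv v hv]
    exact hc₀.1 _ _ (hH _ _ huv)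
  · have key : ∀ w : {v // v ∉ R}, (∀ u : {v // v ∉ R}, G.Adj x u.1 → c u.1 = a → H.Adj w u) →
        usage G R c x a ≤ k := by
      intro w hw
      refine le_trans ?_ (hc₀.2 w a)
      rw [usage, ← Set.ncard_coe_finset]
      have himg : ((((nbrs G x \ R).filter fun u => c u = a) : Finset V) : Set V) ⊆
          Subtype.val '' {u | u ∈ H.neighborSet w ∧ c₀ u = a} := by
        intro u hu
        simp only [Finset.coe_filter, Finset.mem_sdiff, mem_nbrs, Set.mem_ofPred_eq] at hu
        refine ⟨⟨u, hu.1.2⟩, ⟨hw ⟨u, hu.1.2⟩ hu.1.1 hu.2, ?_⟩, rfl⟩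
        rw [← hcv u hu.1.2]
        exact hu.2
      exact (Set.ncard_le_ncard himg (Set.toFinite _)).trans (Set.ncard_image_le (Set.toFinite _))
    by_cases hx : x ∈ R
    · rcases hR x hx with h | ⟨w, hw⟩
      · rw [usage, Finset.sdiff_eq_empty_iff_subset.2 h]
        simp
      · by_cases hwa : c w.1 = a
        · refine le_trans ?_ hk
          rw [usage]
          refine Finset.card_le_one.2 ?_
          have : ∀ u ∈ (nbrs G x \ R).filter (fun u => c u = a), u = w.1 := by
            intro u hu
            rw [Finset.mem_filter, Finset.mem_sdiff, mem_nbrs] at hu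
            rcases hw ⟨u, hu.1.2⟩ hu.1.1 with h | h
            · rw [← h]
            · refine absurd ?_ (hc₀.1 _ _ h)
              rw [← hcv u hu.1.2, hu.2, ← hwa, hcv w.1 w.2]
          intro u hu u' hu'
          rw [this u hu, this u' hu']
        · refine key w fun u hxu hua => (hw u hxu).resolve_left ?_
          rintro rfl
          exact hwa hua
    · exact key ⟨x, hx⟩ fun u hxu _ => hH ⟨x, hx⟩ u hxu

end FrugalPlanar

namespace FrugalPlanar

variable {V : Type}

/-- The graph has a `k`-frugal colouring from any lists of size at least `t`. -/
def FrugallyChoosable (G : SimpleGraph V) (k t : ℕ) : Prop :=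
  ∀ L : V → Finset ℤ, (∀ v, t ≤ (L v).card) →
    ∃ c : V → ℤ, (∀ v, c v ∈ L v) ∧ G.IsFrugalColoring k c

/-- The graph obtained from `G` by identifying each vertex of `R` with its image under `f`. -/
def contract (G : SimpleGraph V) {R : Finset V} (f : V → {v // v ∉ R}) :
    SimpleGraph {v // v ∉ R} where
  Adj a b := a ≠ b ∧ ∃ v v', f v = a ∧ f v' = b ∧ G.Adj v v'
  symm := ⟨fun _ _ ⟨h, v, v', h1, h2, h3⟩ => ⟨h.symm, v', v, h2, h1, h3.symm⟩⟩
  loopless := ⟨fun _ h => h.1 rfl⟩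

section Contract

variable {G : SimpleGraph V} {R : Finset V} {f : V → {v // v ∉ R}}

theorem contract_noK33 (hG : NoK33 G) (hf : ∀ v (h : v ∉ R), f v = ⟨v, h⟩)
    (hR : ∀ v ∈ R, G.Adj v (f v).1) : NoK33 (contract G f) := by
  refine hG.of_star (fun v => some (f v)) Subtype.val (fun u => ?_) (fun v u h => ?_) ?_
  · rw [hf u.1 u.2]
  · by_cases hv : v ∈ R
    · right
      rw [← Option.some_injective _ h]
      exact hR v hv
    · left
      rw [← Option.some_injective _ h, hf v hv]
  · rintro u u' ⟨-, v, v', h1, h2, h3⟩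
    exact ⟨v, v', by simp [h1], by simp [h2], h3⟩

theorem contract_adj (hf : ∀ v (h : v ∉ R), f v = ⟨v, h⟩) (u v : {v // v ∉ R})
    (h : G.Adj u.1 v.1) : (contract G f).Adj u v :=
  ⟨fun e => h.ne (congrArg _ e), u.1, v.1, hf _ u.2, hf _ v.2, h⟩

theorem eq_or_contract_adj (hf : ∀ v (h : v ∉ R), f v = ⟨v, h⟩) (v : V) (u : {v // v ∉ R})
    (h : G.Adj v u.1) : u = f v ∨ (contract G f).Adj (f v) u := by
  by_cases hu : u = f v
  · exact Or.inl hu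
  · exact Or.inr ⟨fun e => hu e.symm, v, u.1, rfl, hf _ u.2, h⟩

end Contract

variable [Fintype V] [DecidableEq V]

/-- A vertex with few neighbours, at most two of which have large degree, can be removed. -/
theorem exists_reduced_graph {G : SimpleGraph V} (hG : NoK33 G) {B : Finset V} {d Δ : ℕ}
    (hB : ∀ w ∉ B, (nbrs G w).card ≤ d) (hd : 2 * d ≤ Δ) (hdeg : ∀ v, (nbrs G v).card ≤ Δ)
    {v : V} (hv : v ∉ B) (hv2 : (nbrs G v ∩ B).card ≤ 2) :
    ∃ H : SimpleGraph {u // u ∉ ({v} : Finset V)}, NoK33 H ∧ (∀ u, (nbrs H u).card ≤ Δ) ∧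
      (∀ u w, G.Adj u.1 w.1 → H.Adj u w) ∧
      (nbrs G v ⊆ {v} ∨ ∃ w : {u // u ∉ ({v} : Finset V)}, ∀ u : {u // u ∉ ({v} : Finset V)},
        G.Adj v u.1 → u = w ∨ H.Adj w u) := by
  classical
  by_cases hemp : nbrs G v = ∅
  · refine ⟨G.comap Subtype.val,
      hG.of_injective Subtype.val Subtype.val_injective fun _ _ h => h, fun u => ?_,
      fun _ _ h => h, Or.inl (by simp [hemp])⟩
    refine le_trans ?_ (hdeg u.1)
    refine Finset.card_le_card_of_injOn Subtype.val (fun w hw => ?_) Subtype.val_injective.injOn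
    have hw' := mem_nbrs.1 (Finset.mem_coe.1 hw)
    exact Finset.mem_coe.2 (mem_nbrs.2 hw')
  have hw : ∃ w ∈ nbrs G v, (nbrs G w).card + (nbrs G v).card ≤ Δ + 2 := by
    by_cases hs : ∃ w ∈ nbrs G v, w ∉ B
    · obtain ⟨w, hw, hwB⟩ := hs
      have := hB w hwB
      have := hB v hv
      exact ⟨w, hw, by omega⟩
    · push Not at hs
      obtain ⟨w, hw⟩ := Finset.nonempty_iff_ne_empty.2 hemp
      rw [Finset.inter_eq_left.2 hs] at hv2
      have := hdeg w
      exact ⟨w, hw, by omega⟩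
  obtain ⟨w, hvw, hcard⟩ := hw
  rw [mem_nbrs] at hvw
  have hwv : w ∉ ({v} : Finset V) := by simpa using hvw.ne'
  let f : V → {u // u ∉ ({v} : Finset V)} := fun u => if h : u ∉ ({v} : Finset V) then ⟨u, h⟩ else ⟨w, hwv⟩
  have hf : ∀ u (h : u ∉ ({v} : Finset V)), f u = ⟨u, h⟩ := fun u h => dif_pos h
  have hfv : f v = ⟨w, hwv⟩ := dif_neg (by simp)
  refine ⟨contract G f, contract_noK33 hG hf fun u hu => ?_, fun u => ?_, contract_adj hf,
    Or.inr ⟨f v, eq_or_contract_adj hf v⟩⟩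
  · rw [Finset.mem_singleton.1 hu, hfv]
    exact hvw
  · have hcase : ∀ a b, (f a).1 = b → (a = v ∧ b = w) ∨ (a ≠ v ∧ a = b) := by
      intro a b h
      by_cases ha : a = v
      · left; refine ⟨ha, ?_⟩
        rw [← h, ha, hfv]
      · right; refine ⟨ha, ?_⟩
        rw [← h, hf a (by simpa using ha)]
    have hadj : ∀ b : {u // u ∉ ({v} : Finset V)}, (contract G f).Adj u b →
        (G.Adj u.1 b.1) ∨ (u.1 = w ∧ G.Adj v b.1) ∨ (b.1 = w ∧ G.Adj u.1 v) := by
      rintro b ⟨hne, a, a', h1, h2, h3⟩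
      rcases hcase a u.1 (by rw [h1]) with ⟨ha, hu⟩ | ⟨ha, hu⟩ <;>
        rcases hcase a' b.1 (by rw [h2]) with ⟨ha', hb⟩ | ⟨ha', hb⟩
      · rw [ha, ha'] at h3; exact absurd h3 (G.irrefl)
      · rw [ha, hb] at h3; exact Or.inr (Or.inl ⟨hu, h3⟩)
      · rw [ha', hu] at h3; exact Or.inr (Or.inr ⟨hb, h3⟩)
      · rw [hu, hb] at h3; exact Or.inl h3
    have huv : u.1 ≠ v := by simpa using u.2
    have himg : (nbrs (contract G f) u).card = ((nbrs (contract G f) u).image Subtype.val).card :=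
      (Finset.card_image_of_injective _ Subtype.val_injective).symm
    rw [himg]
    by_cases huw : u.1 = w
    · have hsub : (nbrs (contract G f) u).image Subtype.val ⊆
          (nbrs G w).erase v ∪ (nbrs G v).erase w := by
        intro b hb
        obtain ⟨b', hb', rfl⟩ := Finset.mem_image.1 hb
        rw [mem_nbrs] at hb'
        have hbv : b'.1 ≠ v := by simpa using b'.2
        have hbw : b'.1 ≠ w := fun e => hb'.1 (Subtype.ext (huw.trans e.symm))
        simp only [Finset.mem_union, Finset.mem_erase, mem_nbrs]
        rcases hadj b' hb' with h | ⟨-, h⟩ | ⟨h, -⟩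
        · exact Or.inl ⟨hbv, huw ▸ h⟩
        · exact Or.inr ⟨hbw, h⟩
        · exact absurd h hbw
      have h1 := (Finset.card_le_card hsub).trans (Finset.card_union_le _ _)
      rw [Finset.card_erase_of_mem (mem_nbrs.2 hvw.symm),
        Finset.card_erase_of_mem (mem_nbrs.2 hvw)] at h1
      have := Finset.card_pos.2 ⟨v, mem_nbrs.2 hvw.symm⟩
      have := Finset.card_pos.2 ⟨w, mem_nbrs.2 hvw⟩
      omega
    · by_cases hva : G.Adj u.1 v
      · have hsub : (nbrs (contract G f) u).image Subtype.val ⊆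
            insert w ((nbrs G u.1).erase v) := by
          intro b hb
          obtain ⟨b', hb', rfl⟩ := Finset.mem_image.1 hb
          rw [mem_nbrs] at hb'
          have hbv : b'.1 ≠ v := by simpa using b'.2
          simp only [Finset.mem_insert, Finset.mem_erase, mem_nbrs]
          rcases hadj b' hb' with h | ⟨h, -⟩ | ⟨h, -⟩
          · exact Or.inr ⟨hbv, h⟩
          · exact absurd h huw
          · exact Or.inl h
        have h1 := (Finset.card_le_card hsub).trans (Finset.card_insert_le _ _)
        rw [Finset.card_erase_of_mem (mem_nbrs.2 hva)] at h1
        have := Finset.card_pos.2 ⟨v, mem_nbrs.2 hva⟩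
        have := hdeg u.1
        omega
      · refine (Finset.card_le_card ?_).trans (hdeg u.1)
        intro b hb
        obtain ⟨b', hb', rfl⟩ := Finset.mem_image.1 hb
        rw [mem_nbrs] at hb'
        rcases hadj b' hb' with h | ⟨h, -⟩ | ⟨-, h⟩
        · exact mem_nbrs.2 h
        · exact absurd h huw
        · exact absurd h hva

theorem frugallyChoosable_of_reducible_vertex {G : SimpleGraph V} (hG : NoK33 G) {B : Finset V}
    {d Δ k t : ℕ} (hk : 1 ≤ k) (hB : ∀ w ∉ B, (nbrs G w).card ≤ d) (hd : 2 * d ≤ Δ)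
    (hdeg : ∀ v, (nbrs G v).card ≤ Δ) {v : V} (hv : v ∉ B) (hv2 : (nbrs G v ∩ B).card ≤ 2)
    (hsum : ∑ x ∈ nbrs G v ∩ B, (nbrs G x).card + k * (d + d * d) < k * t)
    (ih : ∀ H : SimpleGraph {u // u ∉ ({v} : Finset V)}, NoK33 H →
      (∀ u, (nbrs H u).card ≤ Δ) → FrugallyChoosable H k t) : FrugallyChoosable G k t := by
  intro L hL
  obtain ⟨H, hHK, hHd, hH, hHR⟩ := exists_reduced_graph hG hB hd hdeg hv hv2
  obtain ⟨c₀, hc₀L, hc₀⟩ := ih H hHK hHd (fun u => L u.1) fun u => hL u.1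
  obtain ⟨c, hcL, hcp, hcu⟩ := exists_partial_coloring G (L := L) hk H hH
    (fun u hu => by rw [Finset.mem_singleton.1 hu]; exact hHR) c₀ hc₀L hc₀
  have hav := le_card_available G B {v} c L k v
  have h1 : k * (nearby G B v).card ≤ k * (d + d * d) :=
    Nat.mul_le_mul_left _ (card_nearby_le G hB hv)
  have h2 : ∑ x ∈ nbrs G v ∩ B, (nbrs G x \ {v}).card ≤ ∑ x ∈ nbrs G v ∩ B, (nbrs G x).card :=
    Finset.sum_le_sum fun x _ => Finset.card_le_card Finset.sdiff_subset
  have h3 := Nat.mul_le_mul_left k (hL v)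
  obtain ⟨p, hp⟩ := Finset.card_pos.1 (show 0 < (available G B {v} c L k v).card by omega)
  refine exists_frugal_of_selection G (B := B) hk hcL hcp hcu (fun _ => p) (fun u hu => ?_)
    (fun u hu w hw h => ?_) (fun u hu w hw h => ?_)
  · rw [Finset.mem_singleton.1 hu]; exact hp
  · rw [Finset.mem_singleton.1 hu, Finset.mem_singleton.1 hw] at h
    exact absurd rfl ((mem_nearby G).1 h).1
  · exact absurd ((Finset.mem_singleton.1 hu).trans (Finset.mem_singleton.1 hw).symm) h

end FrugalPlanar

namespace FrugalPlanar

variable {V : Type} [Fintype V] [DecidableEq V] {G : SimpleGraph V}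

theorem card_pairs_le (hG : NoK33 G) (B : Finset V) (P : Finset (V × V))
    (hP : ∀ p ∈ P, p.1 ∉ B ∧ p.2 ∉ B ∧ G.Adj p.1 p.2 ∧
      3 ≤ (nbrs G p.1 ∩ B ∪ nbrs G p.2 ∩ B).card)
    (hdis : ∀ p ∈ P, ∀ q ∈ P, p ≠ q → p.1 ≠ q.1 ∧ p.1 ≠ q.2 ∧ p.2 ≠ q.2) :
    P.card ≤ 115440 * B.card := by
  classical
  set R : Finset V := P.image Prod.snd with hR
  have hfst : ∀ p ∈ P, p.1 ∉ R := by
    intro p hp h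
    obtain ⟨q, hq, hqp⟩ := Finset.mem_image.1 h
    by_cases hpq : p = q
    · subst hpq
      exact (hP p hp).2.2.1.ne hqp.symm
    · exact (hdis p hp q hq hpq).2.1 hqp.symm
  have hBR : ∀ x ∈ B, x ∉ R := by
    intro x hx h
    obtain ⟨q, hq, rfl⟩ := Finset.mem_image.1 h
    exact (hP q hq).2.1 hx
  have hex : ∀ v, ∃ u : {v // v ∉ R}, (v ∉ R → v = u.1) ∧ ∀ p ∈ P, p.2 = v → u.1 = p.1 := by
    intro v
    by_cases hv : v ∈ R
    · obtain ⟨q, hq, hqv⟩ := Finset.mem_image.1 hv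
      refine ⟨⟨q.1, hfst q hq⟩, fun h => absurd hv h, fun p hp hpv => ?_⟩
      by_contra hne
      exact (hdis p hp q hq fun e => hne (by rw [e])).2.2 (hpv.trans hqv.symm)
    · exact ⟨⟨v, hv⟩, fun _ => rfl, fun p hp hpv => absurd (Finset.mem_image.2 ⟨p, hp, hpv⟩) hv⟩
  choose f hf1 hf2 using hex
  have hf : ∀ v (h : v ∉ R), f v = ⟨v, h⟩ := fun v h => Subtype.ext (hf1 v h).symm
  have hK : NoK33 (contract G f) := by
    refine contract_noK33 hG hf fun v hv => ?_
    obtain ⟨q, hq, rfl⟩ := Finset.mem_image.1 hv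
    rw [hf2 q.2 q hq rfl]
    exact (hP q hq).2.2.1.symm
  have hle := card_three_neighbours_le hK (B.subtype fun v => v ∉ R)
    ((P.image Prod.fst).subtype fun v => v ∉ R) ?_ ?_
  · rw [Finset.card_subtype, Finset.card_subtype, Finset.filter_true_of_mem hBR,
      Finset.filter_true_of_mem, Finset.card_image_of_injOn] at hle
    · exact hle
    · intro p hp q hq h
      by_contra hne
      exact (hdis p hp q hq hne).1 h
    · intro v hv
      obtain ⟨q, hq, rfl⟩ := Finset.mem_image.1 hv
      exact hfst q hq
  · refine Finset.disjoint_left.2 fun v h1 h2 => ?_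
    rw [Finset.mem_subtype] at h1 h2
    obtain ⟨q, hq, hqv⟩ := Finset.mem_image.1 h2
    exact (hP q hq).1 (hqv ▸ h1)
  · intro s hs
    rw [Finset.mem_subtype] at hs
    obtain ⟨q, hq, hqs⟩ := Finset.mem_image.1 hs
    refine (hP q hq).2.2.2.trans ?_
    rw [← Finset.card_image_of_injective (nbrs (contract G f) s ∩ B.subtype fun v => v ∉ R)
      Subtype.val_injective]
    refine Finset.card_le_card fun x hx => ?_
    have hxB : x ∈ B := by
      rcases Finset.mem_union.1 hx with h | h
      · exact (Finset.mem_inter.1 h).2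
      · exact (Finset.mem_inter.1 h).2
    refine Finset.mem_image.2 ⟨⟨x, hBR x hxB⟩, Finset.mem_inter.2 ⟨mem_nbrs.2 ⟨?_, ?_⟩,
      Finset.mem_subtype.2 hxB⟩, rfl⟩
    · intro e
      refine (hP q hq).1 ?_
      rw [hqs, e]
      exact hxB
    · rcases Finset.mem_union.1 hx with h | h
      · exact ⟨q.1, x, (hf _ (hfst q hq)).trans (Subtype.ext hqs), hf _ (hBR x hxB),
          mem_nbrs.1 (Finset.mem_inter.1 h).1⟩
      · exact ⟨q.2, x, Subtype.ext ((hf2 q.2 q hq rfl).trans hqs), hf _ (hBR x hxB),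
          mem_nbrs.1 (Finset.mem_inter.1 h).1⟩

theorem sum_card_sdiff_le (hG : NoK33 G) (B R : Finset V) (hBR : ∀ x ∈ B, x ∉ R) :
    ∑ x ∈ B, (nbrs G x \ R).card ≤ 240 * (Finset.univ \ R).card := by
  classical
  have hle := card_adjPairs_le (G.comap (Subtype.val : {v // v ∉ R} → V))
    (hG.of_injective Subtype.val Subtype.val_injective fun _ _ h => h)
  have hcard : Fintype.card {v // v ∉ R} = (Finset.univ \ R).card := by
    rw [Fintype.card_subtype]
    congr 1
    ext v
    simp
  rw [card_adjPairs, hcard] at hle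
  refine le_trans ?_ hle
  have hnb : ∀ x : {v // v ∉ R}, (nbrs G x.1 \ R).card =
      (nbrs (G.comap (Subtype.val : {v // v ∉ R} → V)) x).card := by
    intro x
    rw [← Finset.card_image_of_injective (nbrs (G.comap (Subtype.val : {v // v ∉ R} → V)) x)
      Subtype.val_injective]
    congr 1
    ext v
    simp only [Finset.mem_sdiff, mem_nbrs, Finset.mem_image, SimpleGraph.comap_adj]
    constructor
    · rintro ⟨h1, h2⟩
      exact ⟨⟨v, h2⟩, h1, rfl⟩
    · rintro ⟨w, h1, rfl⟩
      exact ⟨h1, w.2⟩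
  rw [← Finset.sum_congr rfl fun x _ => hnb x]
  rw [← Finset.sum_subtype_of_mem (fun x => (nbrs G x \ R).card) hBR]
  exact Finset.sum_le_sum_of_subset (Finset.subset_univ _)

/-- If every vertex outside `B` has at least two neighbours in `B`, then up to a small set the
vertices outside `B` have exactly two neighbours in `B`, which they share with all their other
neighbours. -/
theorem exists_uniform_part (hG : NoK33 G) (B : Finset V)
    (hB : ∀ v ∉ B, 2 ≤ (nbrs G v ∩ B).card) :
    ∃ R : Finset V, (∀ v ∈ R, v ∉ B) ∧ (∀ v ∈ R, (nbrs G v ∩ B).card = 2) ∧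
      (∀ v ∈ R, ∀ u, G.Adj v u → u ∉ B → nbrs G u ∩ B = nbrs G v ∩ B) ∧
      ∑ x ∈ B, (nbrs G x \ R).card ≤ 240 * ((1 + 3 * 115440) * (1 + 115440)) * B.card := by
  classical
  set S := Finset.univ.filter fun v => v ∉ B ∧ 3 ≤ (nbrs G v ∩ B).card with hS
  have hScard : S.card ≤ 115440 * B.card := by
    refine card_three_neighbours_le hG B S (Finset.disjoint_left.2 fun v h1 h2 => ?_) fun s hs => ?_
    · exact (Finset.mem_filter.1 h2).2.1 h1
    · exact (Finset.mem_filter.1 hs).2.2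
  let good : Finset (V × V) → Prop := fun P => (∀ p ∈ P, p.1 ∉ B ∧ p.2 ∉ B ∧ G.Adj p.1 p.2 ∧
      3 ≤ (nbrs G p.1 ∩ B ∪ nbrs G p.2 ∩ B).card) ∧
    ∀ p ∈ P, ∀ q ∈ P, p ≠ q → p.1 ≠ q.1 ∧ p.1 ≠ q.2 ∧ p.2 ≠ q.2
  obtain ⟨P, hP, hmax⟩ := Finset.exists_max_image (Finset.univ.filter good) Finset.card
    ⟨∅, by simp [good]⟩
  have hPg : good P := (Finset.mem_filter.1 hP).2
  have hPcard := card_pairs_le hG B P hPg.1 hPg.2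
  set M := P.image Prod.fst ∪ P.image Prod.snd with hM
  have hMcard : M.card ≤ 2 * (115440 * B.card) := by
    refine (Finset.card_union_le _ _).trans ?_
    have h1 : (P.image Prod.fst).card ≤ P.card := Finset.card_image_le
    have h2 : (P.image Prod.snd).card ≤ P.card := Finset.card_image_le
    omega
  set B' := B ∪ S ∪ M with hB'
  have hB'card : B'.card ≤ (1 + 3 * 115440) * B.card := by
    have h1 := Finset.card_union_le (B ∪ S) M
    have h2 := Finset.card_union_le B S
    rw [← hB'] at h1
    omega
  set S' := Finset.univ.filter fun v => v ∉ B' ∧ 3 ≤ (nbrs G v ∩ B').card with hS'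
  have hS'card : S'.card ≤ 115440 * B'.card := by
    refine card_three_neighbours_le hG B' S' (Finset.disjoint_left.2 fun v h1 h2 => ?_)
      fun s hs => ?_
    · exact (Finset.mem_filter.1 h2).2.1 h1
    · exact (Finset.mem_filter.1 hs).2.2
  have hBB' : B ⊆ B' := fun x hx => Finset.mem_union_left _ (Finset.mem_union_left _ hx)
  have hout : ∀ v ∉ B', v ∉ B ∧ (nbrs G v ∩ B).card = 2 ∧ v ∉ M := by
    intro v hv
    have hvB : v ∉ B := fun h => hv (hBB' h)
    refine ⟨hvB, ?_, fun h => hv (Finset.mem_union_right _ h)⟩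
    have hvS : v ∉ S := fun h => hv (Finset.mem_union_left _ (Finset.mem_union_right _ h))
    have h2 := hB v hvB
    by_contra hne
    exact hvS (Finset.mem_filter.2 ⟨Finset.mem_univ _, hvB, by omega⟩)
  refine ⟨Finset.univ \ (B' ∪ S'), fun v hv => ?_, fun v hv => ?_, fun v hv u hvu huB => ?_, ?_⟩
  · simp only [Finset.mem_sdiff, Finset.mem_union, not_or] at hv
    exact (hout v hv.2.1).1
  · simp only [Finset.mem_sdiff, Finset.mem_union, not_or] at hv
    exact (hout v hv.2.1).2.1
  · simp only [Finset.mem_sdiff, Finset.mem_union, not_or] at hv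
    obtain ⟨hvB, hv2, hvM⟩ := hout v hv.2.1
    have huB' : u ∉ B' := by
      intro h
      refine hv.2.2 (Finset.mem_filter.2 ⟨Finset.mem_univ _, hv.2.1, ?_⟩)
      have : insert u (nbrs G v ∩ B) ⊆ nbrs G v ∩ B' := by
        refine Finset.insert_subset (Finset.mem_inter.2 ⟨mem_nbrs.2 hvu, h⟩)
          (Finset.inter_subset_inter_left hBB')
      have hc := Finset.card_le_card this
      rw [Finset.card_insert_of_notMem (fun h => huB (Finset.mem_inter.1 h).2), hv2] at hc
      exact hc
    obtain ⟨-, hu2, huM⟩ := hout u huB'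
    by_contra hne
    have h3 : 3 ≤ (nbrs G v ∩ B ∪ nbrs G u ∩ B).card := by
      by_contra hlt
      have e1 := Finset.eq_of_subset_of_card_le (Finset.subset_union_left
        (s₁ := nbrs G v ∩ B) (s₂ := nbrs G u ∩ B)) (by omega)
      have e2 := Finset.eq_of_subset_of_card_le (Finset.subset_union_right
        (s₁ := nbrs G v ∩ B) (s₂ := nbrs G u ∩ B)) (by omega)
      exact hne (e2.trans e1.symm)
    have hvP : ∀ p ∈ P, v ≠ p.1 ∧ v ≠ p.2 := fun p hp =>
      ⟨fun e => hvM (Finset.mem_union_left _ (Finset.mem_image.2 ⟨p, hp, e.symm⟩)),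
        fun e => hvM (Finset.mem_union_right _ (Finset.mem_image.2 ⟨p, hp, e.symm⟩))⟩
    have huP : ∀ p ∈ P, u ≠ p.1 ∧ u ≠ p.2 := fun p hp =>
      ⟨fun e => huM (Finset.mem_union_left _ (Finset.mem_image.2 ⟨p, hp, e.symm⟩)),
        fun e => huM (Finset.mem_union_right _ (Finset.mem_image.2 ⟨p, hp, e.symm⟩))⟩
    have hnew : good (insert (v, u) P) := by
      refine ⟨fun p hp => ?_, fun p hp q hq hpq => ?_⟩
      · rcases Finset.mem_insert.1 hp with rfl | hp
        · exact ⟨hvB, huB, hvu, h3⟩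
        · exact hPg.1 p hp
      · rcases Finset.mem_insert.1 hp with rfl | hp <;> rcases Finset.mem_insert.1 hq with rfl | hq
        · exact absurd rfl hpq
        · exact ⟨(hvP q hq).1, (hvP q hq).2, (huP q hq).2⟩
        · exact ⟨(hvP p hp).1.symm, (huP p hp).1.symm, (huP p hp).2.symm⟩
        · exact hPg.2 p hp q hq hpq
    have hle := hmax _ (Finset.mem_filter.2 ⟨Finset.mem_univ _, hnew⟩)
    rw [Finset.card_insert_of_notMem fun h => (hvP _ h).1 rfl] at hle
    omega
  · refine (sum_card_sdiff_le hG B _ fun x hx h => ?_).trans ?_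
    · exact (Finset.mem_sdiff.1 h).2 (Finset.mem_union_left _ (hBB' hx))
    · rw [sdiff_sdiff_right_self, Finset.inf_eq_inter, Finset.univ_inter]
      have := Finset.card_union_le B' S'
      rw [mul_assoc]
      refine Nat.mul_le_mul_left _ ?_
      calc _ ≤ (1 + 115440) * B'.card := by omega
        _ ≤ (1 + 115440) * ((1 + 3 * 115440) * B.card) := Nat.mul_le_mul_left _ hB'card
        _ = _ := by ring

end FrugalPlanar

namespace FrugalPlanar

section Bypass

variable {V : Type} [Fintype V] [DecidableEq V] {G : SimpleGraph V} {B R : Finset V}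

/-- The vertices of `R` have exactly two neighbours in `B`, and share them with all their
neighbours outside `B`. -/
structure IsUniform (G : SimpleGraph V) (B R : Finset V) : Prop where
  notMem : ∀ v ∈ R, v ∉ B
  card_eq : ∀ v ∈ R, (nbrs G v ∩ B).card = 2
  inter_eq : ∀ v ∈ R, ∀ u, G.Adj v u → u ∉ B → nbrs G u ∩ B = nbrs G v ∩ B

theorem IsUniform.subset (h : IsUniform G B R) {R' : Finset V} (hR : R' ⊆ R) : IsUniform G B R' :=
  ⟨fun v hv => h.notMem v (hR hv), fun v hv => h.card_eq v (hR hv),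
    fun v hv => h.inter_eq v (hR hv)⟩

theorem eq_pair_of_card {s : Finset V} (hs : s.card = 2) {x y : V} (hx : x ∈ s) (hy : y ∈ s)
    (hxy : x ≠ y) : s = {x, y} :=
  (Finset.eq_of_subset_of_card_le (by simp [Finset.insert_subset_iff, hx, hy])
    (by rw [hs, Finset.card_pair hxy])).symm

theorem pair_left_cancel {x y z : V} (hy : y ≠ x) (h : ({x, y} : Finset V) = {x, z}) : y = z := by
  have : y ∈ ({x, z} : Finset V) := h ▸ (by simp)
  simpa [hy] using this

theorem IsUniform.exists_bypass (hR : IsUniform G B R) (hG : NoK33 G) {Δ : ℕ}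
    (hdeg : ∀ v, (nbrs G v).card ≤ Δ) :
    ∃ H : SimpleGraph {v // v ∉ R}, NoK33 H ∧ (∀ u, (nbrs H u).card ≤ Δ) ∧
      (∀ u v, G.Adj u.1 v.1 → H.Adj u v) ∧
      (∀ v ∈ R, ∃ w : {v // v ∉ R}, ∀ u : {v // v ∉ R}, G.Adj v u.1 → u = w ∨ H.Adj w u) ∧
      ∀ x y : {v // v ∉ R}, x ≠ y → (∃ v ∈ R, nbrs G v ∩ B = {x.1, y.1}) → H.Adj x y := by
  classical
  have hBR : ∀ x ∈ B, x ∉ R := fun x hx h => hR.notMem x h hx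
  have hex : ∀ v, ∃ u : {v // v ∉ R}, (v ∉ R → v = u.1) ∧ (v ∈ R → u.1 ∈ nbrs G v ∩ B) := by
    intro v
    by_cases hv : v ∈ R
    · have : (nbrs G v ∩ B).Nonempty := Finset.card_pos.1 (by rw [hR.card_eq v hv]; norm_num)
      obtain ⟨x, hx⟩ := this
      exact ⟨⟨x, hBR x (Finset.mem_inter.1 hx).2⟩, fun h => absurd hv h, fun _ => hx⟩
    · exact ⟨⟨v, hv⟩, fun _ => rfl, fun h => absurd h hv⟩
  choose f hf1 hf2 using hex
  have hf : ∀ v (h : v ∉ R), f v = ⟨v, h⟩ := fun v h => Subtype.ext (hf1 v h).symm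
  have hadj : ∀ u b : {v // v ∉ R}, (contract G f).Adj u b →
      G.Adj u.1 b.1 ∨ ∃ v ∈ R, nbrs G v ∩ B = {u.1, b.1} := by
    rintro u b ⟨hne, a, a', rfl, rfl, h⟩
    have hne' : (f a).1 ≠ (f a').1 := fun e => hne (Subtype.ext e)
    by_cases ha : a ∈ R <;> by_cases ha' : a' ∈ R
    · right
      refine ⟨a, ha, eq_pair_of_card (hR.card_eq a ha) (hf2 a ha) ?_ hne'⟩
      rw [← hR.inter_eq a ha a' h (hR.notMem a' ha')]
      exact hf2 a' ha'
    · rw [hf a' ha'] at hne' ⊢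
      by_cases hB : a' ∈ B
      · right
        exact ⟨a, ha, eq_pair_of_card (hR.card_eq a ha) (hf2 a ha)
          (Finset.mem_inter.2 ⟨mem_nbrs.2 h, hB⟩) hne'⟩
      · left
        have := hf2 a ha
        rw [← hR.inter_eq a ha a' h hB] at this
        exact (mem_nbrs.1 (Finset.mem_inter.1 this).1).symm
    · rw [hf a ha] at hne' ⊢
      by_cases hB : a ∈ B
      · right
        exact ⟨a', ha', eq_pair_of_card (hR.card_eq a' ha')
          (Finset.mem_inter.2 ⟨mem_nbrs.2 h.symm, hB⟩) (hf2 a' ha') hne'⟩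
      · left
        have := hf2 a' ha'
        rw [← hR.inter_eq a' ha' a h.symm hB] at this
        exact mem_nbrs.1 (Finset.mem_inter.1 this).1
    · rw [hf a ha, hf a' ha']
      exact Or.inl h
  have hmem : ∀ v ∈ R, ∀ x y, nbrs G v ∩ B = {x, y} → G.Adj v x ∧ G.Adj v y := by
    intro v _ x y h
    have hx : x ∈ nbrs G v ∩ B := h ▸ (by simp)
    have hy : y ∈ nbrs G v ∩ B := h ▸ (by simp)
    exact ⟨mem_nbrs.1 (Finset.mem_inter.1 hx).1, mem_nbrs.1 (Finset.mem_inter.1 hy).1⟩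
  refine ⟨contract G f, contract_noK33 hG hf fun v hv => ?_, fun u => ?_, contract_adj hf,
    fun v _ => ⟨f v, eq_or_contract_adj hf v⟩, fun x y hxy => ?_⟩
  · exact mem_nbrs.1 (Finset.mem_inter.1 (hf2 v hv)).1
  · refine le_trans ?_ (hdeg u.1)
    have hφ : ∀ b : {v // v ∉ R}, ∃ w, (contract G f).Adj u b →
        (w = b.1 ∨ w ∈ R ∧ nbrs G w ∩ B = {u.1, b.1}) ∧ G.Adj u.1 w := by
      intro b
      by_cases hb : (contract G f).Adj u b
      · rcases hadj u b hb with h | ⟨v, hv, h⟩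
        · exact ⟨b.1, fun _ => ⟨Or.inl rfl, h⟩⟩
        · exact ⟨v, fun _ => ⟨Or.inr ⟨hv, h⟩, (hmem v hv _ _ h).1.symm⟩⟩
      · exact ⟨u.1, fun h => absurd h hb⟩
    choose φ hφ using hφ
    refine Finset.card_le_card_of_injOn φ (fun b hb => ?_) fun b hb b' hb' h => ?_
    · exact Finset.mem_coe.2 (mem_nbrs.2 (hφ b (mem_nbrs.1 (Finset.mem_coe.1 hb))).2)
    · have hb1 := mem_nbrs.1 (Finset.mem_coe.1 hb)
      have hb1' := mem_nbrs.1 (Finset.mem_coe.1 hb')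
      rcases (hφ b hb1).1 with h1 | ⟨h1, h2⟩ <;> rcases (hφ b' hb1').1 with h1' | ⟨h1', h2'⟩
      · exact Subtype.ext (h1.symm.trans (h.trans h1'))
      · exact absurd (h1 ▸ h ▸ h1') b.2
      · exact absurd (h1' ▸ h ▸ h1) b'.2
      · rw [← h, h2] at h2'
        exact Subtype.ext (pair_left_cancel (fun e => hb1.1 (Subtype.ext e.symm)) h2')
  · rintro ⟨v, hv, h⟩
    have hx : ∀ z : {v // v ∉ R}, G.Adj v z.1 → z = f v ∨ (contract G f).Adj (f v) z :=
      eq_or_contract_adj hf v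
    have hfv := hf2 v hv
    rw [h, Finset.mem_insert, Finset.mem_singleton] at hfv
    obtain ⟨hvx, hvy⟩ := hmem v hv _ _ h
    rcases hfv with e | e
    · have e' : f v = x := Subtype.ext e
      rcases hx y hvy with h1 | h1
      · exact absurd (h1.trans e').symm hxy
      · rwa [e'] at h1
    · have e' : f v = y := Subtype.ext e
      rcases hx x hvx with h1 | h1
      · exact absurd (h1.trans e') hxy
      · rw [e'] at h1
        exact h1.symm

/-- Number of vertices of `R` whose neighbours in `B` are exactly `x` and `y`. -/
noncomputable def mult (G : SimpleGraph V) (B R : Finset V) (x y : V) : ℕ :=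
  (R.filter fun v => nbrs G v ∩ B = {x, y}).card

theorem mult_comm (x y : V) : mult G B R x y = mult G B R y x := by
  rw [mult, mult, Finset.pair_comm]

theorem IsUniform.sum_mult (hR : IsUniform G B R) {Y : Finset V}
    (hY : ∀ v ∈ R, nbrs G v ∩ B ⊆ Y) {x : V} (hx : x ∈ B) :
    ∑ y ∈ Y, mult G B R x y = (nbrs G x ∩ R).card := by
  classical
  rw [show nbrs G x ∩ R = Y.biUnion fun y => R.filter fun v => nbrs G v ∩ B = {x, y} from ?_,
    Finset.card_biUnion]
  · rfl
  · intro y _ z _ hyz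
    refine Finset.disjoint_left.2 fun v h1 h2 => ?_
    rw [Finset.mem_filter] at h1 h2
    have hc := hR.card_eq v h1.1
    refine hyz (pair_left_cancel ?_ (h1.2.symm.trans h2.2))
    rintro rfl
    rw [h1.2] at hc
    simp at hc
  · ext v
    simp only [Finset.mem_inter, mem_nbrs, Finset.mem_biUnion, Finset.mem_filter]
    constructor
    · rintro ⟨h1, h2⟩
      have hxv : x ∈ nbrs G v ∩ B := Finset.mem_inter.2 ⟨mem_nbrs.2 h1.symm, hx⟩
      obtain ⟨y, hy, hyx⟩ := Finset.exists_mem_ne (by rw [hR.card_eq v h2]; norm_num) x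
      exact ⟨y, hY v h2 hy, h2, eq_pair_of_card (hR.card_eq v h2) hxv hy hyx.symm⟩
    · rintro ⟨y, -, h2, h3⟩
      have hxv : x ∈ nbrs G v ∩ B := h3 ▸ (by simp)
      exact ⟨(mem_nbrs.1 (Finset.mem_inter.1 hxv).1).symm, h2⟩

end Bypass

theorem cut_map {U V : Type} (m : V → V → ℝ) (φ : U ↪ V) (X Y : Finset U) :
    cut m (X.map φ) (Y.map φ) = cut (fun x y => m (φ x) (φ y)) X Y := by
  simp [cut]

theorem deficiency_map {U V : Type} (d : V → ℝ) (m : V → V → ℝ) (φ : U ↪ V) (X : Finset U) :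
    deficiency d m (X.map φ) = deficiency (fun x => d (φ x)) (fun x y => m (φ x) (φ y)) X := by
  rw [deficiency, deficiency, cut_map, Finset.sum_map]

theorem exists_bounded_cluster_on {δ : ℝ} (hδ : 0 < δ) : ∃ N : ℕ, ∀ (V : Type) [DecidableEq V]
    (U : Finset V) (F : SimpleGraph {x // x ∈ U}) (m : V → V → ℝ) (d : V → ℝ), U.Nonempty →
    NoK33 F → (∀ x y, 0 ≤ m x y) → (∀ x y, m x y = m y x) →
    (∀ x y : {x // x ∈ U}, m x.1 y.1 ≠ 0 → F.Adj x y) →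
    (∀ x ∈ U, ∑ y ∈ U, m x y ≤ 1) → deficiency d m U ≤ δ / 2 * U.card →
    ∃ W ⊆ U, W.Nonempty ∧ W.card ≤ N ∧ ∀ X ⊆ W,
      deficiency d m X ≤ 2 * cut m X (W \ X) + δ * X.card := by
  obtain ⟨N, hN⟩ := exists_bounded_cluster hδ
  refine ⟨N, fun V _ U F m d hU hF hm hs hmF hd hdef => ?_⟩
  have : Nonempty {x // x ∈ U} := hU.to_subtype
  set φ : {x // x ∈ U} ↪ V := Function.Embedding.subtype _ with hφ
  have huniv : (Finset.univ : Finset {x // x ∈ U}).map φ = U := by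
    ext x
    simp [φ]
  have hd' : ∀ x : {x // x ∈ U}, ∑ y, m (φ x) (φ y) ≤ 1 := by
    intro x
    have h := Finset.sum_map Finset.univ φ fun y => m (φ x) y
    rw [huniv] at h
    exact h.symm.trans_le (hd x.1 x.2)
  obtain ⟨W, hW, hWN, hWX⟩ := hN {x // x ∈ U} F (fun x y => m (φ x) (φ y)) (fun x => d (φ x)) hF
    (fun x y => hm _ _) (fun x y => hs _ _) hmF hd' (by
      rw [← deficiency_map, huniv, Fintype.card_coe]
      exact hdef)
  refine ⟨W.map φ, fun x hx => ?_, hW.map, by rwa [Finset.card_map], fun X hX => ?_⟩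
  · obtain ⟨y, -, rfl⟩ := Finset.mem_map.1 hx
    exact y.2
  · obtain ⟨X', hX', rfl⟩ := Finset.subset_map_iff.1 hX
    have := hWX X' hX'
    rw [deficiency_map, ← Finset.map_sdiff, cut_map, Finset.card_map]
    exact this

end FrugalPlanar

namespace FrugalPlanar

section Select

variable {V : Type} [Fintype V] [DecidableEq V] {G : SimpleGraph V} {B R : Finset V}

theorem card_inter_add_card_sdiff_real (s t : Finset V) :
    ((s ∩ t).card : ℝ) + ((s \ t).card : ℝ) = s.card := by
  rw [← Nat.cast_add, Finset.card_inter_add_card_sdiff]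

theorem IsUniform.exists_type_graph (hR : IsUniform G B R) (hG : NoK33 G) {U : Finset V}
    (hU : U ⊆ B) : ∃ F : SimpleGraph {x // x ∈ U}, NoK33 F ∧
      ∀ x y : {x // x ∈ U}, mult G B R x.1 y.1 ≠ 0 → F.Adj x y := by
  obtain ⟨H, hH, -, -, -, hHadj⟩ := hR.exists_bypass hG (Δ := Fintype.card V)
    fun v => Finset.card_le_univ _
  have hUR : ∀ x : {x // x ∈ U}, x.1 ∉ R := fun x h => hR.notMem x.1 h (hU x.2)
  let φ : {x // x ∈ U} → {v // v ∉ R} := fun x => ⟨x.1, hUR x⟩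
  refine ⟨H.comap φ, hH.of_injective φ ?_ fun _ _ h => h, fun x y hxy => hHadj (φ x) (φ y) ?_ ?_⟩
  · intro x y h
    exact Subtype.ext (Subtype.mk.inj h)
  · intro e
    have e' : x.1 = y.1 := Subtype.mk.inj e
    obtain ⟨v, hv⟩ := Finset.card_pos.1 (Nat.pos_of_ne_zero hxy)
    rw [Finset.mem_filter] at hv
    have := hR.card_eq v hv.1
    rw [hv.2, e'] at this
    simp at this
  · obtain ⟨v, hv⟩ := Finset.card_pos.1 (Nat.pos_of_ne_zero hxy)
    rw [Finset.mem_filter] at hv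
    exact ⟨v, hv.1, hv.2⟩

end Select

/-- A bounded set of vertices whose types support a fractional edge colouring. -/
theorem exists_good_cluster {δ : ℝ} (hδ : 0 < δ) : ∃ N : ℕ, ∀ (V : Type) [Fintype V]
    [DecidableEq V] (G : SimpleGraph V) (Δ : ℕ) (B U R : Finset V), NoK33 G → 0 < Δ →
    (∀ v, (nbrs G v).card ≤ Δ) → U ⊆ B → U.Nonempty → IsUniform G B R →
    (∀ v ∈ R, nbrs G v ∩ B ⊆ U) →
    ((∑ x ∈ U, (nbrs G x \ R).card : ℕ) : ℝ) ≤ δ / 2 * Δ * U.card →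
    (∀ x ∈ U, (1 / 2 + δ) * Δ ≤ (nbrs G x).card) →
    ∃ W ⊆ B, W.Nonempty ∧ W.card ≤ N ∧ ∃ R' ⊆ R, R'.Nonempty ∧ (∀ v ∈ R', nbrs G v ∩ B ⊆ W) ∧
      ∀ X ⊆ W, cut (fun x y => (mult G B R' x y : ℝ) / Δ) X X ≤
        ∑ x ∈ X, (1 - 2 * ((nbrs G x \ R').card / Δ) + δ) := by
  obtain ⟨N, hN⟩ := exists_bounded_cluster_on hδ
  refine ⟨N, fun V _ _ G Δ B U R hG hΔ hdeg hUB hUne hR hRU hsum hlarge => ?_⟩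
  classical
  have hΔ' : (0 : ℝ) < Δ := by exact_mod_cast hΔ
  obtain ⟨F, hF, hFadj⟩ := hR.exists_type_graph hG hUB
  set m : V → V → ℝ := fun x y => (mult G B R x y : ℝ) / Δ with hm
  set d : V → ℝ := fun x => 2 * ((nbrs G x).card / Δ) - 1 with hd
  have hrow : ∀ x ∈ U, ∑ y ∈ U, m x y = ((nbrs G x).card - (nbrs G x \ R).card) / Δ := by
    intro x hx
    rw [← Finset.sum_div, ← Nat.cast_sum, hR.sum_mult hRU (hUB hx),
      ← card_inter_add_card_sdiff_real (nbrs G x) R]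
    ring
  have hdeg1 : ∀ x, ((nbrs G x).card : ℝ) ≤ Δ := fun x => by exact_mod_cast hdeg x
  obtain ⟨W, hWU, hW, hWN, hWX⟩ := hN V U F m d hUne hF
    (fun x y => div_nonneg (Nat.cast_nonneg _) hΔ'.le) (fun x y => by simp only [hm, mult_comm])
    (fun x y h => hFadj x y fun e => h (by simp [hm, e])) (fun x hx => by
      rw [hrow x hx, div_le_one hΔ']
      linarith [hdeg1 x, (Nat.cast_nonneg (nbrs G x \ R).card : (0 : ℝ) ≤ _)]) (by
      have h1 : deficiency d m U ≤ ∑ x ∈ U, ((nbrs G x \ R).card : ℝ) / Δ := by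
        rw [deficiency, cut, ← Finset.sum_sub_distrib]
        refine Finset.sum_le_sum fun x hx => ?_
        rw [hrow x hx, hd, sub_div]
        have := (div_le_one hΔ').2 (hdeg1 x)
        linarith
      rw [← Finset.sum_div, ← Nat.cast_sum] at h1
      refine h1.trans ?_
      rw [div_le_iff₀ hΔ']
      linarith)
  set R' := R.filter fun v => nbrs G v ∩ B ⊆ W with hR'
  have hR'R : R' ⊆ R := Finset.filter_subset _ _
  have hmult : ∀ x ∈ W, ∀ y ∈ W, mult G B R' x y = mult G B R x y := by
    intro x hx y hy
    rw [mult, mult, hR', Finset.filter_filter]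
    congr 1
    refine Finset.filter_congr fun v _ => ⟨fun h => h.2, fun h => ⟨?_, h⟩⟩
    rw [h]
    simp [Finset.insert_subset_iff, hx, hy]
  have hR'W : ∀ v ∈ R', nbrs G v ∩ B ⊆ W := fun v hv => (Finset.mem_filter.1 hv).2
  have hrow' : ∀ x ∈ W, ∑ y ∈ W, m x y =
      ((nbrs G x).card - (nbrs G x \ R').card) / Δ := by
    intro x hx
    rw [← Finset.sum_div, ← Nat.cast_sum, ← Finset.sum_congr rfl fun y hy => hmult x hx y hy,
      (hR.subset hR'R).sum_mult hR'W (hUB (hWU hx)),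
      ← card_inter_add_card_sdiff_real (nbrs G x) R']
    ring
  refine ⟨W, hWU.trans hUB, hW, hWN, R', hR'R, ?_, hR'W, fun X hX => ?_⟩
  · by_contra hne
    rw [Finset.not_nonempty_iff_eq_empty] at hne
    have h0 : cut m W W = 0 := by
      refine Finset.sum_eq_zero fun x hx => Finset.sum_eq_zero fun y hy => ?_
      simp only [hm, ← hmult x hx y hy, hne]
      simp [mult]
    have h1 := hWX W subset_rfl
    rw [deficiency, h0, Finset.sdiff_self] at h1
    have h2 : cut m W ∅ = 0 := by simp [cut]
    have h3 : ∑ _x ∈ W, 2 * δ ≤ ∑ x ∈ W, d x := by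
      refine Finset.sum_le_sum fun x hx => ?_
      have := (le_div_iff₀ hΔ').2 (hlarge x (hWU hx))
      simp only [hd]
      linarith
    rw [Finset.sum_const, nsmul_eq_mul] at h3
    have h4 : (0 : ℝ) < W.card := by exact_mod_cast hW.card_pos
    rw [h2] at h1
    nlinarith [mul_pos hδ h4]
  · have hcut : cut (fun x y => (mult G B R' x y : ℝ) / Δ) X X = cut m X X := by
      refine Finset.sum_congr rfl fun x hx => Finset.sum_congr rfl fun y hy => ?_
      simp only [hm]
      rw [hmult x (hX hx) y (hX hy)]
    rw [hcut]
    have h1 := hWX X hX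
    have h2 : cut m X X + cut m X (W \ X) =
        ∑ x ∈ X, ((nbrs G x).card - (nbrs G x \ R').card : ℝ) / Δ := by
      rw [← cut_union_right Finset.disjoint_sdiff, Finset.union_sdiff_of_subset hX, cut]
      exact Finset.sum_congr rfl fun x hx => hrow' x (hX hx)
    have h3 : ∑ x ∈ X, d x + ∑ x ∈ X, (1 - 2 * (((nbrs G x \ R').card : ℝ) / Δ) + δ) =
        2 * ∑ x ∈ X, ((nbrs G x).card - (nbrs G x \ R').card : ℝ) / Δ + δ * X.card := by
      rw [← Finset.sum_add_distrib, Finset.mul_sum, mul_comm δ, ← nsmul_eq_mul, ← Finset.sum_const,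
        ← Finset.sum_add_distrib]
      refine Finset.sum_congr rfl fun x _ => ?_
      simp only [hd]
      ring
    rw [deficiency] at h1
    linarith

end FrugalPlanar

namespace FrugalPlanar

open scoped Classical in
/-- Edges of a bounded multigraph satisfying the relaxed fractional edge colouring inequalities can
be coloured from large lists, avoiding conflicts between nearby edges. -/
theorem exists_cluster_coloring {W E α β : Type} [Fintype W] [Fintype E] [Nonempty W] {N : ℕ}
    (hN : Fintype.card W ≤ N) {ε : ℝ} (hε : 0 < ε) (hε1 : ε ≤ 1) {Δ : ℕ} (hΔ : 0 < Δ)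
    {μ : W → W → ℕ} (hμs : ∀ x y, μ x y = μ y x) {b : W → ℕ}
    (hdeg : ∀ x, ∑ y, μ x y + b x ≤ Δ)
    (hcut : ∀ X : Finset W, cut (fun x y => (μ x y : ℝ) / Δ) X X ≤
      ∑ x ∈ X, (1 - 2 * ((b x : ℝ) / Δ) + ε / 8))
    (ends : E → Finset W) (hends : ∀ e, (ends e).card = 2)
    (hμ : ∀ x y, x ≠ y → ∀ s : Finset E, (∀ e ∈ s, x ∈ ends e ∧ y ∈ ends e) → s.card ≤ μ x y)
    (A : E → Finset α) (near : E → E → Prop) (hnear_symm : ∀ e e', near e e' → near e' e) {D : ℕ}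
    (hnear : ∀ e, ∀ s : Finset E, (∀ e' ∈ s, near e e') → s.card ≤ D) (π : α → β) {k : ℕ}
    (hπ : ∀ e c, ∀ s ⊆ A e, (∀ a ∈ s, π a = c) → s.card ≤ k) {K : ℝ} (hK : (3 / 2 + ε) * Δ ≤ K)
    (hA : ∀ e, K - ∑ x ∈ ends e, (b x : ℝ) ≤ (A e).card)
    (hbig : 64 * N * N.factorial * (k * D + 1) ≤ ε * Δ)
    (hsum : Fintype.card E * N.factorial *
      Real.exp (-((ε / (32 * N * N.factorial)) ^ 2 / 2)) ^ (Δ / 2) < 1) :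
    ∃ f : E → α, (∀ e, f e ∈ A e) ∧
      (∀ e e', e ≠ e' → (∃ x, x ∈ ends e ∧ x ∈ ends e') → f e ≠ f e') ∧
      ∀ e e', e ≠ e' → near e e' → π (f e) ≠ π (f e') := by
  have hΔ' : (0 : ℝ) < Δ := by exact_mod_cast hΔ
  have hN1 : (1 : ℝ) ≤ N := by
    have := Fintype.card_pos (α := W)
    exact_mod_cast (by omega : 1 ≤ N)
  have hNf : (1 : ℝ) ≤ N.factorial := by exact_mod_cast N.factorial_pos
  have hperm : (Fintype.card (Equiv.Perm W) : ℝ) ≤ N.factorial := by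
    rw [Fintype.card_perm]
    exact_mod_cast Nat.factorial_le hN
  obtain ⟨l, hl, hinv, hl1, hguide⟩ := exists_matching_guide hN hε hε1
    (m := fun x y => (μ x y : ℝ) / Δ) (fun x y => by positivity)
    (fun x y => by simp only [hμs x y]) (a := fun x => (b x : ℝ) / Δ) (fun x => by positivity)
    (fun x => by
      rw [← Finset.sum_div, ← Nat.cast_sum, le_sub_iff_add_le, ← add_div, div_le_one hΔ']
      exact_mod_cast hdeg x) hcut
  have hb : ∀ x, (b x : ℝ) ≤ (1 / 2 + ε / 16) * Δ := by
    intro x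
    have h := hcut {x}
    rw [cut, Finset.sum_singleton, Finset.sum_singleton, Finset.sum_singleton] at h
    have h0 : (0 : ℝ) ≤ (μ x x : ℝ) / Δ := by positivity
    have h1 : (b x : ℝ) / Δ ≤ 1 / 2 + ε / 16 := by linarith
    rwa [div_le_iff₀ hΔ'] at h1
  set ℓ : Finset W → ℝ := fun s => max 0 (K - ∑ x ∈ s, (b x : ℝ)) with hℓ
  have hℓpair : ∀ x y, x ≠ y → K - b x - b y ≤ ℓ {x, y} := by
    intro x y hxy
    rw [hℓ]
    refine le_trans (le_of_eq ?_) (le_max_right _ _)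
    rw [Finset.sum_pair hxy]
    ring
  have hℓlarge : ∀ x y, x ≠ y → (Δ : ℝ) / 2 ≤ ℓ {x, y} := by
    intro x y hxy
    have := hℓpair x y hxy
    nlinarith [hb x, hb y, mul_pos hε hΔ']
  have hAl : ∀ e, ℓ (ends e) ≤ (A e).card := fun e => max_le (Nat.cast_nonneg _) (hA e)
  have hAcard : ∀ e, Δ / 2 ≤ (A e).card := by
    intro e
    obtain ⟨x, y, hxy, he⟩ := Finset.card_eq_two.1 (hends e)
    have h1 := hAl e
    rw [he] at h1
    have h2 := (hℓlarge x y hxy).trans h1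
    have h3 : (Δ : ℝ) ≤ 2 * (A e).card := by linarith
    have h4 : Δ ≤ 2 * (A e).card := by exact_mod_cast h3
    omega
  set η := ε / (32 * N * N.factorial) with hη
  have hη0 : 0 < η := by positivity
  have hq1 : Real.exp (-(η ^ 2 / 2)) ≤ 1 := Real.exp_le_one_iff.2 (by
    have := sq_nonneg η
    linarith)
  obtain ⟨f, hfA, hfe, hfn⟩ := exists_edge_coloring ends hends A near hnear_symm (D := D)
    (fun e => hnear e _ fun e' he' => (Finset.mem_filter.1 he').2) π (k := k)
    (fun e c => hπ e c _ (Finset.filter_subset _ _) fun a ha => (Finset.mem_filter.1 ha).2) ℓ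
    (fun s => le_max_left _ _) hAl hη0 hl hinv hl1 (by
      refine lt_of_le_of_lt ?_ hsum
      have hterm : ∀ e, ∑ _σ : Equiv.Perm W, Real.exp (-(η ^ 2 / 2)) ^ (A e).card ≤
          N.factorial * Real.exp (-(η ^ 2 / 2)) ^ (Δ / 2) := by
        intro e
        rw [Finset.sum_const, nsmul_eq_mul, Finset.card_univ]
        exact mul_le_mul hperm (pow_le_pow_of_le_one (Real.exp_pos _).le hq1 (hAcard e))
          (by positivity) (by positivity)
      refine (Finset.sum_le_sum fun e _ => hterm e).trans (le_of_eq ?_)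
      rw [Finset.sum_const, nsmul_eq_mul, Finset.card_univ, mul_assoc]) (by
      intro x y hxy
      have h1 : ((Finset.univ.filter fun e => ends e = {x, y}).card : ℝ) ≤ μ x y := by
        have := hμ x y hxy (Finset.univ.filter fun e => ends e = {x, y}) fun e he => by
          rw [(Finset.mem_filter.1 he).2]
          simp
        exact_mod_cast this
      have h2 := hguide x y hxy (ℓ {x, y} / Δ) (by
        have h := hℓpair x y hxy
        rw [le_div_iff₀ hΔ']
        have e : (3 / 2 + ε - (b x : ℝ) / Δ - (b y : ℝ) / Δ) * Δ =
            (3 / 2 + ε) * Δ - b x - b y := by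
          field_simp
        rw [e]
        linarith)
      have h3 : (μ x y : ℝ) + ε / (16 * N) * ℓ {x, y} ≤
          ℓ {x, y} * ∑ σ : Equiv.Perm W, if σ x = y then l σ else 0 := by
        have h := mul_le_mul_of_nonneg_right h2 hΔ'.le
        have e1 : ((μ x y : ℝ) / Δ + ε / (16 * N) * (ℓ {x, y} / Δ)) * Δ =
            μ x y + ε / (16 * N) * ℓ {x, y} := by field_simp
        have e2 : ∀ S : ℝ, ℓ {x, y} / Δ * S * Δ = ℓ {x, y} * S := fun S => by field_simp
        rwa [e1, e2] at h
      have h4 : (Fintype.card (Equiv.Perm W) : ℝ) * (η * ℓ {x, y} + k * D + 1) ≤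
          N.factorial * (η * ℓ {x, y} + k * D + 1) := by
        refine mul_le_mul_of_nonneg_right hperm ?_
        have : 0 ≤ η * ℓ {x, y} := mul_nonneg hη0.le (le_max_left _ _)
        positivity
      have h5 : (N.factorial : ℝ) * (η * ℓ {x, y}) = ε / (32 * N) * ℓ {x, y} := by
        rw [hη]
        field_simp
      have h6 : (N.factorial : ℝ) * (k * D + 1) ≤ ε / (32 * N) * ℓ {x, y} := by
        have h7 : (N.factorial : ℝ) * (k * D + 1) ≤ ε / (32 * N) * (Δ / 2) := by
          rw [div_mul_div_comm, le_div_iff₀ (by positivity)]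
          linarith
        exact h7.trans (mul_le_mul_of_nonneg_left (hℓlarge x y hxy) (by positivity))
      have h8 : ε / (16 * N) * ℓ {x, y} = 2 * (ε / (32 * N) * ℓ {x, y}) := by
        field_simp
        ring
      linarith)
  refine ⟨f, hfA, fun e e' hne ⟨x, hx, hx'⟩ => hfe e e' hne ⟨x, Finset.mem_inter.2 ⟨hx, hx'⟩⟩, hfn⟩

end FrugalPlanar

namespace FrugalPlanar

theorem frugallyChoosable_of_cluster {V : Type} [Fintype V] [DecidableEq V] {G : SimpleGraph V}
    (hG : NoK33 G) {B W R : Finset V} {d Δ k t N : ℕ} {ε : ℝ} (hk : 1 ≤ k) (hε : 0 < ε)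
    (hε1 : ε ≤ 1) (hΔ : 0 < Δ) (hB : ∀ w ∉ B, (nbrs G w).card ≤ d)
    (hdeg : ∀ v, (nbrs G v).card ≤ Δ) (hR : IsUniform G B R) (hWB : W ⊆ B) (hW : W.Nonempty)
    (hWN : W.card ≤ N) (hRW : ∀ v ∈ R, nbrs G v ∩ B ⊆ W)
    (hcut : ∀ X ⊆ W, cut (fun x y => (mult G B R x y : ℝ) / Δ) X X ≤
      ∑ x ∈ X, (1 - 2 * ((nbrs G x \ R).card / Δ) + ε / 8))
    (ht : (3 / 2 + ε) * Δ ≤ k * t - k * (d + d * d))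
    (hbig : 64 * N * N.factorial * (k * (d + d * d) + 1) ≤ ε * Δ)
    (hsum : N * Δ * N.factorial *
      Real.exp (-((ε / (32 * N * N.factorial)) ^ 2 / 2)) ^ (Δ / 2) < 1)
    (ih : ∀ H : SimpleGraph {u // u ∉ R}, NoK33 H →
      (∀ u, (nbrs H u).card ≤ Δ) → FrugallyChoosable H k t) : FrugallyChoosable G k t := by
  intro L hL
  obtain ⟨H, hHK, hHd, hH, hHR, -⟩ := hR.exists_bypass hG hdeg
  obtain ⟨c₀, hc₀L, hc₀⟩ := ih H hHK hHd (fun u => L u.1) fun u => hL u.1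
  obtain ⟨c, hcL, hcp, hcu⟩ := exists_partial_coloring G (L := L) hk H hH
    (fun u hu => Or.inr (hHR u hu)) c₀ hc₀L hc₀
  have hmap : ∀ v ∈ R, ((nbrs G v ∩ B).subtype fun x => x ∈ W).map (Function.Embedding.subtype _) =
      nbrs G v ∩ B := fun v hv => Finset.subtype_map_of_mem fun x hx => hRW v hv hx
  set φ : {x // x ∈ W} ↪ V := Function.Embedding.subtype _ with hφ
  have huniv : (Finset.univ : Finset {x // x ∈ W}).map φ = W := by
    ext x
    simp [φ]
  have hne : Nonempty {x // x ∈ W} := hW.to_subtype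
  set ends : {v // v ∈ R} → Finset {x // x ∈ W} :=
    fun e => (nbrs G e.1 ∩ B).subtype fun x => x ∈ W with hends
  have hmem : ∀ e x, x ∈ ends e ↔ x.1 ∈ nbrs G e.1 ∩ B := fun e x => Finset.mem_subtype
  have hcard2 : ∀ e, (ends e).card = 2 := by
    intro e
    rw [← hR.card_eq e.1 e.2, ← hmap e.1 e.2, Finset.card_map]
  have hrows : ∀ x : {x // x ∈ W}, ∑ y : {x // x ∈ W}, mult G B R x.1 y.1 = (nbrs G x.1 ∩ R).card := by
    intro x
    rw [← hR.sum_mult hRW (hWB x.2)]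
    have h := Finset.sum_map Finset.univ φ fun y => mult G B R x.1 y
    rw [huniv] at h
    exact h.symm
  have hRcard : Fintype.card {v // v ∈ R} ≤ N * Δ := by
    rw [Fintype.card_coe]
    have hsub : R ⊆ W.biUnion (nbrs G) := by
      intro v hv
      obtain ⟨x, hx⟩ := Finset.card_pos.1 (by rw [hR.card_eq v hv]; norm_num :
        0 < (nbrs G v ∩ B).card)
      exact Finset.mem_biUnion.2 ⟨x, hRW v hv hx,
        mem_nbrs.2 (mem_nbrs.1 (Finset.mem_inter.1 hx).1).symm⟩
    exact (Finset.card_le_card hsub).trans ((Finset.card_biUnion_le_card_mul _ _ Δ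
      fun x _ => hdeg x).trans (Nat.mul_le_mul_right _ hWN))
  obtain ⟨f, hfA, hfe, hfn⟩ := exists_cluster_coloring (W := {x // x ∈ W}) (E := {v // v ∈ R})
    (N := N) (by rwa [Fintype.card_coe]) hε hε1 hΔ (μ := fun x y => mult G B R x.1 y.1)
    (fun x y => mult_comm _ _) (b := fun x => (nbrs G x.1 \ R).card)
    (fun x => by
      rw [hrows x, Finset.card_inter_add_card_sdiff]
      exact hdeg x.1)
    (fun X => by
      have h := hcut (X.map φ) fun x hx => by
        obtain ⟨y, -, rfl⟩ := Finset.mem_map.1 hx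
        exact y.2
      rw [cut_map, Finset.sum_map] at h
      exact h)
    ends hcard2
    (fun x y hxy s hs => by
      rw [mult, ← Finset.card_map (Function.Embedding.subtype fun v => v ∈ R)]
      refine Finset.card_le_card fun v hv => ?_
      obtain ⟨e, he, rfl⟩ := Finset.mem_map.1 hv
      refine Finset.mem_filter.2 ⟨e.2, eq_pair_of_card (hR.card_eq e.1 e.2)
        ((hmem e x).1 (hs e he).1) ((hmem e y).1 (hs e he).2) fun h => hxy (Subtype.ext h)⟩)
    (fun e => available G B R c L k e.1) (fun e e' => e'.1 ∈ nearby G B e.1)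
    (fun e e' h => nearby_symm G h) (D := d + d * d)
    (fun e s hs => by
      rw [← Finset.card_map (Function.Embedding.subtype fun v => v ∈ R)]
      refine (Finset.card_le_card fun v hv => ?_).trans
        (card_nearby_le G hB (hR.notMem e.1 e.2))
      obtain ⟨e', he', rfl⟩ := Finset.mem_map.1 hv
      exact hs e' he')
    Prod.fst (k := k)
    (fun e a s hsA hsa => by
      rw [← Finset.card_range k]
      refine Finset.card_le_card_of_injOn Prod.snd (fun p hp => ?_) fun p hp q hq h => ?_
      · have := hsA hp
        rw [available, Finset.mem_filter, Finset.mem_product] at this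
        exact this.1.2
      · exact Prod.ext ((hsa p hp).trans (hsa q hq).symm) h)
    (K := k * t - k * (d + d * d)) ht
    (fun e => by
      have h1 := le_card_available G B R c L k e.1
      have h2 : k * (nearby G B e.1).card ≤ k * (d + d * d) :=
        Nat.mul_le_mul_left _ (card_nearby_le G hB (hR.notMem e.1 e.2))
      have h3 := Nat.mul_le_mul_left k (hL e.1)
      have h4 : ∑ x ∈ nbrs G e.1 ∩ B, (nbrs G x \ R).card =
          ∑ x ∈ ends e, (nbrs G x.1 \ R).card := by
        conv_lhs => rw [← hmap e.1 e.2]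
        rw [Finset.sum_map]
        rfl
      rw [h4] at h1
      have h5 : k * t ≤ (available G B R c L k e.1).card + k * (d + d * d) +
          ∑ x ∈ ends e, (nbrs G x.1 \ R).card := by omega
      have h6 : (k * t : ℝ) ≤ (available G B R c L k e.1).card + k * (d + d * d) +
          ∑ x ∈ ends e, ((nbrs G x.1 \ R).card : ℝ) := by exact_mod_cast h5
      linarith)
    (by exact_mod_cast hbig)
    (by
      refine lt_of_le_of_lt ?_ hsum
      have : (Fintype.card {v // v ∈ R} : ℝ) ≤ N * Δ := by exact_mod_cast hRcard
      gcongr)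
  refine exists_frugal_of_selection G (B := B) hk hcL hcp hcu
    (fun v => if h : v ∈ R then f ⟨v, h⟩ else (0, 0)) (fun v hv => ?_) (fun u hu v hv h => ?_)
    (fun u hu v hv huv x hx hxu hxv => ?_)
  · rw [dif_pos hv]
    exact hfA ⟨v, hv⟩
  · rw [dif_pos hu, dif_pos hv]
    exact (hfn ⟨v, hv⟩ ⟨u, hu⟩ (fun e => ((mem_nearby G).1 h).1 (Subtype.mk.inj e).symm) h).symm
  · rw [dif_pos hu, dif_pos hv]
    have hxu' : x ∈ nbrs G u ∩ B := Finset.mem_inter.2 ⟨mem_nbrs.2 hxu.symm, hx⟩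
    have hxv' : x ∈ nbrs G v ∩ B := Finset.mem_inter.2 ⟨mem_nbrs.2 hxv.symm, hx⟩
    refine hfe ⟨u, hu⟩ ⟨v, hv⟩ (fun e => huv (Subtype.mk.inj e)) ⟨⟨x, hRW u hu hxu'⟩, ?_, ?_⟩
    · exact (hmem _ _).2 hxu'
    · exact (hmem _ _).2 hxv'

end FrugalPlanar

namespace FrugalPlanar

theorem exists_uniform_constant : ∃ C : ℕ, 0 < C ∧ ∀ (V : Type) [Fintype V] [DecidableEq V]
    (G : SimpleGraph V) (B : Finset V), NoK33 G → (∀ v ∉ B, 2 ≤ (nbrs G v ∩ B).card) →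
    ∃ R : Finset V, IsUniform G B R ∧ ∑ x ∈ B, (nbrs G x \ R).card ≤ C * B.card := by
  refine ⟨240 * ((1 + 3 * 115440) * (1 + 115440)), by norm_num, fun V _ _ G B hG hB => ?_⟩
  obtain ⟨R, h1, h2, h3, h4⟩ := exists_uniform_part hG B hB
  exact ⟨R, ⟨h1, h2, h3⟩, h4⟩

/-- The bound on `Δ` needed for the probabilistic step holds for all large `Δ`. -/
theorem eventually_mul_pow_lt_one (N M : ℝ) {q : ℝ} (hq0 : 0 ≤ q) (hq1 : q < 1) :
    ∀ᶠ Δ : ℕ in Filter.atTop, N * Δ * M * q ^ (Δ / 2) < 1 := by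
  have h1 := tendsto_self_mul_const_pow_of_lt_one hq0 hq1
  have h2 := tendsto_pow_atTop_nhds_zero_of_lt_one hq0 hq1
  have h3 : Filter.Tendsto (fun n : ℕ => |N * M| * (2 * (n * q ^ n) + q ^ n)) Filter.atTop
      (nhds 0) := by
    simpa using ((h1.const_mul 2).add h2).const_mul |N * M|
  have h4 := (h3.comp (Nat.tendsto_div_const_atTop (two_ne_zero))).eventually_lt_const zero_lt_one
  filter_upwards [h4] with Δ hΔ
  refine lt_of_le_of_lt ?_ hΔ
  have h5 : (Δ : ℝ) ≤ 2 * ((Δ / 2 : ℕ) : ℝ) + 1 := by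
    have : Δ ≤ 2 * (Δ / 2) + 1 := by omega
    exact_mod_cast this
  have h6 : 0 ≤ q ^ (Δ / 2) := pow_nonneg hq0 _
  calc N * Δ * M * q ^ (Δ / 2) = N * M * (Δ * q ^ (Δ / 2)) := by ring
    _ ≤ |N * M| * (Δ * q ^ (Δ / 2)) := mul_le_mul_of_nonneg_right (le_abs_self _) (by positivity)
    _ ≤ |N * M| * ((2 * ((Δ / 2 : ℕ) : ℝ) + 1) * q ^ (Δ / 2)) := by gcongr
    _ = _ := by
      simp only [Function.comp]
      ring

/-- Every vertex outside `B` sees at least two vertices of `B` if none of them is reducible. -/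
theorem two_le_card_of_irreducible {V : Type} [Fintype V] [DecidableEq V] {G : SimpleGraph V}
    {B : Finset V} {Δ K₀ K : ℕ} (hdeg : ∀ v, (nbrs G v).card ≤ Δ) (hK : Δ + K₀ < K)
    (h : ∀ v ∉ B, (nbrs G v ∩ B).card ≤ 2 →
      K ≤ ∑ x ∈ nbrs G v ∩ B, (nbrs G x).card + K₀) {v : V} (hv : v ∉ B) :
    2 ≤ (nbrs G v ∩ B).card := by
  by_contra hlt
  have h1 := h v hv (by omega)
  have h2 : ∑ x ∈ nbrs G v ∩ B, (nbrs G x).card ≤ (nbrs G v ∩ B).card * Δ :=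
    (Finset.sum_le_card_nsmul _ _ _ fun x _ => hdeg x).trans (by rw [smul_eq_mul])
  have h3 : (nbrs G v ∩ B).card * Δ ≤ 1 * Δ := Nat.mul_le_mul_right _ (by omega)
  omega

theorem frugallyChoosable_of_noK33 {ε : ℝ} (hε : 0 < ε) (hε1 : ε ≤ 1) {k : ℕ} (hk : 1 ≤ k) :
    ∃ Δ₀ : ℕ, ∀ Δ ≥ Δ₀, ∀ t : ℕ, (3 / 2 + 2 * ε) * Δ ≤ k * t → ∀ (V : Type) [Fintype V]
      (G : SimpleGraph V), NoK33 G → (∀ v, (nbrs G v).card ≤ Δ) → FrugallyChoosable G k t := by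
  classical
  obtain ⟨C, hC, hunif⟩ := exists_uniform_constant
  obtain ⟨N, hN⟩ := exists_good_cluster (δ := ε / 8) (by positivity)
  set d := 2 * C with hd
  set q : ℝ := Real.exp (-((ε / (32 * N * N.factorial)) ^ 2 / 2)) with hq
  have hlarge : ∀ c : ℝ, ∀ᶠ Δ : ℕ in Filter.atTop, c ≤ ε * Δ := fun c =>
    ((tendsto_natCast_atTop_atTop (R := ℝ)).const_mul_atTop hε).eventually_ge_atTop c
  have hqev : ∀ᶠ Δ : ℕ in Filter.atTop, (N : ℝ) * Δ * N.factorial * q ^ (Δ / 2) < 1 := by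
    by_cases hN0 : N = 0
    · simp [hN0]
    · refine eventually_mul_pow_lt_one _ _ (Real.exp_pos _).le (Real.exp_lt_one_iff.2 ?_)
      have h1 : (0 : ℝ) < N := by exact_mod_cast Nat.pos_of_ne_zero hN0
      have h2 : (0 : ℝ) < N.factorial := by exact_mod_cast N.factorial_pos
      have : 0 < (ε / (32 * N * N.factorial)) ^ 2 / 2 := by positivity
      linarith
  obtain ⟨Δ₀, hΔ₀⟩ := Filter.eventually_atTop.1 ((Filter.eventually_ge_atTop (2 * d + 1)).and
    ((hlarge (k * (d + d * d))).and ((hlarge (64 * N * N.factorial * (k * (d + d * d) + 1))).and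
      (hqev.and (hlarge (32 * C))))))
  refine ⟨Δ₀, fun Δ hΔ t ht V _ G => ?_⟩
  obtain ⟨hΔd, hΔk, hΔbig, hΔq, hΔC⟩ := hΔ₀ Δ hΔ
  have hΔpos : 0 < Δ := by omega
  have hΔ' : (0 : ℝ) < Δ := by exact_mod_cast hΔpos
  induction hn : Fintype.card V using Nat.strong_induction_on generalizing V with
  | _ n ih =>
    intro hG hdeg
    have ihR : ∀ R : Finset V, R.Nonempty → ∀ H : SimpleGraph {u // u ∉ R}, NoK33 H →
        (∀ u, (nbrs H u).card ≤ Δ) → FrugallyChoosable H k t := by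
      intro R hR H hH hHd
      obtain ⟨v, hv⟩ := hR
      refine ih _ ?_ {u // u ∉ R} _ H rfl hH hHd
      rw [← hn]
      exact Fintype.card_subtype_lt (x := v) (by simpa using hv)
    set B : Finset V := Finset.univ.filter fun v => d < (nbrs G v).card with hBdef
    have hB : ∀ w ∉ B, (nbrs G w).card ≤ d := by
      intro w hw
      by_contra h
      exact hw (Finset.mem_filter.2 ⟨Finset.mem_univ _, not_le.1 h⟩)
    by_cases hred : ∃ v, v ∉ B ∧ (nbrs G v ∩ B).card ≤ 2 ∧
        ∑ x ∈ nbrs G v ∩ B, (nbrs G x).card + k * (d + d * d) < k * t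
    · obtain ⟨v, hv, hv2, hvs⟩ := hred
      exact frugallyChoosable_of_reducible_vertex hG hk hB (by omega) hdeg hv hv2 hvs
        (ihR {v} (Finset.singleton_nonempty v))
    push Not at hred
    rcases isEmpty_or_nonempty V with hV | ⟨⟨v₀⟩⟩
    · exact fun L _ => ⟨fun _ => 0, fun v => hV.elim v, fun v => hV.elim v, fun v => hV.elim v⟩
    have h2 : ∀ v ∉ B, 2 ≤ (nbrs G v ∩ B).card := by
      refine fun v hv => two_le_card_of_irreducible hdeg (K₀ := k * (d + d * d)) (K := k * t) ?_
        hred hv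
      have h : (Δ : ℝ) + k * (d + d * d) < k * t := by nlinarith
      exact_mod_cast h
    have hBne : B.Nonempty := by
      by_contra h
      rw [Finset.not_nonempty_iff_eq_empty] at h
      have := h2 v₀ (by simp [h])
      simp [h] at this
    obtain ⟨R, hR, hRsum⟩ := hunif V G B hG h2
    set U := B.filter fun x => (1 / 2 + ε / 8) * Δ ≤ ((nbrs G x).card : ℝ) with hU
    have hUB : U ⊆ B := Finset.filter_subset _ _
    have hRU : ∀ v ∈ R, nbrs G v ∩ B ⊆ U := by
      intro v hv x hx
      have h3 := hred v (hR.notMem v hv) (hR.card_eq v hv).le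
      obtain ⟨y, hy, hyx⟩ := Finset.exists_mem_ne (by rw [hR.card_eq v hv]; norm_num :
        1 < (nbrs G v ∩ B).card) x
      rw [eq_pair_of_card (hR.card_eq v hv) hx hy hyx.symm, Finset.sum_pair hyx.symm] at h3
      have h4 : (k * t : ℝ) ≤ (nbrs G x).card + (nbrs G y).card + k * (d + d * d) := by
        exact_mod_cast h3
      have h5 : ((nbrs G y).card : ℝ) ≤ Δ := by exact_mod_cast hdeg y
      refine Finset.mem_filter.2 ⟨(Finset.mem_inter.1 hx).2, ?_⟩
      nlinarith [mul_pos hε hΔ']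
    have hfew : B.card ≤ 2 * U.card := by
      have h3 : ∀ x ∈ B \ U, d ≤ (nbrs G x \ R).card := by
        intro x hx
        rw [Finset.mem_sdiff] at hx
        rw [Finset.sdiff_eq_self_of_disjoint]
        · exact (Finset.mem_filter.1 hx.1).2.le
        · refine Finset.disjoint_left.2 fun v hv hvR => hx.2 (hRU v hvR ?_)
          exact Finset.mem_inter.2 ⟨mem_nbrs.2 (mem_nbrs.1 hv).symm, hx.1⟩
      have h4 : (B \ U).card * d ≤ ∑ x ∈ B \ U, (nbrs G x \ R).card := by
        rw [← smul_eq_mul]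
        exact Finset.card_nsmul_le_sum _ _ _ h3
      have h5 : ∑ x ∈ B \ U, (nbrs G x \ R).card ≤ ∑ x ∈ B, (nbrs G x \ R).card :=
        Finset.sum_le_sum_of_subset Finset.sdiff_subset
      have h6 : C * (2 * (B \ U).card) ≤ C * B.card := by
        calc C * (2 * (B \ U).card) = (B \ U).card * d := by rw [hd]; ring
          _ ≤ _ := h4.trans (h5.trans hRsum)
      have h7 := Nat.le_of_mul_le_mul_left h6 hC
      have h8 := Finset.card_sdiff_add_card_eq_card hUB
      omega
    have hUne : U.Nonempty := Finset.card_pos.1 (by have := hBne.card_pos; omega)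
    obtain ⟨W, hWB, hW, hWN, R', hR'R, hR'ne, hR'W, hcut⟩ := hN V G Δ B U R hG hΔpos hdeg hUB hUne
      hR hRU (by
        have h3 : ∑ x ∈ U, (nbrs G x \ R).card ≤ C * (2 * U.card) :=
          (Finset.sum_le_sum_of_subset hUB).trans (hRsum.trans (Nat.mul_le_mul_left _ hfew))
        have h4 : ((∑ x ∈ U, (nbrs G x \ R).card : ℕ) : ℝ) ≤ C * (2 * U.card) := by
          exact_mod_cast h3
        have h5 : (0 : ℝ) ≤ U.card := Nat.cast_nonneg _
        nlinarith) fun x hx => (Finset.mem_filter.1 hx).2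
    exact frugallyChoosable_of_cluster hG hk hε hε1 hΔpos hB hdeg (hR.subset hR'R) hWB hW hWN hR'W
      hcut (by nlinarith) (by exact_mod_cast hΔbig) hΔq (ihR R' hR'ne)

end FrugalPlanar

/-- For each `ε > 0` and `k ≥ 1` there is `Δ_{ε,k}` such that every planar graph with
`Δ(G) ≥ Δ_{ε,k}` satisfies `ch_k(G) ≤ (3 + ε)Δ(G)/(2k)`. -/
theorem frugalChoiceNumber_planar_asymptotic (ε : ℝ) (hε : 0 < ε) (k : ℕ) (hk : 1 ≤ k) :
    ∃ Δεk : ℕ, ∀ (V : Type) [Fintype V] (G : SimpleGraph V) [DecidableRel G.Adj],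
      G.IsPlanar → Δεk ≤ G.maxDegree →
      (G.frugalChoiceNumber k : ℝ) ≤ (3 + ε) * (G.maxDegree : ℝ) / (2 * k) := by
  classical
  obtain ⟨Δ₀, hΔ₀⟩ := FrugalPlanar.frugallyChoosable_of_noK33 (ε := min 1 (ε / 8)) (by positivity)
    (min_le_left _ _) hk
  obtain ⟨M, hM⟩ := exists_nat_ge (4 * k / ε)
  refine ⟨max Δ₀ M, fun V _ G _ hG hΔ => ?_⟩
  have hk' : (0 : ℝ) < k := by exact_mod_cast hk
  set Δ := G.maxDegree
  have hMΔ : 4 * k ≤ ε * Δ := by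
    have : (M : ℝ) ≤ Δ := by exact_mod_cast (le_max_right _ _).trans hΔ
    have := hM.trans this
    rwa [div_le_iff₀' hε] at this
  set x : ℝ := (3 + ε) * Δ / (2 * k) with hx
  have hx0 : 0 ≤ x := by positivity
  have hfloor : (3 / 2 + 2 * min 1 (ε / 8)) * Δ ≤ k * (⌊x⌋₊ : ℝ) := by
    have h1 : x < ⌊x⌋₊ + 1 := Nat.lt_floor_add_one x
    have h2 : k * x = (3 + ε) * Δ / 2 := by rw [hx]; field_simp
    have h3 : min 1 (ε / 8) * Δ ≤ ε / 8 * Δ := by gcongr; exact min_le_right _ _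
    nlinarith
  have hdeg : ∀ v, (FrugalPlanar.nbrs G v).card ≤ Δ := by
    intro v
    have : FrugalPlanar.nbrs G v = G.neighborFinset v := by
      ext w
      simp [FrugalPlanar.nbrs]
    rw [this, G.card_neighborFinset_eq_degree]
    exact G.degree_le_maxDegree v
  have hch := hΔ₀ Δ ((le_max_left _ _).trans hΔ) ⌊x⌋₊ hfloor V G
    (FrugalPlanar.noK33_of_isPlanar hG) hdeg
  have hle : G.frugalChoiceNumber k ≤ ⌊x⌋₊ :=
    Nat.sInf_le fun L hL => hch L fun v => (hL v).ge
  exact (Nat.cast_le.2 hle).trans (Nat.floor_le hx0)
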